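/- arXiv:2109.03129 — 2 statements merged into one kernel-verified Lean document; each statement's English description precedes it below -/
import Mathlib

section
/- For every ε > 0 there exists n_ε ∈ ℕ such that for every n ≥ n_ε there exists a natural number e with 1 ≤ e ≤ ⌊n²/4⌋ and s(n,e) − s_b(n,e) ≥ ((1 − ε)/e^{3/4}) · s(n,e). -/
/- The adjacency matrix (over `ℝ`) of a simple graph on `Fin n`. -/
open scoped Classical in
noncomputable def adjMat {n : ℕ} (G : SimpleGraph (Fin n)) : Matrix (Fin n) (Fin n) ℝ :=
  fun i j => if G.Adj i j then 1 else 0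

lemma adjMat_isHermitian {n : ℕ} (G : SimpleGraph (Fin n)) :
    (adjMat G).IsHermitian := by
  classical
  unfold Matrix.IsHermitian
  ext i j
  simp only [Matrix.conjTranspose_apply, adjMat]
  rw [show star (if G.Adj j i then (1:ℝ) else 0) = (if G.Adj j i then (1:ℝ) else 0) from
    star_trivial _]
  exact if_congr (G.adj_comm j i) rfl rfl

/-- The eigenvalues of the adjacency matrix of `G`. -/
noncomputable def graphEigs {n : ℕ} (G : SimpleGraph (Fin n)) : Fin n → ℝ :=
  (adjMat_isHermitian G).eigenvalues

/-- `λ₁(G)`, the largest adjacency eigenvalue. -/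
noncomputable def lamMax {n : ℕ} (G : SimpleGraph (Fin n)) : ℝ := ⨆ i, graphEigs G i

/-- `λₙ(G)`, the smallest adjacency eigenvalue. -/
noncomputable def lamMin {n : ℕ} (G : SimpleGraph (Fin n)) : ℝ := ⨅ i, graphEigs G i

/-- The spread `s(G) = λ₁(G) - λₙ(G)`. -/
noncomputable def spread {n : ℕ} (G : SimpleGraph (Fin n)) : ℝ := lamMax G - lamMin G

/-- `s(n,e)`: the maximum spread over all simple graphs on `n` vertices with `e` edges. -/
noncomputable def spreadMaxNE (n e : ℕ) : ℝ :=
  ⨆ G : {G : SimpleGraph (Fin n) // G.edgeSet.ncard = e}, spread G.1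

/-- `s_b(n,e)`: the maximum spread over all bipartite simple graphs on `n` vertices
with `e` edges (bipartite = 2-colorable). -/
noncomputable def spreadMaxBipNE (n e : ℕ) : ℝ :=
  ⨆ G : {G : SimpleGraph (Fin n) // G.edgeSet.ncard = e ∧ G.Colorable 2}, spread G.1

open Matrix in
lemma spec_decomp {n : ℕ} (G : SimpleGraph (Fin n)) :
    ∃ U : Matrix (Fin n) (Fin n) ℝ, Uᵀ * U = 1 ∧ U * Uᵀ = 1 ∧
      adjMat G = U * diagonal (graphEigs G) * Uᵀ := by
  have h := (adjMat_isHermitian G).spectral_theorem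
  rw [Unitary.conjStarAlgAut_apply] at h
  refine ⟨(adjMat_isHermitian G).eigenvectorUnitary, ?_, ?_, ?_⟩
  · have := Unitary.coe_star_mul_self (adjMat_isHermitian G).eigenvectorUnitary
    simpa [star_eq_conjTranspose] using this
  · have := Unitary.coe_mul_star_self (adjMat_isHermitian G).eigenvectorUnitary
    simpa [star_eq_conjTranspose] using this
  · simpa [star_eq_conjTranspose, Function.comp_def, graphEigs] using h

open Matrix in
lemma sum_eig_pow4 {n : ℕ} (G : SimpleGraph (Fin n)) :
    ∑ i, (graphEigs G i) ^ 4 = trace ((adjMat G * adjMat G) * (adjMat G * adjMat G)) := by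
  obtain ⟨U, h1, h2, h3⟩ := spec_decomp G
  set D := diagonal (graphEigs G) with hD
  have e1 : adjMat G * adjMat G = U * (D * D) * Uᵀ := by
    calc adjMat G * adjMat G = U * D * (Uᵀ * U) * D * Uᵀ := by
          rw [h3]; simp only [Matrix.mul_assoc]
      _ = _ := by rw [h1]; simp only [Matrix.mul_assoc, Matrix.mul_one]
  have e2 : (adjMat G * adjMat G) * (adjMat G * adjMat G) = U * (D * D * (D * D)) * Uᵀ := by
    calc _ = U * (D * D) * (Uᵀ * U) * (D * D) * Uᵀ := by
          rw [e1]; simp only [Matrix.mul_assoc]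
      _ = _ := by rw [h1]; simp only [Matrix.mul_assoc, Matrix.mul_one]
  rw [e2, Matrix.trace_mul_comm, ← Matrix.mul_assoc, h1, Matrix.one_mul, hD]
  simp only [diagonal_mul_diagonal, trace_diagonal]
  exact Finset.sum_congr rfl fun i _ => by ring

open Matrix in
lemma quad_form {n : ℕ} (G : SimpleGraph (Fin n)) :
    ∃ V : (Fin n → ℝ) → (Fin n → ℝ), ∀ x, (∑ i, V x i ^ 2 = ∑ i, x i ^ 2) ∧
      (∑ i, ∑ j, adjMat G i j * x i * x j = ∑ i, graphEigs G i * V x i ^ 2) := by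
  obtain ⟨U, h1, h2, h3⟩ := spec_decomp G
  refine ⟨fun x => Uᵀ *ᵥ x, fun x => ⟨?_, ?_⟩⟩
  · have : (Uᵀ *ᵥ x) ⬝ᵥ (Uᵀ *ᵥ x) = x ⬝ᵥ x := by
      rw [Matrix.dotProduct_mulVec, Matrix.vecMul_transpose, Matrix.mulVec_mulVec, h2,
        Matrix.one_mulVec]
    simpa [dotProduct, sq] using this
  · have : x ⬝ᵥ (adjMat G *ᵥ x) = (Uᵀ *ᵥ x) ⬝ᵥ (diagonal (graphEigs G) *ᵥ (Uᵀ *ᵥ x)) := by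
      rw [h3, Matrix.mul_assoc, ← Matrix.mulVec_mulVec, ← Matrix.mulVec_mulVec,
        Matrix.dotProduct_mulVec, Matrix.mulVec_transpose]
    have l : x ⬝ᵥ (adjMat G *ᵥ x) = ∑ i, ∑ j, adjMat G i j * x i * x j := by
      simp only [dotProduct, mulVec, Finset.mul_sum]
      exact Finset.sum_congr rfl fun i _ => Finset.sum_congr rfl fun j _ => by ring
    rw [← l, this]
    simp only [dotProduct, mulVec_diagonal]
    exact Finset.sum_congr rfl fun i _ => by ring

lemma eig_le_max {n : ℕ} (G : SimpleGraph (Fin n)) (i : Fin n) : graphEigs G i ≤ lamMax G :=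
  le_ciSup (f := graphEigs G) (Set.finite_range _).bddAbove i

lemma min_le_eig {n : ℕ} (G : SimpleGraph (Fin n)) (i : Fin n) : lamMin G ≤ graphEigs G i :=
  ciInf_le (f := graphEigs G) (Set.finite_range _).bddBelow i

lemma spread_ge {n : ℕ} (G : SimpleGraph (Fin n)) (x y : Fin n → ℝ) (m : ℝ)
    (hx : ∑ i, x i ^ 2 = m) (hy : ∑ i, y i ^ 2 = m) :
    (∑ i, ∑ j, adjMat G i j * x i * x j) - (∑ i, ∑ j, adjMat G i j * y i * y j)
      ≤ spread G * m := by
  obtain ⟨V, hV⟩ := quad_form G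
  rw [(hV x).2, (hV y).2, spread, sub_mul]
  apply sub_le_sub
  · rw [← hx, ← (hV x).1, Finset.mul_sum]
    exact Finset.sum_le_sum fun i _ => mul_le_mul_of_nonneg_right (eig_le_max G i) (sq_nonneg _)
  · rw [← hy, ← (hV y).1, Finset.mul_sum]
    exact Finset.sum_le_sum fun i _ => mul_le_mul_of_nonneg_right (min_le_eig G i) (sq_nonneg _)

open Matrix in
lemma spread_pow4_le {n : ℕ} (hn : 0 < n) (G : SimpleGraph (Fin n)) :
    spread G ^ 4 ≤ 8 * trace ((adjMat G * adjMat G) * (adjMat G * adjMat G)) := by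
  have : Nonempty (Fin n) := ⟨⟨0, hn⟩⟩
  obtain ⟨a, ha⟩ := exists_eq_ciSup_of_finite (f := graphEigs G)
  obtain ⟨b, hb⟩ := exists_eq_ciInf_of_finite (f := graphEigs G)
  rw [← sum_eig_pow4, spread, lamMax, lamMin, ← ha, ← hb]
  have h0 : 0 ≤ ∑ i, graphEigs G i ^ 4 := Finset.sum_nonneg fun i _ => by positivity
  by_cases hab : a = b
  · subst hab
    simpa using h0
  · have : graphEigs G a ^ 4 + graphEigs G b ^ 4 ≤ ∑ i, graphEigs G i ^ 4 := by
      rw [← Finset.sum_pair (f := fun i => graphEigs G i ^ 4) hab]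
      exact Finset.sum_le_sum_of_subset_of_nonneg (Finset.subset_univ _)
        fun i _ _ => by positivity
    generalize graphEigs G a = u at *
    generalize graphEigs G b = v at *
    have k1 : (u - v) ^ 2 ≤ 2 * (u ^ 2 + v ^ 2) := by nlinarith [sq_nonneg (u + v)]
    have k2 : ((u - v) ^ 2) ^ 2 ≤ (2 * (u ^ 2 + v ^ 2)) ^ 2 :=
      pow_le_pow_left₀ (sq_nonneg _) k1 2
    nlinarith [sq_nonneg (u ^ 2 - v ^ 2)]

open Classical in
lemma sum_adj {n : ℕ} (G : SimpleGraph (Fin n)) :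
    ∑ i, ∑ j, adjMat G i j = 2 * (G.edgeSet.ncard : ℝ) := by
  have h := G.two_mul_card_edgeFinset
  have h2 : G.edgeSet.ncard = G.edgeFinset.card := by
    rw [← SimpleGraph.coe_edgeFinset, Set.ncard_coe_finset]
  rw [h2]
  have h3 : (2 * (G.edgeFinset.card : ℝ)) = ((2 * G.edgeFinset.card : ℕ) : ℝ) := by push_cast; ring
  rw [h3, h, Finset.card_filter, ← Finset.univ_product_univ, Finset.sum_product]
  push_cast
  rfl

/-- abstract counting of four-cycles in an almost complete bipartite graph -/
lemma count_W {ι : Type*} (S T : Finset ι) (f : ι → ι → ℝ)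
    (h01 : ∀ i j, f i j = 0 ∨ f i j = 1) (e N M : ℝ)
    (he : ∑ i ∈ S, ∑ j ∈ T, f i j = e) (hN : (S.card : ℝ) * T.card = e + N)
    (hS : (S.card : ℝ) ≤ M) (hT : (T.card : ℝ) ≤ M) :
    ∑ i ∈ S, ∑ j ∈ T, ∑ k ∈ S, ∑ l ∈ T, f i j * f k j * f k l * f i l
      ≤ e ^ 2 - 2 * N * (e - M * (N + 1)) := by
  classical
  set g : ι → ι → ℝ := fun i j => 1 - f i j with hg
  have f0 : ∀ i j, 0 ≤ f i j := fun i j => by rcases h01 i j with h | h <;> simp [h]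
  have g0 : ∀ i j, 0 ≤ g i j := fun i j => by rcases h01 i j with h | h <;> simp [hg, h]
  have f1 : ∀ i j, f i j ≤ 1 := fun i j => by rcases h01 i j with h | h <;> simp [h]
  have hgN : ∑ i ∈ S, ∑ j ∈ T, g i j = N := by
    simp only [hg, Finset.sum_sub_distrib, he]
    simp
    linarith
  have hN0 : 0 ≤ N := by
    rw [← hgN]; exact Finset.sum_nonneg fun i _ => Finset.sum_nonneg fun j _ => g0 i j
  -- key count
  have key : ∀ i ∈ S, ∀ l ∈ T, g i l * (e + N - M * (N + 1)) ≤
      g i l * ((∑ j ∈ T, f i j) * (∑ k ∈ S, f k l)) := by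
    intro i hi l hl
    rcases h01 i l with h | h
    · have gil : g i l = 1 := by simp [hg, h]
      rw [gil, one_mul, one_mul]
      have r : ∑ j ∈ T, f i j = T.card - ∑ j ∈ T, g i j := by simp [hg]
      have c : ∑ k ∈ S, f k l = S.card - ∑ k ∈ S, g k l := by simp [hg]
      have z0 : 0 ≤ ∑ j ∈ T, g i j := Finset.sum_nonneg fun j _ => g0 i j
      have w0 : 0 ≤ ∑ k ∈ S, g k l := Finset.sum_nonneg fun k _ => g0 k l
      have zw : ∑ j ∈ T, g i j + ∑ k ∈ S, g k l ≤ N + 1 := by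
        have b1 := Finset.add_sum_erase S (fun k => ∑ j ∈ T, g k j) hi
        have b2 := Finset.add_sum_erase S (fun k => g k l) hi
        simp only [gil] at b1 b2
        have : ∑ k ∈ S.erase i, g k l ≤ ∑ k ∈ S.erase i, ∑ j ∈ T, g k j :=
          Finset.sum_le_sum fun k _ =>
            Finset.single_le_sum (f := fun j => g k j) (fun j _ => g0 k j) hl
        linarith
      rw [r, c]
      generalize ∑ j ∈ T, g i j = z at *
      generalize ∑ k ∈ S, g k l = w at *
      nlinarith [mul_nonneg z0 w0, mul_le_mul_of_nonneg_right hS z0,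
        mul_le_mul_of_nonneg_right hT w0,
        mul_le_mul_of_nonneg_left zw (le_trans (Nat.cast_nonneg _) hS)]
    · have gil : g i l = 0 := by simp [hg, h]
      simp [gil]
  have keysum : N * (e + N - M * (N + 1)) ≤
      ∑ i ∈ S, ∑ j ∈ T, ∑ k ∈ S, ∑ l ∈ T, f i j * f k l * g i l := by
    have : ∑ i ∈ S, ∑ j ∈ T, ∑ k ∈ S, ∑ l ∈ T, f i j * f k l * g i l =
        ∑ i ∈ S, ∑ l ∈ T, g i l * ((∑ j ∈ T, f i j) * (∑ k ∈ S, f k l)) := by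
      refine Finset.sum_congr rfl fun i _ => ?_
      simp only [Finset.sum_mul_sum]
      simp only [Finset.mul_sum]
      conv_rhs => rw [Finset.sum_comm]
      refine Finset.sum_congr rfl fun j _ => ?_
      rw [Finset.sum_comm]
      exact Finset.sum_congr rfl fun l _ => Finset.sum_congr rfl fun k _ => by ring
    rw [this]
    conv_lhs => rw [← hgN]
    rw [Finset.sum_mul, hgN]
    refine Finset.sum_le_sum fun i hi => ?_
    rw [Finset.sum_mul]
    exact Finset.sum_le_sum fun l hl => key i hi l hl
  have keysum2 : ∑ i ∈ S, ∑ j ∈ T, ∑ k ∈ S, ∑ l ∈ T, f i j * f k l * g k j =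
      ∑ i ∈ S, ∑ j ∈ T, ∑ k ∈ S, ∑ l ∈ T, f i j * f k l * g i l := by
    have sw : ∀ F : ι → ι → ι → ι → ℝ, ∑ i ∈ S, ∑ j ∈ T, ∑ k ∈ S, ∑ l ∈ T, F i j k l =
        ∑ i ∈ S, ∑ j ∈ T, ∑ k ∈ S, ∑ l ∈ T, F k l i j := by
      intro F
      have := Finset.sum_comm (s := S ×ˢ T) (t := S ×ˢ T)
        (f := fun x y => F x.1 x.2 y.1 y.2)
      simpa only [Finset.sum_product] using this
    rw [sw]
    refine Finset.sum_congr rfl fun i _ => Finset.sum_congr rfl fun j _ =>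
      Finset.sum_congr rfl fun k _ => Finset.sum_congr rfl fun l _ => by ring
  have gg : ∑ i ∈ S, ∑ j ∈ T, ∑ k ∈ S, ∑ l ∈ T, f i j * f k l * (g i l * g k j) ≤ N ^ 2 := by
    have : N ^ 2 = ∑ i ∈ S, ∑ j ∈ T, ∑ k ∈ S, ∑ l ∈ T, g i l * g k j := by
      rw [sq]
      conv_lhs => rw [← hgN]
      rw [Finset.sum_mul, hgN]
      refine Finset.sum_congr rfl fun i _ => ?_
      rw [← hgN]
      simp only [Finset.mul_sum, Finset.sum_mul]
      rw [Finset.sum_comm]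
    rw [this]
    refine Finset.sum_le_sum fun i _ => Finset.sum_le_sum fun j _ =>
      Finset.sum_le_sum fun k _ => Finset.sum_le_sum fun l _ => ?_
    have a1 : f i j * f k l ≤ 1 := mul_le_one₀ (f1 _ _) (f0 _ _) (f1 _ _)
    exact mul_le_of_le_one_left (mul_nonneg (g0 _ _) (g0 _ _)) a1
  have ee : e ^ 2 = ∑ i ∈ S, ∑ j ∈ T, ∑ k ∈ S, ∑ l ∈ T, f i j * f k l := by
    rw [sq, ← he]
    simp only [Finset.sum_mul, Finset.mul_sum]
    exact Finset.sum_congr rfl fun i _ => Finset.sum_congr rfl fun j _ =>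
      Finset.sum_congr rfl fun k _ => Finset.sum_congr rfl fun l _ => by ring
  have tot : ∑ i ∈ S, ∑ j ∈ T, ∑ k ∈ S, ∑ l ∈ T, f i j * f k j * f k l * f i l =
      (∑ i ∈ S, ∑ j ∈ T, ∑ k ∈ S, ∑ l ∈ T, f i j * f k l)
      - (∑ i ∈ S, ∑ j ∈ T, ∑ k ∈ S, ∑ l ∈ T, f i j * f k l * g i l)
      - (∑ i ∈ S, ∑ j ∈ T, ∑ k ∈ S, ∑ l ∈ T, f i j * f k l * g k j)
      + (∑ i ∈ S, ∑ j ∈ T, ∑ k ∈ S, ∑ l ∈ T, f i j * f k l * (g i l * g k j)) := by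
    simp only [← Finset.sum_sub_distrib, ← Finset.sum_add_distrib]
    refine Finset.sum_congr rfl fun i _ => Finset.sum_congr rfl fun j _ =>
      Finset.sum_congr rfl fun k _ => Finset.sum_congr rfl fun l _ => ?_
    simp only [hg]; ring
  rw [tot, keysum2, ← ee]
  nlinarith
lemma adjMat_symm {n : ℕ} (G : SimpleGraph (Fin n)) (i j : Fin n) :
    adjMat G i j = adjMat G j i := by
  classical
  unfold adjMat
  exact if_congr (G.adj_comm i j) rfl rfl

lemma adjMat_01 {n : ℕ} (G : SimpleGraph (Fin n)) (i j : Fin n) :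
    adjMat G i j = 0 ∨ adjMat G i j = 1 := by
  simp only [adjMat]; split_ifs <;> simp

open Matrix in
lemma bip_spread {n : ℕ} (hn : 0 < n) (G : SimpleGraph (Fin n)) (hc : G.Colorable 2) :
    ∃ a b : ℕ, a + b = n ∧ G.edgeSet.ncard ≤ a * b ∧ ∀ M e N : ℝ, (a : ℝ) ≤ M → (b : ℝ) ≤ M →
      e = G.edgeSet.ncard → e + N = a * b →
      spread G ^ 4 ≤ 16 * (e ^ 2 - 2 * N * (e - M * (N + 1))) := by
  classical
  obtain ⟨C⟩ := hc
  set S : Finset (Fin n) := Finset.univ.filter (fun i => C i = 0) with hS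
  set T : Finset (Fin n) := Finset.univ.filter (fun i => ¬ C i = 0) with hT
  set f := adjMat G with hf
  have z : ∀ i j, C i = C j → f i j = 0 := by
    intro i j h
    simp only [hf, adjMat]
    rw [if_neg]
    intro hadj
    exact C.valid hadj h
  have hsym : ∀ i j, f i j = f j i := adjMat_symm G
  have fin2 : ∀ x y : Fin 2, x ≠ 0 → y ≠ 0 → x = y := by decide
  have sS : ∀ i ∈ S, ∀ h : Fin n → ℝ, ∑ j, f i j * h j = ∑ j ∈ T, f i j * h j := by
    intro i hi h
    symm
    apply Finset.sum_subset (Finset.subset_univ _)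
    intro j _ hj
    simp only [hS, hT, Finset.mem_filter, Finset.mem_univ, true_and, not_not] at hi hj
    rw [z i j (hi.trans hj.symm), zero_mul]
  have sT : ∀ i ∈ T, ∀ h : Fin n → ℝ, ∑ j, f i j * h j = ∑ j ∈ S, f i j * h j := by
    intro i hi h
    symm
    apply Finset.sum_subset (Finset.subset_univ _)
    intro j _ hj
    simp only [hS, hT, Finset.mem_filter, Finset.mem_univ, true_and] at hi hj
    rw [z i j (fin2 _ _ hi hj), zero_mul]
  have split : ∀ h : Fin n → ℝ, ∑ i, h i = ∑ i ∈ S, h i + ∑ i ∈ T, h i := fun h =>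
    (Finset.sum_filter_add_sum_filter_not _ _ _).symm
  have he : ∑ i ∈ S, ∑ j ∈ T, f i j = (G.edgeSet.ncard : ℝ) := by
    have h := sum_adj G
    rw [split] at h
    have h1 : ∑ i ∈ S, ∑ j, f i j = ∑ i ∈ S, ∑ j ∈ T, f i j :=
      Finset.sum_congr rfl fun i hi => by simpa using sS i hi (fun _ => 1)
    have h2 : ∑ i ∈ T, ∑ j, f i j = ∑ i ∈ S, ∑ j ∈ T, f i j := by
      have sc : ∑ i ∈ S, ∑ j ∈ T, f i j = ∑ j ∈ T, ∑ i ∈ S, f i j := Finset.sum_comm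
      rw [sc]
      refine Finset.sum_congr rfl fun i hi => ?_
      have := sT i hi (fun _ => 1)
      simp only [mul_one] at this
      rw [this]
      exact Finset.sum_congr rfl fun j _ => adjMat_symm G i j
    rw [← hf, h1, h2] at h
    linarith
  have htr : trace ((f * f) * (f * f)) =
      2 * ∑ i ∈ S, ∑ j ∈ T, ∑ k ∈ S, ∑ l ∈ T, f i j * f k j * f k l * f i l := by
    have e1 : trace ((f * f) * (f * f)) =
        ∑ i, ∑ j, f i j * ∑ k, f j k * ∑ l, f k l * f l i := by
      rw [Matrix.mul_assoc]
      simp only [trace, diag, Matrix.mul_apply]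
    rw [e1, split, two_mul]
    congr 1
    · refine Finset.sum_congr rfl fun i hi => ?_
      rw [sS i hi]
      refine Finset.sum_congr rfl fun j hj => ?_
      rw [sT j hj, Finset.mul_sum]
      refine Finset.sum_congr rfl fun k hk => ?_
      rw [sS k hk, Finset.mul_sum, Finset.mul_sum]
      refine Finset.sum_congr rfl fun l _ => ?_
      have x1 := hsym j k; have x2 := hsym l i; rw [x1, x2]; ring
    · rw [Finset.sum_comm (s := S)]
      refine Finset.sum_congr rfl fun i hi => ?_
      rw [sT i hi]
      refine Finset.sum_congr rfl fun j hj => ?_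
      rw [sS j hj, Finset.mul_sum, Finset.sum_comm (s := S)]
      refine Finset.sum_congr rfl fun k hk => ?_
      rw [sT k hk, Finset.mul_sum, Finset.mul_sum]
      refine Finset.sum_congr rfl fun l _ => ?_
      have x1 := hsym i j; have x2 := hsym k l; rw [x1, x2]; ring
  refine ⟨S.card, T.card, ?_, ?_, ?_⟩
  · have := Finset.card_filter_add_card_filter_not (s := (Finset.univ : Finset (Fin n)))
      (fun i => C i = 0)
    simpa using this
  · have : (G.edgeSet.ncard : ℝ) ≤ ((S.card * T.card : ℕ) : ℝ) := by
      rw [← he]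
      calc _ ≤ ∑ i ∈ S, ∑ j ∈ T, (1 : ℝ) := Finset.sum_le_sum fun i _ =>
            Finset.sum_le_sum fun j _ => by rcases adjMat_01 G i j with h | h <;> simp [hf, h]
        _ = _ := by simp
    exact_mod_cast this
  · intro M e N h1 h2 h3 h4
    have := count_W S T f (adjMat_01 G) e N M (by rw [he, h3]) h4.symm h1 h2
    have h5 := spread_pow4_le hn G
    rw [← hf, htr] at h5
    linarith

/-- complete bipartite graph plus one edge inside the second class -/
def kpq (n p : ℕ) : SimpleGraph (Fin n) where
  Adj i j := (i.val < p ∧ p ≤ j.val) ∨ (j.val < p ∧ p ≤ i.val) ∨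
    (i.val = p ∧ j.val = p + 1) ∨ (i.val = p + 1 ∧ j.val = p)
  symm := ⟨by intro i j h; omega⟩
  loopless := ⟨by intro i h; omega⟩

lemma kpq_adj (n p : ℕ) (i j : Fin n) : adjMat (kpq n p) i j =
    (if i.val < p then 1 else 0) * (if p ≤ j.val then 1 else 0) +
    (if p ≤ i.val then 1 else 0) * (if j.val < p then 1 else 0) +
    (if i.val = p then 1 else 0) * (if j.val = p + 1 then 1 else 0) +
    (if i.val = p + 1 then 1 else 0) * (if j.val = p then 1 else 0) := by
  have h : (kpq n p).Adj i j ↔ (i.val < p ∧ p ≤ j.val) ∨ (j.val < p ∧ p ≤ i.val) ∨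
    (i.val = p ∧ j.val = p + 1) ∨ (i.val = p + 1 ∧ j.val = p) := Iff.rfl
  unfold adjMat
  by_cases hA : (kpq n p).Adj i j
  · rw [if_pos hA]
    rw [h] at hA
    split_ifs <;> first | omega | norm_num
  · rw [if_neg hA]
    rw [h] at hA
    split_ifs <;> first | omega | norm_num

lemma four_sum {n : ℕ} (P Q u v x : Fin n → ℝ) :
    ∑ i, ∑ j, (P i * Q j + Q i * P j + u i * v j + v i * u j) * x i * x j =
      2 * (∑ i, P i * x i) * (∑ i, Q i * x i) + 2 * (∑ i, u i * x i) * (∑ i, v i * x i) := by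
  have h : ∀ a b : Fin n → ℝ, (∑ i, a i * x i) * (∑ i, b i * x i) =
      ∑ i, ∑ j, a i * b j * x i * x j := by
    intro a b
    rw [Finset.sum_mul_sum]
    exact Finset.sum_congr rfl fun i _ => Finset.sum_congr rfl fun j _ => by ring
  have : 2 * (∑ i, P i * x i) * (∑ i, Q i * x i) + 2 * (∑ i, u i * x i) * (∑ i, v i * x i) =
      (∑ i, P i * x i) * (∑ i, Q i * x i) + (∑ i, Q i * x i) * (∑ i, P i * x i) +
      (∑ i, u i * x i) * (∑ i, v i * x i) + (∑ i, v i * x i) * (∑ i, u i * x i) := by ring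
  rw [this]
  simp only [h, ← Finset.sum_add_distrib]
  exact Finset.sum_congr rfl fun i _ => Finset.sum_congr rfl fun j _ => by ring

lemma kpq_sums {n p q : ℕ} (hpq : p + q = n) (hq : 2 ≤ q) (s t : ℝ) :
    (∑ i : Fin n, (if i.val < p then (1:ℝ) else 0) * (if i.val < p then s else t) = p * s) ∧
    (∑ i : Fin n, (if p ≤ i.val then (1:ℝ) else 0) * (if i.val < p then s else t) = q * t) ∧
    (∑ i : Fin n, (if i.val = p then (1:ℝ) else 0) * (if i.val < p then s else t) = t) ∧
    (∑ i : Fin n, (if i.val = p + 1 then (1:ℝ) else 0) * (if i.val < p then s else t) = t) ∧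
    (∑ i : Fin n, (if i.val < p then s else t) ^ 2 = p * s ^ 2 + q * t ^ 2) := by
  subst hpq
  obtain ⟨r, rfl⟩ : ∃ r, q = r + 2 := ⟨q - 2, by omega⟩
  refine ⟨?_, ?_, ?_, ?_, ?_⟩
  · rw [Fin.sum_univ_add]; simp
  · rw [Fin.sum_univ_add]; simp
    exact Finset.sum_eq_zero fun i _ => by simp
  · rw [Fin.sum_univ_add]; simp [Fin.sum_univ_succ]
    exact Finset.sum_eq_zero fun i _ => by simp [(Fin.isLt i).ne]
  · rw [Fin.sum_univ_add]; simp [Fin.sum_univ_succ]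
    exact Finset.sum_eq_zero fun i _ => by
      rw [if_neg]; have := Fin.isLt i; omega
  · rw [Fin.sum_univ_add]; simp

lemma kpq_edges {n p q : ℕ} (hpq : p + q = n) (hq : 2 ≤ q) :
    (kpq n p).edgeSet.ncard = p * q + 1 := by
  have h := sum_adj (kpq n p)
  have h2 := four_sum (fun i : Fin n => if i.val < p then 1 else 0)
    (fun i : Fin n => if p ≤ i.val then 1 else 0) (fun i : Fin n => if i.val = p then 1 else 0)
    (fun i : Fin n => if i.val = p + 1 then 1 else 0) (fun i : Fin n => if i.val < p then 1 else 1)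
  obtain ⟨k1, k2, k3, k4, k5⟩ := kpq_sums hpq hq 1 1
  rw [k1, k2, k3, k4] at h2
  simp only [← kpq_adj, ite_self, mul_one] at h2
  rw [h] at h2
  have : ((kpq n p).edgeSet.ncard : ℝ) = ((p * q + 1 : ℕ) : ℝ) := by push_cast; linarith
  exact_mod_cast this

lemma kpq_spread {n p q : ℕ} (hpq : p + q = n) (hp : 1 ≤ p) (hq : 2 ≤ q) :
    2 * √((p : ℝ) * q) ≤ spread (kpq n p) := by
  have h2 := four_sum (fun i : Fin n => if i.val < p then 1 else 0)
    (fun i : Fin n => if p ≤ i.val then 1 else 0) (fun i : Fin n => if i.val = p then 1 else 0)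
    (fun i : Fin n => if i.val = p + 1 then 1 else 0)
    (fun i : Fin n => if i.val < p then √q else √p)
  obtain ⟨k1, k2, k3, k4, k5⟩ := kpq_sums hpq hq √q √p
  have h2' := four_sum (fun i : Fin n => if i.val < p then 1 else 0)
    (fun i : Fin n => if p ≤ i.val then 1 else 0) (fun i : Fin n => if i.val = p then 1 else 0)
    (fun i : Fin n => if i.val = p + 1 then 1 else 0)
    (fun i : Fin n => if i.val < p then √q else -√p)
  obtain ⟨k1', k2', k3', k4', k5'⟩ := kpq_sums hpq hq √q (-√p)
  rw [k1, k2, k3, k4] at h2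
  rw [k1', k2', k3', k4'] at h2'
  simp only [← kpq_adj] at h2 h2'
  have h := spread_ge (kpq n p) _ _ (p * √q ^ 2 + q * √p ^ 2) k5 (by rw [k5', neg_sq])
  rw [h2, h2'] at h
  rw [Real.sqrt_mul (by positivity)]
  have a : √(p:ℝ) ^ 2 = p := Real.sq_sqrt (by positivity)
  have b : √(q:ℝ) ^ 2 = q := Real.sq_sqrt (by positivity)
  rw [a, b] at h
  have hp0 : (0:ℝ) < p := by exact_mod_cast hp
  have hq0 : (0:ℝ) < q := by exact_mod_cast (by omega : 0 < q)
  have hpq0 : (0:ℝ) < 2 * (p * q) := by positivity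
  refine le_of_mul_le_mul_right ?_ hpq0
  nlinarith
/-- choice of parameters -/
lemma params (ε : ℝ) (h0 : 0 < ε) (h1 : ε < 1) : ∃ n0 : ℕ, ∀ n : ℕ, n0 ≤ n →
    ∃ p q d : ℕ, p + q = n ∧ q = p + d ∧ 1 ≤ p ∧ 2 ≤ d ∧
      (d : ℝ) ^ 2 / 4 + d - 2 ≤ p ∧
      (p : ℝ) * (1 + (1 - ε) * √(2 * n)) ≤ (d - 2) * (p + 1 - d) := by
  obtain ⟨K, hK⟩ := exists_nat_ge (40 / ε)
  refine ⟨K ^ 2, fun n hn => ?_⟩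
  set s := √(2 * (n : ℝ)) with hs
  have hs2 : s ^ 2 = 2 * n := Real.sq_sqrt (by positivity)
  have hKs : (K : ℝ) ≤ s := by
    apply Real.le_sqrt_of_sq_le
    have : ((K ^ 2 : ℕ) : ℝ) ≤ n := by exact_mod_cast hn
    push_cast at this
    have : (0:ℝ) ≤ n := by positivity
    linarith
  have hes : 40 ≤ ε * s := by
    have := hK.trans hKs
    rw [div_le_iff₀ h0] at this
    linarith
  have hs40 : 40 ≤ s := by nlinarith
  set θ := 1 - ε / 2 with hθ
  have hτn : θ * s ≤ n := by nlinarith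
  set p := ⌈((n : ℝ) - θ * s) / 2⌉₊ with hp
  have p1 : ((n : ℝ) - θ * s) / 2 ≤ p := Nat.le_ceil _
  have p2 : (p : ℝ) < ((n : ℝ) - θ * s) / 2 + 1 := Nat.ceil_lt_add_one (by linarith)
  have hθs : 20 ≤ θ * s := by nlinarith
  have h2p : 2 * p ≤ n := by
    have : ((2 * p : ℕ) : ℝ) ≤ (n : ℝ) := by push_cast; linarith
    exact_mod_cast this
  obtain ⟨d, hd⟩ : ∃ d, n = 2 * p + d := ⟨n - 2 * p, by omega⟩
  have hdr : (n : ℝ) = 2 * p + d := by exact_mod_cast hd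
  have d1 : (d : ℝ) ≤ θ * s := by linarith
  have d2 : θ * s - 2 ≤ d := by linarith
  have hp8 : s ^ 2 / 8 ≤ p := by nlinarith
  have hdd : (d : ℝ) ^ 2 ≤ (θ * s) ^ 2 := pow_le_pow_left₀ (by positivity) d1 2
  have hθ1 : θ ≤ 1 := by linarith
  have hθ0 : 0 ≤ θ := by linarith
  have hd3 : (d:ℝ) ^ 2 ≤ 8 * p := by
    have : (θ * s) ^ 2 ≤ s ^ 2 :=
      pow_le_pow_left₀ (by linarith) (mul_le_of_le_one_left (by linarith) hθ1) 2
    linarith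
  refine ⟨p, p + d, d, by omega, rfl, ?_, ?_, ?_, ?_⟩
  · have : (0:ℝ) < p := by nlinarith
    exact_mod_cast this
  · have : (2:ℝ) ≤ d := by linarith
    exact_mod_cast this
  · have e1 : 1 - θ ^ 2 ≥ ε / 2 := by nlinarith
    have e2 : s * 20 ≤ s ^ 2 * (1 - θ ^ 2) := by
      have : s ^ 2 * (ε / 2) ≤ s ^ 2 * (1 - θ ^ 2) := mul_le_mul_of_nonneg_left e1 (sq_nonneg s)
      have : s * 40 ≤ s * (ε * s) := mul_le_mul_of_nonneg_left hes (by linarith)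
      linarith
    have e3 : (θ * s) ^ 2 = s ^ 2 - s ^ 2 * (1 - θ ^ 2) := by ring
    have e4 : θ * s ≤ s := mul_le_of_le_one_left (by linarith) hθ1
    linarith
  · have hp0 : (0:ℝ) ≤ p := by positivity
    have hd2 : (2:ℝ) ≤ d := by linarith
    have e1 : (p:ℝ) * (d - 10) ≤ (d - 2) * (p + 1 - d) := by nlinarith
    refine le_trans (mul_le_mul_of_nonneg_left ?_ hp0) e1
    have e5 : θ * s = s - ε * s / 2 := by rw [hθ]; ring
    linarith

lemma bip_num (p q d e N y : ℝ) (hpr : 1 ≤ p) (hq : 1 ≤ q) (hdr : 2 ≤ d) (y1 : 1 ≤ y)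
    (her : e = p * q + 1) (A1 : d ^ 2 / 4 + d - 2 ≤ p) (A2 : p * y ≤ (d - 2) * (p + 1 - d))
    (N1 : d - 2 ≤ N) (N2 : N + 1 ≤ d ^ 2 / 4) :
    e * y ≤ N * (e - q * (N + 1)) ∧ y ≤ e := by
  have N3 : p * y ≤ N * (p - 1 - N) := by
    have : 0 ≤ (N - (d - 2)) * (p - 1 - (d - 2) - N) :=
      mul_nonneg (by linarith) (by linarith)
    have h2 : N * (p - 1 - N) = (N - (d - 2)) * (p - 1 - (d - 2) - N)
      + (d - 2) * (p + 1 - d) := by ring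
    linarith
  have N0 : 0 ≤ N := by linarith
  have Ny : y ≤ N := by
    have : N * (p - 1 - N) ≤ N * p := mul_le_mul_of_nonneg_left (by linarith) N0
    have : p * y ≤ p * N := by linarith
    exact le_of_mul_le_mul_left this (by linarith)
  constructor
  · rw [her]
    have h1 : q * (p * y) ≤ q * (N * (p - 1 - N)) :=
      mul_le_mul_of_nonneg_left N3 (by linarith)
    have h2 : N * (p * q + 1 - q * (N + 1)) = q * (N * (p - 1 - N)) + N := by ring
    rw [h2]
    linarith
  · have h1 : N ≤ p := by linarith
    have h2 : p * 1 ≤ p * q := mul_le_mul_of_nonneg_left hq (by linarith)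
    linarith

set_option maxHeartbeats 1000000 in
theorem bipartite_spread_lower (ε : ℝ) (hε : 0 < ε) :
    ∃ nε : ℕ, ∀ n : ℕ, nε ≤ n → ∃ e : ℕ, 1 ≤ e ∧ e ≤ n ^ 2 / 4 ∧
      ((1 - ε) / (e : ℝ) ^ ((3 : ℝ) / 4)) * spreadMaxNE n e ≤
        spreadMaxNE n e - spreadMaxBipNE n e := by
  set δ := min ε (1 / 2) with hδ
  have hδ0 : 0 < δ := lt_min hε (by norm_num)
  have hδ1 : δ < 1 := lt_of_le_of_lt (min_le_right _ _) (by norm_num)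
  have hδε : δ ≤ ε := min_le_left _ _
  obtain ⟨n0, hn0⟩ := params δ hδ0 hδ1
  refine ⟨n0, fun n hn => ?_⟩
  obtain ⟨p, q, d, hpq, hqd, hp, hd, A1, A2⟩ := hn0 n hn
  have hq : 2 ≤ q := by omega
  have hn1 : 0 < n := by omega
  have hpr : (1:ℝ) ≤ p := by exact_mod_cast hp
  have hdr : (2:ℝ) ≤ d := by exact_mod_cast hd
  have hqr : (q:ℝ) = p + d := by exact_mod_cast hqd
  have hnr : (n:ℝ) = p + q := by exact_mod_cast hpq.symm
  have h4e : 4 * (p * q + 1) ≤ n ^ 2 := by rw [← hpq, hqd]; nlinarith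
  refine ⟨p * q + 1, by omega, by omega, ?_⟩
  set e : ℕ := p * q + 1 with he
  have her : (e:ℝ) = p * q + 1 := by rw [he]; push_cast; ring
  have he1 : (1:ℝ) ≤ e := by rw [her]; nlinarith
  set s := √(2 * (n:ℝ)) with hs
  have hs2 : s ^ 2 = 2 * n := Real.sq_sqrt (by positivity)
  have hs0 : 0 ≤ s := Real.sqrt_nonneg _
  set c := (1 - δ) / (e : ℝ) ^ ((3 : ℝ) / 4) with hc
  have hE : 1 ≤ (e : ℝ) ^ ((3 : ℝ) / 4) := Real.one_le_rpow he1 (by norm_num)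
  have hc0 : 0 ≤ c := div_nonneg (by linarith) (by linarith)
  have hc1 : c ≤ 1 := by rw [hc, div_le_one (by linarith)]; linarith
  have hce : c * e ≤ (1 - δ) * (s / 2) := by
    have e1 : c * e = (1 - δ) * (e : ℝ) ^ ((1:ℝ) / 4) := by
      have : (e:ℝ) = (e : ℝ) ^ ((3 : ℝ) / 4) * (e : ℝ) ^ ((1:ℝ) / 4) := by
        rw [← Real.rpow_add (by linarith)]; norm_num
      rw [hc, div_mul_eq_mul_div, div_eq_iff (by linarith)]
      conv_lhs => rw [this]
      ring
    rw [e1]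
    apply mul_le_mul_of_nonneg_left _ (by linarith)
    have e2 : (e:ℝ) ≤ (s / 2) ^ (4:ℝ) := by
      have h4 : 4 * (e:ℝ) ≤ n ^ 2 := by exact_mod_cast h4e
      have : (s / 2) ^ (4:ℝ) = (s ^ 2) ^ 2 / 16 := by
        rw [show (4:ℝ) = ((4:ℕ):ℝ) by norm_num, Real.rpow_natCast]; ring
      rw [this, hs2]; linarith
    calc (e : ℝ) ^ ((1:ℝ) / 4) ≤ ((s / 2) ^ (4:ℝ)) ^ ((1:ℝ) / 4) :=
          Real.rpow_le_rpow (by linarith) e2 (by norm_num)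
      _ = s / 2 := by rw [← Real.rpow_mul (by linarith)]; norm_num
  set y := 1 + (1 - δ) * s with hy
  -- lower bound
  have low : 2 * √((p:ℝ) * q) ≤ spreadMaxNE n e := by
    refine (kpq_spread hpq hp hq).trans ?_
    exact le_ciSup (f := fun G : {G : SimpleGraph (Fin n) // G.edgeSet.ncard = e} => spread G.1)
      (Set.finite_range _).bddAbove ⟨kpq n p, kpq_edges hpq hq⟩
  set R := √((p:ℝ) * q) with hR
  have hR2 : R ^ 2 = p * q := Real.sq_sqrt (by positivity)
  have hR0 : 0 ≤ R := Real.sqrt_nonneg _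
  have up : spreadMaxBipNE n e ≤ (1 - c) * (2 * R) := by
    have hb0 : 0 ≤ (1 - c) * (2 * R) := mul_nonneg (by linarith) (by linarith)
    refine Real.iSup_le (fun ⟨G, hG, hcol⟩ => ?_) hb0
    obtain ⟨a, b, hab, hle, hW⟩ := bip_spread hn1 G hcol
    rw [hG] at hle
    -- integer facts
    have dz : ((a:ℤ) - b) ^ 2 ≤ ((d:ℤ) - 2) ^ 2 ∧ a ≤ q ∧ b ≤ q := by
      have i1 : ((a:ℤ) - b) ^ 2 < (d:ℤ) ^ 2 := by
        have l1 : (p:ℤ) * q + 1 ≤ a * b := by exact_mod_cast hle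
        have l2 : (a:ℤ) + b = p + q := by exact_mod_cast hab.trans hpq.symm
        have l3 : (q:ℤ) = p + d := by exact_mod_cast hqd
        have : ((a:ℤ) - b) ^ 2 = ((a:ℤ) + b) ^ 2 - 4 * (a * b) := by ring
        rw [this, l2]
        have : (d:ℤ) = q - p := by linarith
        rw [this]; nlinarith
      have i2 := abs_lt_of_sq_lt_sq i1 (by positivity)
      rw [abs_lt] at i2
      have i3 : |(a:ℤ) - b| ≤ d - 2 := by rw [abs_le]; omega
      refine ⟨?_, by omega, by omega⟩
      rw [← sq_abs]
      exact pow_le_pow_left₀ (abs_nonneg _) i3 2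
    obtain ⟨dz, haq, hbq⟩ := dz
    have dr : ((a:ℝ) - b) ^ 2 ≤ ((d:ℝ) - 2) ^ 2 := by exact_mod_cast dz
    have habr : (a:ℝ) + b = p + q := by exact_mod_cast hab.trans hpq.symm
    set N : ℝ := a * b - e with hN
    have hid : 4 * ((a:ℝ) * b) = (p + q) ^ 2 - (a - b) ^ 2 := by rw [← habr]; ring
    have hid2 : 4 * ((p:ℝ) * q) = (p + q) ^ 2 - (d:ℝ) ^ 2 := by rw [hqr]; ring
    have N1 : (d:ℝ) - 2 ≤ N := by
      have h3 : ((d:ℝ) - 2) ^ 2 = d ^ 2 - 4 * d + 4 := by ring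
      linarith
    have N2 : N + 1 ≤ (d:ℝ) ^ 2 / 4 := by
      have h3 := sq_nonneg ((a:ℝ) - b)
      linarith
    have W := hW q e N (by exact_mod_cast haq) (by exact_mod_cast hbq) (by rw [hG])
      (by rw [hN]; ring)
    have y1 : 1 ≤ y := by
      have : 0 ≤ (1 - δ) * s := mul_nonneg (by linarith) hs0
      linarith
    obtain ⟨N4, ye⟩ := bip_num p q d e N y hpr (by linarith) hdr y1 her A1 A2 N1 N2
    have Y : (e:ℝ) - y ≤ (1 - c) ^ 2 * R ^ 2 := by
      rw [hR2, ← sub_eq_of_eq_add her]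
      have : (1 - 2 * c) * ((e:ℝ) - 1) ≤ (1 - c) ^ 2 * ((e:ℝ) - 1) :=
        mul_le_mul_of_nonneg_right (by nlinarith [sq_nonneg c]) (by linarith)
      have h3 : (1 - 2 * c) * ((e:ℝ) - 1) = e - 1 - 2 * (c * e) + 2 * c := by ring
      linarith
    have Y2 : ((e:ℝ) - y) ^ 2 ≤ ((1 - c) ^ 2 * R ^ 2) ^ 2 :=
      pow_le_pow_left₀ (by linarith) Y 2
    have fin : spread G ^ 4 ≤ ((1 - c) * (2 * R)) ^ 4 := by
      have : ((1 - c) * (2 * R)) ^ 4 = 16 * ((1 - c) ^ 2 * R ^ 2) ^ 2 := by ring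
      rw [this]
      have h3 : ((e:ℝ) - y) ^ 2 = e ^ 2 - 2 * (e * y) + y ^ 2 := by ring
      have h4 : 2 * N * (e - q * (N + 1)) = 2 * (N * (e - q * (N + 1))) := by ring
      have h5 := sq_nonneg y
      rw [h4] at W
      linarith
    exact le_of_pow_le_pow_left₀ (by norm_num) hb0 fin
  have hs' : 0 ≤ spreadMaxNE n e := by linarith
  have m1 : (1 - ε) / (e : ℝ) ^ ((3 : ℝ) / 4) * spreadMaxNE n e ≤ c * spreadMaxNE n e := by
    apply mul_le_mul_of_nonneg_right _ hs'
    rw [hc]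
    exact div_le_div_of_nonneg_right (by linarith) (by linarith)
  have m2 : (1 - c) * (2 * R) ≤ (1 - c) * spreadMaxNE n e :=
    mul_le_mul_of_nonneg_left low (by linarith)
  linarith
end

section
/- Let W : [0,1]² → [0,1] be Lebesgue-measurable with W(x,y) = W(y,x) for a.e. (x,y) ∈ [0,1]². Then for all f, g ∈ L²[0,1] with ‖f‖₂ = ‖g‖₂ = 1, one has ∫₀¹∫₀¹ W(x,y)·(f(x)f(y) − g(x)g(y)) dx dy ≤ 2/√3. -/
open MeasureTheory

/-- Lebesgue measure restricted to the unit square `[0,1]²`. -/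
noncomputable def unitSq : Measure (ℝ × ℝ) :=
  volume.restrict (Set.Icc (0 : ℝ) 1 ×ˢ Set.Icc (0 : ℝ) 1)

/-- Lebesgue measure restricted to the unit interval `[0,1]`. -/
noncomputable def unitInt : Measure ℝ := volume.restrict (Set.Icc (0 : ℝ) 1)

/-- A graphon: a measurable function with values in `[0,1]` which is symmetric
almost everywhere on `[0,1]²`. -/
def IsGraphon (W : ℝ → ℝ → ℝ) : Prop :=
  Measurable (Function.uncurry W) ∧ (∀ x y, W x y ∈ Set.Icc (0 : ℝ) 1) ∧
    (∀ᵐ p : ℝ × ℝ ∂unitSq, W p.1 p.2 = W p.2 p.1)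

/-- A unit function of `L²[0,1]`: measurable with `∫₀¹ f² = 1`. -/
def IsUnitL2 (f : ℝ → ℝ) : Prop :=
  Measurable f ∧ (∫ x in Set.Icc (0 : ℝ) 1, (f x) ^ 2) = 1

/-- The quadratic form `∫₀¹∫₀¹ W(x,y) f(x) f(y) dx dy`. -/
noncomputable def quadForm (W : ℝ → ℝ → ℝ) (f : ℝ → ℝ) : ℝ :=
  ∫ x in Set.Icc (0 : ℝ) 1, ∫ y in Set.Icc (0 : ℝ) 1, W x y * f x * f y

/-- `μ(W)`, the maximum eigenvalue of the kernel operator associated to `W`. -/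
noncomputable def graphonMu (W : ℝ → ℝ → ℝ) : ℝ :=
  sSup {r : ℝ | ∃ f : ℝ → ℝ, IsUnitL2 f ∧ r = quadForm W f}

/-- `ν(W)`, the minimum eigenvalue of the kernel operator associated to `W`. -/
noncomputable def graphonNu (W : ℝ → ℝ → ℝ) : ℝ :=
  sInf {r : ℝ | ∃ f : ℝ → ℝ, IsUnitL2 f ∧ r = quadForm W f}

/-- The spread `spr(W) = μ(W) − ν(W)` of a graphon. -/
noncomputable def graphonSpr (W : ℝ → ℝ → ℝ) : ℝ := graphonMu W - graphonNu W

/-- `f` is a `lam`-eigenfunction of the kernel operator of `W`. -/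
def IsEigenfunction (W : ℝ → ℝ → ℝ) (lam : ℝ) (f : ℝ → ℝ) : Prop :=
  ∀ᵐ x ∂unitInt, (∫ y in Set.Icc (0 : ℝ) 1, W x y * f y) = lam * f x

set_option linter.unusedVariables false

section S1

/-- Concave interpolation on a triangle. -/
lemma tri_lemma (q ρ c s X Xm ρm K0 k1 k2 H : ℝ) (hk2 : 0 ≤ k2) (hqc : q ≤ c) (hcX : c ≤ X)
    (hXm : X ≤ Xm) (hq : q < Xm) (hqρ : q ^ 2 + ρ ^ 2 = 1)
    (hcs : c ^ 2 + s ^ 2 = 1) (hs : 0 ≤ s) (hm : Xm ^ 2 + ρm ^ 2 ≤ 1)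
    (h1 : H ≤ q * (K0 + k1) + k2 * ρ) (h2 : H ≤ Xm * K0 + k1 * q + k2 * ρ)
    (h3 : H ≤ Xm * (K0 + k1) + k2 * ρm) : H ≤ X * K0 + k1 * c + k2 * s := by
  have hd : 0 < Xm - q := by linarith
  have hconc : ρ * (Xm - c) + ρm * (c - q) ≤ (Xm - q) * s := by
    apply abs_le_of_sq_le_sq' _ (by positivity) |>.2
    have e1 : 0 ≤ (Xm - c) := by linarith
    have e2 : 0 ≤ c - q := by linarith
    have hs2 : s ^ 2 = 1 - c ^ 2 := by linarith
    have hr2 : ρ ^ 2 = 1 - q ^ 2 := by linarith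
    have hJ : (ρ * (Xm - c) + ρm * (c - q)) ^ 2 ≤
        (Xm - q) * (ρ ^ 2 * (Xm - c) + ρm ^ 2 * (c - q)) := by
      nlinarith [mul_nonneg (mul_nonneg e1 e2) (sq_nonneg (ρ - ρm))]
    have hJ2 : ρ ^ 2 * (Xm - c) + ρm ^ 2 * (c - q) ≤ (Xm - q) * s ^ 2 := by
      have : ρm ^ 2 * (c - q) ≤ (1 - Xm ^ 2) * (c - q) :=
        mul_le_mul_of_nonneg_right (by linarith) e2
      rw [hs2, hr2]
      nlinarith [mul_nonneg (mul_nonneg e1 e2) hd.le]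
    calc _ ≤ _ := hJ
      _ ≤ (Xm - q) * ((Xm - q) * s ^ 2) := mul_le_mul_of_nonneg_left hJ2 hd.le
      _ = _ := by ring
  have key : (Xm - q) * H ≤ (Xm - q) * (X * K0 + k1 * c + k2 * s) := by
    have a1 := mul_le_mul_of_nonneg_left h1 (sub_nonneg.2 hXm)
    have a2 := mul_le_mul_of_nonneg_left h2 (sub_nonneg.2 hcX)
    have a3 := mul_le_mul_of_nonneg_left h3 (sub_nonneg.2 hqc)
    have a4 := mul_le_mul_of_nonneg_left hconc hk2
    nlinarith
  exact le_of_mul_le_mul_left key hd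


lemma poly1 (ρ : ℝ) (hρ : 0 ≤ ρ) :
    0.43305 ≤ (1 - ρ ^ 2 * 0.54449) * (0.4695 - 0.17335 * ρ ^ 2) + 0.608 * ρ ^ 3 := by
  have h1 := mul_nonneg (by linarith : 0 ≤ ρ + 0.235) (sq_nonneg (ρ - 0.47))
  nlinarith [sq_nonneg (ρ ^ 2)]

lemma poly2 (ρ : ℝ) (hρ : 0 ≤ ρ) :
    0.43305 ≤ 0.99 * (0.4695 - 0.17335 * ρ ^ 2)
      - 0.639 * ((1 - ρ ^ 2) * (ρ ^ 2 * 0.54449 - 0.01)) + 0.608 * ρ ^ 3 := by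
  have h1 := mul_nonneg (by linarith : 0 ≤ ρ + 0.21675) (sq_nonneg (ρ - 0.4335))
  have h2 := sq_nonneg (ρ ^ 2 - 0.4335 ^ 2)
  nlinarith

lemma poly3 (ρ : ℝ) (hρ : 0.4582 ≤ ρ) :
    0.0044 ≤ - 0.36605 * ((1 - ρ ^ 2) * (ρ ^ 2 * 0.54449 - 0.01)) + 0.366 * ρ ^ 3 := by
  have hu : 0 ≤ ρ - 0.4582 := by linarith
  obtain ⟨u, rfl⟩ : ∃ u, ρ = 0.4582 + u := ⟨ρ - 0.4582, by ring⟩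
  have hu : 0 ≤ u := by linarith
  have h2 : 0 ≤ u ^ 2 := by positivity
  have h3 : 0 ≤ u ^ 3 := by positivity
  have h4 : 0 ≤ u ^ 4 := by positivity
  ring_nf
  linarith

lemma poly4 (ρ : ℝ) (hρ : 0 ≤ ρ) :
    0.43305 ≤ (1 - ρ ^ 2 * 0.52967) * (0.4695 - 0.17335 * ρ ^ 2) + 0.608 * ρ ^ 3 := by
  have h1 := mul_nonneg (by linarith : 0 ≤ ρ + 0.2315) (sq_nonneg (ρ - 0.463))
  nlinarith [sq_nonneg (ρ ^ 2)]

lemma poly5 (ρ : ℝ) (hρ : 0 ≤ ρ) :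
    0.43305 ≤ (0.4695 - 0.17335 * ρ ^ 2)
      - 0.639 * ((1 - ρ ^ 2) * (ρ ^ 2 * 0.52967)) + 0.608 * ρ ^ 3 := by
  have h1 := mul_nonneg (by linarith : 0 ≤ ρ + 0.215) (sq_nonneg (ρ - 0.43))
  have h2 := sq_nonneg (ρ ^ 2 - 0.43 ^ 2)
  nlinarith

lemma certC (t q ρ X : ℝ) (ht2 : t ^ 2 = 3) (ht0 : 0 ≤ t) (htl : 1.732 ≤ t) (htu : t ≤ 1.7321)
    (hq : 0 ≤ q) (hρ : 0 ≤ ρ) (hqρ : q ^ 2 + ρ ^ 2 = 1) (hqX : q ≤ X)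
    (hX : X ≤ 1) (hm : q ^ 2 < 7 / 10) : ∃ n1 s1 n0 s0 : ℝ, n1 ^ 2 + s1 ^ 2 ≤ 1 ∧ n0 ^ 2 + s0 ^ 2 ≤ 1 ∧ 0 ≤ s1 ∧
      ∀ c s : ℝ, q ≤ c → c ≤ X → 0 ≤ s → c ^ 2 + s ^ 2 = 1 →
      t / 4 ≤ X * ((n1 * q ^ 2 + t * s1 * ρ ^ 2) / 2 - (n1 - n0) * q ^ 2)
        + (n1 - n0) * q ^ 2 * c + (s0 - s1) * ρ ^ 2 * s := by
  have hq1 : q ≤ 1 := by nlinarith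
  have hρ2 : ρ ^ 2 = 1 - q ^ 2 := by linarith
  have hq8 : q ≤ 0.837 := by nlinarith
  have hr1 : (0.547 : ℝ) ≤ ρ := by nlinarith
  have hf : 0.93 ≤ ρ * (1 + q) := by
    apply abs_le_of_sq_le_sq' _ (by positivity) |>.2
    rw [mul_pow, hρ2]; nlinarith [mul_nonneg hq hq, mul_nonneg (mul_nonneg hq hq) hq, mul_nonneg hq (sub_nonneg.2 hq8), mul_nonneg (mul_nonneg hq hq) (sub_nonneg.2 hq8), mul_nonneg (mul_nonneg (mul_nonneg hq hq) hq) (sub_nonneg.2 hq8)]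
  refine ⟨t / 2, 1 / 2, 0.24, 0.97, by nlinarith, by norm_num, by norm_num, ?_⟩
  intro c s h1 h2 h3 h4
  have hr3 : ρ ^ 2 * ρ = (1 - q) * (ρ * (1 + q)) := by rw [hρ2]; ring
  have := tri_lemma q ρ c s X 1 0 ((t / 2 * q ^ 2 + t * (1 / 2) * ρ ^ 2) / 2 - (t / 2 - 0.24) * q ^ 2)
    ((t / 2 - 0.24) * q ^ 2) ((0.97 - 1 / 2) * ρ ^ 2) (t / 4) (by positivity) h1 h2 hX (by linarith)
    hqρ h4 h3 (by norm_num) ?_ ?_ ?_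
  · linarith
  · have : (0.97 - 1 / 2) * ρ ^ 2 * ρ = 0.47 * ((1 - q) * (ρ * (1 + q))) := by rw [← hr3]; ring
    rw [this, hρ2]
    nlinarith [mul_le_mul_of_nonneg_left hf (sub_nonneg.2 hq1)]
  · have : (0.97 - 1 / 2) * ρ ^ 2 * ρ = 0.47 * ((1 - q) * (ρ * (1 + q))) := by rw [← hr3]; ring
    rw [this, hρ2]
    have : 0 ≤ (1 - q) * (0.47 * (ρ * (1 + q)) - (t / 2 - 0.24) * q ^ 2) := by
      apply mul_nonneg (by linarith); nlinarith
    nlinarith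
  · rw [hρ2]; nlinarith

lemma certB1 (t q ρ X : ℝ) (ht2 : t ^ 2 = 3) (ht0 : 0 ≤ t) (htl : 1.732 ≤ t) (htu : t ≤ 1.7321)
    (hq : 0 ≤ q) (hρ : 0 ≤ ρ) (hqρ : q ^ 2 + ρ ^ 2 = 1) (hqX : q ≤ X)
    (hX : X ≤ 1) (hm : 7 / 10 ≤ q ^ 2) (hm2 : q ^ 2 < 0.79) (hX9 : X < 0.99) : ∃ n1 s1 n0 s0 : ℝ, n1 ^ 2 + s1 ^ 2 ≤ 1 ∧ n0 ^ 2 + s0 ^ 2 ≤ 1 ∧ 0 ≤ s1 ∧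
      ∀ c s : ℝ, q ≤ c → c ≤ X → 0 ≤ s → c ^ 2 + s ^ 2 = 1 →
      t / 4 ≤ X * ((n1 * q ^ 2 + t * s1 * ρ ^ 2) / 2 - (n1 - n0) * q ^ 2)
        + (n1 - n0) * q ^ 2 * c + (s0 - s1) * ρ ^ 2 * s := by
  have hq1 : q ≤ 1 := by nlinarith
  have hρ2 : ρ ^ 2 = 1 - q ^ 2 := by linarith
  have hq8 : 0.8366 ≤ q := by nlinarith
  have hq1' : 1 - q ≤ ρ ^ 2 * 0.54449 := by rw [hρ2]; nlinarith
  have hq9 : q ≤ 0.8889 := by nlinarith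
  refine ⟨0.939, 0.342, 0.3, 0.95, by norm_num, by norm_num, by norm_num, ?_⟩
  intro c s h1 h2 h3 h4
  have hqq : q ^ 2 = 1 - ρ ^ 2 := by linarith
  have hA : 0.939 - 0.3467 * ρ ^ 2 ≤ 0.939 * q ^ 2 + t * 0.342 * ρ ^ 2 := by
    rw [hqq]; nlinarith [mul_nonneg (sub_nonneg.2 htl) (sq_nonneg ρ)]
  set A := 0.939 * q ^ 2 + t * 0.342 * ρ ^ 2 with hAdef
  have hk : (0.95 - 0.342) * ρ ^ 2 * ρ = 0.608 * ρ ^ 3 := by ring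
  have := tri_lemma q ρ c s X 0.99 0.141 (A / 2 - (0.939 - 0.3) * q ^ 2)
    ((0.939 - 0.3) * q ^ 2) ((0.95 - 0.342) * ρ ^ 2) (t / 4) (by positivity) h1 h2 hX9.le
    (by linarith) hqρ h4 h3 (by norm_num) ?_ ?_ ?_
  · exact this
  · have hp := poly1 ρ hρ
    have e : (1 - ρ ^ 2 * 0.54449) * (0.4695 - 0.17335 * ρ ^ 2) ≤ q * (A / 2) := by
      apply mul_le_mul _ _ _ hq
      · linarith
      · linarith
      · nlinarith
    rw [hk]
    linarith
  · have e1 : q ^ 2 * (0.99 - q) ≤ (1 - ρ ^ 2) * (ρ ^ 2 * 0.54449 - 0.01) := by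
      rw [hqq]; apply mul_le_mul_of_nonneg_left _ (by nlinarith); linarith
    have hp := poly2 ρ hρ
    rw [hk]
    nlinarith
  · linarith

lemma certB2 (t q ρ X : ℝ) (ht2 : t ^ 2 = 3) (ht0 : 0 ≤ t) (htl : 1.732 ≤ t) (htu : t ≤ 1.7321)
    (hq : 0 ≤ q) (hρ : 0 ≤ ρ) (hqρ : q ^ 2 + ρ ^ 2 = 1) (hqX : q ≤ X)
    (hX : X ≤ 1) (hm2 : 0.79 ≤ q ^ 2) (hql : q < 1) : ∃ n1 s1 n0 s0 : ℝ, n1 ^ 2 + s1 ^ 2 ≤ 1 ∧ n0 ^ 2 + s0 ^ 2 ≤ 1 ∧ 0 ≤ s1 ∧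
      ∀ c s : ℝ, q ≤ c → c ≤ X → 0 ≤ s → c ^ 2 + s ^ 2 = 1 →
      t / 4 ≤ X * ((n1 * q ^ 2 + t * s1 * ρ ^ 2) / 2 - (n1 - n0) * q ^ 2)
        + (n1 - n0) * q ^ 2 * c + (s0 - s1) * ρ ^ 2 * s := by
  have hq1 : q ≤ 1 := by nlinarith
  have hρ2 : ρ ^ 2 = 1 - q ^ 2 := by linarith
  have hq8 : 0.888 ≤ q := by nlinarith
  have hq1' : 1 - q ≤ ρ ^ 2 * 0.52967 := by rw [hρ2]; nlinarith
  refine ⟨0.939, 0.342, 0.3, 0.95, by norm_num, by norm_num, by norm_num, ?_⟩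
  intro c s h1 h2 h3 h4
  have hqq : q ^ 2 = 1 - ρ ^ 2 := by linarith
  have hA : 0.939 - 0.3467 * ρ ^ 2 ≤ 0.939 * q ^ 2 + t * 0.342 * ρ ^ 2 := by
    rw [hqq]; nlinarith [mul_nonneg (sub_nonneg.2 htl) (sq_nonneg ρ)]
  set A := 0.939 * q ^ 2 + t * 0.342 * ρ ^ 2 with hAdef
  have hk : (0.95 - 0.342) * ρ ^ 2 * ρ = 0.608 * ρ ^ 3 := by ring
  have := tri_lemma q ρ c s X 1 0 (A / 2 - (0.939 - 0.3) * q ^ 2)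
    ((0.939 - 0.3) * q ^ 2) ((0.95 - 0.342) * ρ ^ 2) (t / 4) (by positivity) h1 h2 hX
    hql hqρ h4 h3 (by norm_num) ?_ ?_ ?_
  · exact this
  · have hp := poly4 ρ hρ
    have e : (1 - ρ ^ 2 * 0.52967) * (0.4695 - 0.17335 * ρ ^ 2) ≤ q * (A / 2) := by
      apply mul_le_mul _ _ _ hq
      · linarith
      · linarith
      · nlinarith
    rw [hk]
    linarith
  · have e1 : q ^ 2 * (1 - q) ≤ (1 - ρ ^ 2) * (ρ ^ 2 * 0.52967) := by
      rw [hqq]; apply mul_le_mul_of_nonneg_left _ (by nlinarith); linarith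
    have hp := poly5 ρ hρ
    rw [hk]
    nlinarith
  · linarith

set_option maxHeartbeats 1000000 in
lemma certA (t q ρ X : ℝ) (ht2 : t ^ 2 = 3) (ht0 : 0 ≤ t) (htl : 1.732 ≤ t) (htu : t ≤ 1.7321)
    (hq : 0 ≤ q) (hρ : 0 ≤ ρ) (hqρ : q ^ 2 + ρ ^ 2 = 1) (hqX : q ≤ X)
    (hX : X ≤ 1) (hm : 7 / 10 ≤ q ^ 2) (hm2 : q ^ 2 < 0.79) (hX9 : 0.99 ≤ X) : ∃ n1 s1 n0 s0 : ℝ, n1 ^ 2 + s1 ^ 2 ≤ 1 ∧ n0 ^ 2 + s0 ^ 2 ≤ 1 ∧ 0 ≤ s1 ∧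
      ∀ c s : ℝ, q ≤ c → c ≤ X → 0 ≤ s → c ^ 2 + s ^ 2 = 1 →
      t / 4 ≤ X * ((n1 * q ^ 2 + t * s1 * ρ ^ 2) / 2 - (n1 - n0) * q ^ 2)
        + (n1 - n0) * q ^ 2 * c + (s0 - s1) * ρ ^ 2 * s := by
  have hq1 : q ≤ 1 := by nlinarith
  have hρ2 : ρ ^ 2 = 1 - q ^ 2 := by linarith
  have hq8 : 0.8366 ≤ q := by nlinarith
  have hr5 : ρ ≤ 0.5478 := by nlinarith
  have hq1' : 1 - q ≤ ρ ^ 2 * 0.54449 := by rw [hρ2]; nlinarith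
  have hr4 : 0.4582 ≤ ρ := by nlinarith
  have hq9 : q ≤ 0.8889 := by nlinarith
  refine ⟨t / 2, 1 / 2, 1 / 2, 0.866, by nlinarith, by norm_num, by norm_num, ?_⟩
  intro c s h1 h2 h3 h4
  have hA : (t / 2 * q ^ 2 + t * (1 / 2) * ρ ^ 2) / 2 = t / 4 := by rw [hρ2]; ring
  rw [hA]
  have hqq : q ^ 2 = 1 - ρ ^ 2 := by linarith
  have hκa : (t / 2 - 1 / 2) * q ^ 2 ≤ 0.36605 * q ^ 2 :=
    mul_le_mul_of_nonneg_right (by linarith) (sq_nonneg q)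
  have hκ1' : 0 ≤ (t / 2 - 1 / 2) * q ^ 2 := by
    apply mul_nonneg _ (sq_nonneg q); linarith
  have hκ2 : 0.0767 ≤ (0.866 - 1 / 2) * ρ ^ 2 := by rw [hρ2]; linarith
  have e3 : (0.866 - 1 / 2) * ρ ^ 2 * ρ = 0.366 * ρ ^ 3 := by ring
  have e1 : q ^ 2 * (0.99 - q) ≤ (1 - ρ ^ 2) * (ρ ^ 2 * 0.54449 - 0.01) := by
    rw [hqq]; apply mul_le_mul_of_nonneg_left _ (by rw [← hqq]; positivity); linarith
  have e2 := poly3 ρ hr4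
  generalize (t / 2 - 1 / 2) * q ^ 2 = κ1 at *
  generalize (0.866 - 1 / 2) * ρ ^ 2 = κ2 at *
  have e4 : κ1 * (0.99 - q) ≤ 0.36605 * q ^ 2 * (0.99 - q) :=
    mul_le_mul_of_nonneg_right hκa (by linarith)
  have hκ1 : κ1 ≤ 0.2892 := by linarith
  rcases lt_or_ge c 0.98 with hc | hc
  · have h5 := tri_lemma q ρ c s 0.98 0.98 0.198 0 κ1 κ2 (t / 4 - 0.99 * (t / 4 - κ1)) (by linarith)
      h1 hc.le le_rfl (by linarith) hqρ h4 h3 (by norm_num) (by linarith) (by linarith) (by linarith)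
    have h6 : 0.99 * (t / 4 - κ1) ≤ X * (t / 4 - κ1) :=
      mul_le_mul_of_nonneg_right hX9 (by linarith)
    linarith
  · have hs9 : 9 * (1 - c) ≤ s := by
      apply abs_le_of_sq_le_sq' _ h3 |>.2
      nlinarith
    have h7 : κ2 * (9 * (1 - c)) ≤ κ2 * s := mul_le_mul_of_nonneg_left hs9 (by linarith)
    have h5 : 0.0767 * (9 * (1 - c)) ≤ κ2 * (9 * (1 - c)) :=
      mul_le_mul_of_nonneg_right hκ2 (by linarith)
    have h6 : c * (t / 4 - κ1) ≤ X * (t / 4 - κ1) :=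
      mul_le_mul_of_nonneg_right h2 (by linarith)
    have h8 : t / 4 * (1 - c) ≤ 0.4331 * (1 - c) := mul_le_mul_of_nonneg_right (by linarith) (by linarith)
    linarith

lemma side_cert (q ρ X : ℝ) (hq : 0 ≤ q) (hρ : 0 ≤ ρ) (hqρ : q ^ 2 + ρ ^ 2 = 1) (hqX : q ≤ X)
    (hX : X ≤ 1) (hq1 : q < 1) : ∃ n1 s1 n0 s0 : ℝ, n1 ^ 2 + s1 ^ 2 ≤ 1 ∧ n0 ^ 2 + s0 ^ 2 ≤ 1 ∧ 0 ≤ s1 ∧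
      ∀ c s : ℝ, q ≤ c → c ≤ X → 0 ≤ s → c ^ 2 + s ^ 2 = 1 →
      Real.sqrt 3 / 4 ≤ X * ((n1 * q ^ 2 + Real.sqrt 3 * s1 * ρ ^ 2) / 2 - (n1 - n0) * q ^ 2)
        + (n1 - n0) * q ^ 2 * c + (s0 - s1) * ρ ^ 2 * s := by
  have ht2 : Real.sqrt 3 ^ 2 = 3 := Real.sq_sqrt (by norm_num)
  have ht0 : 0 ≤ Real.sqrt 3 := Real.sqrt_nonneg 3
  have htl : 1.732 ≤ Real.sqrt 3 := by apply Real.le_sqrt_of_sq_le; norm_num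
  have htu : Real.sqrt 3 ≤ 1.7321 := by apply Real.sqrt_le_iff.2; constructor <;> norm_num
  rcases lt_or_ge (q ^ 2) (7 / 10) with hm | hm
  · exact certC _ q ρ X ht2 ht0 htl htu hq hρ hqρ hqX hX hm
  rcases lt_or_ge (q ^ 2) 0.79 with hm2 | hm2
  · rcases lt_or_ge X 0.99 with hX9 | hX9
    · exact certB1 _ q ρ X ht2 ht0 htl htu hq hρ hqρ hqX hX hm hm2 hX9
    · exact certA _ q ρ X ht2 ht0 htl htu hq hρ hqρ hqX hX hm hm2 hX9
  · exact certB2 _ q ρ X ht2 ht0 htl htu hq hρ hqρ hqX hX hm2 hq1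

end S1

section S2

/-- Weighted length of the vector `(x,y)`. -/
noncomputable def pen (m x y : ℝ) : ℝ := Real.sqrt ((m * x) ^ 2 + ((1 - m) * y) ^ 2)

lemma pen_nonneg (m x y : ℝ) : 0 ≤ pen m x y := Real.sqrt_nonneg _

lemma pen_ge (m x y n s : ℝ) (h : n ^ 2 + s ^ 2 ≤ 1) :
    n * (m * x) + s * ((1 - m) * y) ≤ pen m x y := by
  apply Real.le_sqrt_of_sq_le
  nlinarith [sq_nonneg (n * ((1 - m) * y) - s * (m * x)), sq_nonneg (m * x), sq_nonneg ((1 - m) * y),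
    mul_nonneg (sub_nonneg.2 h) (add_nonneg (sq_nonneg (m * x)) (sq_nonneg ((1 - m) * y)))]

lemma case2_geom (ca sa cb sb cx sx cy sy m p : ℝ) (hca : 0 ≤ ca) (hsa : 0 ≤ sa) (hcb : 0 ≤ cb)
    (hsb : 0 ≤ sb) (hcx : 0 ≤ cx) (hsx : 0 ≤ sx) (hcy : 0 ≤ cy) (hsy : 0 ≤ sy)
    (ha : ca ^ 2 + sa ^ 2 = 1) (hb : cb ^ 2 + sb ^ 2 = 1) (hx : cx ^ 2 + sx ^ 2 = 1)
    (hy : cy ^ 2 + sy ^ 2 = 1) (hm0 : 0 ≤ m) (hm1 : m < 1) (hmx : m ≤ cx ^ 2) (hmy : m ≤ cy ^ 2)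
    (hxX : cx ≤ ca + cb) (hyX : cy ≤ ca + cb) (ht : (ca + cb) ^ 2 + (sb - sa) ^ 2 ≤ 1)
    (hp : pen m (cx - cb) (sx - sb) + pen m (ca + cb - cx) (sb - sa - sx)
      + pen m (cy - ca) (sa - sy) + pen m (ca + cb - cy) (sb - sa + sy) ≤ p) :
    Real.sqrt 3 / 2 ≤ p := by
  have h3 : Real.sqrt 3 ^ 2 = 3 := Real.sq_sqrt (by norm_num)
  have h30 : 0 ≤ Real.sqrt 3 := Real.sqrt_nonneg 3
  set q := Real.sqrt m with hq
  set ρ := Real.sqrt (1 - m) with hρ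
  have hq2 : q ^ 2 = m := Real.sq_sqrt hm0
  have hρ2 : ρ ^ 2 = 1 - m := Real.sq_sqrt (by linarith)
  have hqx : q ≤ cx := Real.sqrt_le_iff.2 ⟨hcx, hmx⟩
  have hqy : q ≤ cy := Real.sqrt_le_iff.2 ⟨hcy, hmy⟩
  have hX : ca + cb ≤ 1 := by nlinarith [sq_nonneg (sb - sa)]
  have hY : Real.sqrt 3 * (ca + cb) ≤ sa + sb := by
    apply abs_le_of_sq_le_sq' _ (by positivity) |>.2
    rw [mul_pow, h3]
    have e1 : (ca + cb) ^ 2 * (ca - cb) ^ 2 = (sa + sb) ^ 2 * (sb - sa) ^ 2 := by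
      have : (ca + cb) * (ca - cb) = (sa + sb) * (sb - sa) := by linarith
      rw [← mul_pow, this, mul_pow]
    have e2 : (sa + sb) ^ 2 + (ca - cb) ^ 2 = 4 - ((ca + cb) ^ 2 + (sb - sa) ^ 2) := by linarith
    nlinarith [mul_le_mul_of_nonneg_left ht (sq_nonneg (sa + sb)), mul_le_mul_of_nonneg_left ht (sq_nonneg (ca + cb))]
  obtain ⟨n1, s1, n0, s0, g1, g0, gs, hc⟩ := side_cert q ρ (ca + cb) (Real.sqrt_nonneg _)
    (Real.sqrt_nonneg _) (by rw [hq2, hρ2]; ring) (by linarith) hX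
    (by rw [hq, Real.sqrt_lt' one_pos]; linarith)
  rw [hq2, hρ2] at hc
  have a1 := hc cx sx hqx hxX hsx hx
  have a2 := hc cy sy hqy hyX hsy hy
  have b1 := pen_ge m (cx - cb) (sx - sb) n1 (-s1) (by linarith [neg_sq s1])
  have b2 := pen_ge m (ca + cb - cx) (sb - sa - sx) n0 (-s0) (by linarith [neg_sq s0])
  have b3 := pen_ge m (cy - ca) (sa - sy) n1 s1 g1
  have b4 := pen_ge m (ca + cb - cy) (sb - sa + sy) n0 s0 g0
  have e := mul_le_mul_of_nonneg_left hY (mul_nonneg gs (by linarith : 0 ≤ 1 - m))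
  linarith

end S2

section S3

lemma hom_identity (c s k l : ℝ) :
    let C := c * (k ^ 2 - l ^ 2) - s * (2 * k * l)
    let C' := k * (c ^ 2 - s ^ 2) - l * (2 * c * s)
    let U := c ^ 2 - 3 * s ^ 2
    let U' := k ^ 2 - 3 * l ^ 2
    let x := 8 * c * C - U * (k ^ 2 + l ^ 2)
    let x' := 8 * k * C' - U' * (c ^ 2 + s ^ 2)
    let S := s * k + c * l
    let K := c * k - s * l
    let Q := ((c ^ 2 - s ^ 2) * (k ^ 2 + l ^ 2) - (k ^ 2 - l ^ 2) * (c ^ 2 + s ^ 2)) ^ 2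
      + ((2 * s * c) * (k ^ 2 + l ^ 2) + (2 * k * l) * (c ^ 2 + s ^ 2) - 4 * S * K) ^ 2
    4 * (48 * S ^ 2 * C ^ 2 * C' ^ 2 - x ^ 2 * C' ^ 2 * (k ^ 2 + l ^ 2) - x' ^ 2 * C ^ 2 * (c ^ 2 + s ^ 2)
      + 2 * x * x' * C * C' * K) =
      U * U' * ((c ^ 2 + s ^ 2) * (k ^ 2 + l ^ 2) - 2 * (K ^ 2 - S ^ 2)) * Q := by
  intro C C' U U' x x' S K Q
  simp only [C, C', U, U', x, x', S, K, Q]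
  ring

lemma unit_exists (k s X Y : ℝ) (hks : k ^ 2 + s ^ 2 = 1) (hs : 0 < s)
    (h : X ^ 2 + Y ^ 2 - 2 * X * Y * k ≤ s ^ 2) :
    ∃ u v : ℝ, u ^ 2 + v ^ 2 = 1 ∧ X ≤ u ∧ Y ≤ u * k + v * s := by
  have hk : 0 < 1 + k := by nlinarith
  set y := (Y - X * k) / s with hy
  have hys : y * s = Y - X * k := by rw [hy]; field_simp
  have h0 : X ^ 2 + y ^ 2 ≤ 1 := by
    have : (X ^ 2 + y ^ 2) * s ^ 2 ≤ 1 * s ^ 2 := by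
      have : y ^ 2 * s ^ 2 = (Y - X * k) ^ 2 := by rw [← hys]; ring
      nlinarith
    exact le_of_mul_le_mul_right this (by positivity)
  let φ : ℝ → ℝ := fun r => (X + r * (1 + k)) ^ 2 + (y + r * s) ^ 2
  have hφ : Continuous φ := by fun_prop
  obtain ⟨R, hR0, hR⟩ : ∃ R, 0 ≤ R ∧ 1 ≤ φ R := by
    refine ⟨(1 + |y|) / s, by positivity, ?_⟩
    have : (1 + |y|) / s * s = 1 + |y| := by field_simp
    simp only [φ]; rw [this]
    have := neg_abs_le y
    nlinarith [sq_nonneg (X + (1 + |y|) / s * (1 + k))]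
  obtain ⟨r, hr, hr1⟩ := intermediate_value_Icc hR0 hφ.continuousOn
    (show (1:ℝ) ∈ Set.Icc (φ 0) (φ R) from ⟨by simp only [φ]; linarith, hR⟩)
  refine ⟨_, _, hr1, ?_, ?_⟩
  · have := mul_nonneg hr.1 hk.le
    linarith
  · have : 0 ≤ r * (1 + k) := mul_nonneg hr.1 hk.le
    nlinarith

lemma pen_norm (m : ℝ) (z : ℂ) :
    2 * pen m z.re z.im = ‖z + (2 * m - 1 : ℝ) * (starRingEnd ℂ) z‖ := by
  rw [Complex.norm_eq_sqrt_sq_add_sq]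
  have : (2:ℝ) = Real.sqrt (2 ^ 2) := by rw [Real.sqrt_sq]; norm_num
  unfold pen
  nth_rewrite 1 [this]
  rw [← Real.sqrt_mul (by norm_num)]
  congr 1
  simp
  ring

set_option maxHeartbeats 1000000 in
lemma case3_alg (m ca sa cb sb u0 v0 : ℝ) (ha : ca ^ 2 + sa ^ 2 = 1) (hb : cb ^ 2 + sb ^ 2 = 1)
    (hu : u0 ^ 2 + v0 ^ 2 = 1) (hsa : 0 < sa) (hsb : 0 < sb) (hca : 0 < ca) (hcb : 0 < cb)
    (hU : 0 ≤ ca ^ 2 - 3 * sa ^ 2) (hU' : 0 ≤ cb ^ 2 - 3 * sb ^ 2)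
    (hC : 0 < ca * (cb ^ 2 - sb ^ 2) - sa * (2 * cb * sb))
    (hC' : 0 < cb * (ca ^ 2 - sa ^ 2) - sb * (2 * ca * sa))
    (hσ : 0 ≤ 1 - 2 * ((ca * cb - sa * sb) ^ 2 - (sa * cb + ca * sb) ^ 2))
    (H L E : ℂ) (hH : H = (u0 + v0 * Complex.I) * (1 - (cb + sb * Complex.I) ^ 2))
    (hL : L = (u0 + v0 * Complex.I) * (1 - (ca - sa * Complex.I) ^ 2))
    (hE : E = (u0 + v0 * Complex.I) * ((cb + sb * Complex.I) ^ 2 + (ca - sa * Complex.I) ^ 2 - 1)) :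
    Real.sqrt 3 / 2 ≤ pen m H.re H.im + pen m L.re L.im + pen m E.re E.im := by
  have h3 : Real.sqrt 3 ^ 2 = 3 := Real.sq_sqrt (by norm_num)
  have h30 : 0 < Real.sqrt 3 := Real.sqrt_pos.2 (by norm_num)
  have hid := hom_identity ca sa cb sb
  simp only [ha, hb, mul_one] at hid
  set C := ca * (cb ^ 2 - sb ^ 2) - sa * (2 * cb * sb) with hCd
  set C' := cb * (ca ^ 2 - sa ^ 2) - sb * (2 * ca * sa) with hCd'
  set S := sa * cb + ca * sb with hS
  set K := ca * cb - sa * sb with hK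
  have hSpos : 0 < S := by positivity
  have hKS : K ^ 2 + S ^ 2 = 1 := by
    have : K ^ 2 + S ^ 2 = (ca ^ 2 + sa ^ 2) * (cb ^ 2 + sb ^ 2) := by rw [hK, hS]; ring
    rw [this, ha, hb]; ring
  obtain ⟨u, v, huv, h1, h2⟩ := unit_exists K S
    ((8 * ca * C - (ca ^ 2 - 3 * sa ^ 2)) / (4 * Real.sqrt 3 * C))
    ((8 * cb * C' - (cb ^ 2 - 3 * sb ^ 2)) / (4 * Real.sqrt 3 * C')) hKS hSpos (by
      have hnn : 0 ≤ (ca ^ 2 - 3 * sa ^ 2) * (cb ^ 2 - 3 * sb ^ 2) * (1 - 2 * (K ^ 2 - S ^ 2)) *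
        ((ca ^ 2 - sa ^ 2 - (cb ^ 2 - sb ^ 2)) ^ 2 + (2 * sa * ca + 2 * cb * sb - 4 * S * K) ^ 2) := by
        have := mul_nonneg (mul_nonneg hU hU') hσ
        positivity
      rw [← hid] at hnn
      generalize (8 * ca * C - (ca ^ 2 - 3 * sa ^ 2)) = x at *
      generalize (8 * cb * C' - (cb ^ 2 - 3 * sb ^ 2)) = x' at *
      have e : (x / (4 * Real.sqrt 3 * C)) ^ 2 + (x' / (4 * Real.sqrt 3 * C')) ^ 2
          - 2 * (x / (4 * Real.sqrt 3 * C)) * (x' / (4 * Real.sqrt 3 * C')) * K =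
          (x ^ 2 * C' ^ 2 + x' ^ 2 * C ^ 2 - 2 * x * x' * C * C' * K) / (16 * Real.sqrt 3 ^ 2 * C ^ 2 * C' ^ 2) := by
        field_simp
        ring
      rw [e, div_le_iff₀ (by positivity), h3]
      linarith)
  rw [div_le_iff₀ (by positivity)] at h1 h2
  -- norms of the certificate vectors
  have n1 : (Real.sqrt 3 / 2 * u - C) ^ 2 + (Real.sqrt 3 / 2 * v) ^ 2 ≤ (2 * S * sb) ^ 2 := by
    have e : 2 * S * sb = ca - C := by rw [hS, hCd]; linear_combination ca * hb
    rw [e]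
    have : (Real.sqrt 3 / 2 * u - C) ^ 2 + (Real.sqrt 3 / 2 * v) ^ 2 = 3 / 4 - Real.sqrt 3 * u * C + C ^ 2 := by
      linear_combination (Real.sqrt 3 ^ 2 / 4) * huv + h3 / 4
    rw [this]
    linarith [sq_nonneg ca]
  have n2 : (Real.sqrt 3 / 2 * (u * K + v * S) - C') ^ 2 + (Real.sqrt 3 / 2 * (v * K - u * S)) ^ 2 ≤ (2 * S * sa) ^ 2 := by
    have e : 2 * S * sa = cb - C' := by rw [hS, hCd']; linear_combination cb * ha
    rw [e]
    have : (Real.sqrt 3 / 2 * (u * K + v * S) - C') ^ 2 + (Real.sqrt 3 / 2 * (v * K - u * S)) ^ 2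
        = 3 / 4 - Real.sqrt 3 * (u * K + v * S) * C' + C' ^ 2 := by
      linear_combination (Real.sqrt 3 ^ 2 / 4) * (K ^ 2 + S ^ 2) * huv + (Real.sqrt 3 ^ 2 / 4) * hKS + h3 / 4
    rw [this]
    linarith [sq_nonneg ca]
  have hI : Complex.I ^ 2 = -1 := Complex.I_sq
  have haC : (ca : ℂ) ^ 2 + (sa : ℂ) ^ 2 = 1 := by exact_mod_cast ha
  have hbC : (cb : ℂ) ^ 2 + (sb : ℂ) ^ 2 = 1 := by exact_mod_cast hb
  have huC : (u0 : ℂ) ^ 2 + (v0 : ℂ) ^ 2 = 1 := by exact_mod_cast hu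
  have hSC : (S : ℂ) = sa * cb + ca * sb := by rw [hS]; push_cast; ring
  have hKC : (K : ℂ) = ca * cb - sa * sb := by rw [hK]; push_cast; ring
  have hCC : (C : ℂ) = ca * (cb ^ 2 - sb ^ 2) - sa * (2 * cb * sb) := by rw [hCd]; push_cast; ring
  have hCC' : (C' : ℂ) = cb * (ca ^ 2 - sa ^ 2) - sb * (2 * ca * sa) := by rw [hCd']; push_cast; ring
  have hS0 : (S : ℂ) ≠ 0 := by exact_mod_cast hSpos.ne'
  have hsa0 : (sa : ℂ) ≠ 0 := by exact_mod_cast hsa.ne'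
  have hsb0 : (sb : ℂ) ≠ 0 := by exact_mod_cast hsb.ne'
  set N1 : ℂ := ((Real.sqrt 3 / 2 * u - C : ℝ) + (Real.sqrt 3 / 2 * v : ℝ) * Complex.I) / (2 * S * sb : ℝ) with hN1
  set N2 : ℂ := ((Real.sqrt 3 / 2 * (u * K + v * S) - C' : ℝ) + (Real.sqrt 3 / 2 * (v * K - u * S) : ℝ) * Complex.I) / (2 * S * sa : ℝ) with hN2
  have nn : ∀ x y r : ℝ, 0 < r → x ^ 2 + y ^ 2 ≤ r ^ 2 → ‖((x : ℂ) + (y : ℂ) * Complex.I) / (r : ℂ)‖ ≤ 1 := by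
    intro x y r hr h
    rw [norm_div, Complex.norm_add_mul_I, Complex.norm_real, Real.norm_eq_abs, abs_of_pos hr,
      div_le_one hr, Real.sqrt_le_iff]
    exact ⟨hr.le, h⟩
  have N1le : ‖N1‖ ≤ 1 := nn _ _ _ (by positivity) n1
  have N2le : ‖N2‖ ≤ 1 := nn _ _ _ (by positivity) n2
  have kr : sb + sa * K + ca * S - 2 * S * ca = 0 := by
    rw [hS, hK]; linear_combination (-sb) * ha
  have ki : -cb + ca * K - sa * S + 2 * S * sa = 0 := by
    rw [hS, hK]; linear_combination cb * ha
  have lr : cb - (ca * K + sa * S) = 0 := by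
    rw [hS, hK]; linear_combination (-cb) * ha
  have li : sb + (sa * K - ca * S) = 0 := by
    rw [hS, hK]; linear_combination (-sb) * ha
  have R : - sb * C - sa * C' + S * ((cb ^ 2 - sb ^ 2) + (ca ^ 2 - sa ^ 2) - 1) = 0 := by
    have h : - sb * C * (ca ^ 2 + sa ^ 2) - sa * C' * (cb ^ 2 + sb ^ 2)
      + S * ((cb ^ 2 - sb ^ 2) * (ca ^ 2 + sa ^ 2) + (ca ^ 2 - sa ^ 2) * (cb ^ 2 + sb ^ 2)
        - (ca ^ 2 + sa ^ 2) * (cb ^ 2 + sb ^ 2)) = 0 := by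
      rw [hCd, hCd', hS]; ring
    simp only [ha, hb, mul_one] at h; exact h
  have Im : cb * C - ca * C' + S * (2 * cb * sb - 2 * ca * sa) = 0 := by
    have h : cb * C * (ca ^ 2 + sa ^ 2) - ca * C' * (cb ^ 2 + sb ^ 2)
      + S * (2 * cb * sb * (ca ^ 2 + sa ^ 2) - 2 * ca * sa * (cb ^ 2 + sb ^ 2)) = 0 := by
      rw [hCd, hCd', hS]; ring
    simp only [ha, hb, mul_one] at h; exact h
  clear hCC hCC' hSC hKC
  clear_value C C' S K
  have g1 : 1 - ((cb : ℂ) + sb * Complex.I) ^ 2 = - 2 * Complex.I * sb * (cb + sb * Complex.I) := by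
    linear_combination (-1) * hbC + (sb : ℂ) ^ 2 * hI
  have g2 : 1 - ((ca : ℂ) - sa * Complex.I) ^ 2 = 2 * Complex.I * sa * (ca - sa * Complex.I) := by
    linear_combination (-1) * haC + (sa : ℂ) ^ 2 * hI
  have g1c : 1 - ((cb : ℂ) - sb * Complex.I) ^ 2 = 2 * Complex.I * sb * (cb - sb * Complex.I) := by
    linear_combination (-1) * hbC + (sb : ℂ) ^ 2 * hI
  have g2c : 1 - ((ca : ℂ) + sa * Complex.I) ^ 2 = - 2 * Complex.I * sa * (ca + sa * Complex.I) := by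
    linear_combination (-1) * haC + (sa : ℂ) ^ 2 * hI
  have d1 : N1 * sb * S * 2 = ((Real.sqrt 3 / 2 * u - C : ℝ) + (Real.sqrt 3 / 2 * v : ℝ) * Complex.I) := by
    rw [hN1]; push_cast; field_simp
  have d2 : N2 * sa * S * 2 = ((Real.sqrt 3 / 2 * (u * K + v * S) - C' : ℝ) + (Real.sqrt 3 / 2 * (v * K - u * S) : ℝ) * Complex.I) := by
    rw [hN2]; push_cast; field_simp
  have key : - Complex.I * (cb + sb * Complex.I) * ((Real.sqrt 3 / 2 * u - C : ℝ) + (Real.sqrt 3 / 2 * v : ℝ) * Complex.I)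
      + Complex.I * (ca - sa * Complex.I) * ((Real.sqrt 3 / 2 * (u * K + v * S) - C' : ℝ) + (Real.sqrt 3 / 2 * (v * K - u * S) : ℝ) * Complex.I)
      + S * ((cb + sb * Complex.I) ^ 2 + (ca - sa * Complex.I) ^ 2 - 1)
      = S * (Real.sqrt 3 * ((ca - sa * Complex.I) * (u + v * Complex.I))) := by
    apply Complex.ext
    · simp [pow_two]
      linear_combination (Real.sqrt 3 / 2) * u * kr - (Real.sqrt 3 / 2) * v * ki + R
    · simp [pow_two]
      linear_combination (Real.sqrt 3 / 2) * u * ki + (Real.sqrt 3 / 2) * v * kr + Im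
  have keyc : Complex.I * (cb - sb * Complex.I) * ((Real.sqrt 3 / 2 * u - C : ℝ) + (Real.sqrt 3 / 2 * v : ℝ) * Complex.I)
      - Complex.I * (ca + sa * Complex.I) * ((Real.sqrt 3 / 2 * (u * K + v * S) - C' : ℝ) + (Real.sqrt 3 / 2 * (v * K - u * S) : ℝ) * Complex.I)
      + S * ((cb - sb * Complex.I) ^ 2 + (ca + sa * Complex.I) ^ 2 - 1) = 0 := by
    apply Complex.ext
    · simp [pow_two]
      linear_combination (Real.sqrt 3 / 2) * u * li - (Real.sqrt 3 / 2) * v * lr + R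
    · simp [pow_two]
      linear_combination (Real.sqrt 3 / 2) * u * lr + (Real.sqrt 3 / 2) * v * li - Im
  rw [← d1, ← d2] at key keyc
  have sumX : N1 * H + N2 * L + E = Real.sqrt 3 * ((u0 + v0 * Complex.I) * ((ca - sa * Complex.I) * (u + v * Complex.I))) := by
    apply mul_left_cancel₀ hS0
    rw [hH, hL, hE, g1, g2]
    linear_combination (u0 + v0 * Complex.I) * key
  have hHc : (starRingEnd ℂ) H = (u0 - v0 * Complex.I) * (1 - (cb - sb * Complex.I) ^ 2) := by
    rw [hH]; simp only [map_mul, map_sub, map_add, map_pow, map_one, Complex.conj_ofReal, Complex.conj_I]; ring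
  have hLc : (starRingEnd ℂ) L = (u0 - v0 * Complex.I) * (1 - (ca + sa * Complex.I) ^ 2) := by
    rw [hL]; simp only [map_mul, map_sub, map_add, map_pow, map_one, Complex.conj_ofReal, Complex.conj_I]; ring
  have hEc : (starRingEnd ℂ) E = (u0 - v0 * Complex.I) * ((cb - sb * Complex.I) ^ 2 + (ca + sa * Complex.I) ^ 2 - 1) := by
    rw [hE]; simp only [map_mul, map_sub, map_add, map_pow, map_one, Complex.conj_ofReal, Complex.conj_I]; ring
  have sumXc : N1 * (starRingEnd ℂ) H + N2 * (starRingEnd ℂ) L + (starRingEnd ℂ) E = 0 := by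
    apply mul_left_cancel₀ hS0
    rw [hHc, hLc, hEc, g1c, g2c]
    linear_combination (u0 - v0 * Complex.I) * keyc
  have p1 := pen_norm m H
  have p2 := pen_norm m L
  have p3 := pen_norm m E
  have hnorm : ‖N1 * (H + (2 * m - 1 : ℝ) * (starRingEnd ℂ) H) + N2 * (L + (2 * m - 1 : ℝ) * (starRingEnd ℂ) L)
      + (E + (2 * m - 1 : ℝ) * (starRingEnd ℂ) E)‖ = Real.sqrt 3 := by
    have : N1 * (H + (2 * m - 1 : ℝ) * (starRingEnd ℂ) H) + N2 * (L + (2 * m - 1 : ℝ) * (starRingEnd ℂ) L)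
      + (E + (2 * m - 1 : ℝ) * (starRingEnd ℂ) E) = Real.sqrt 3 * ((u0 + v0 * Complex.I) * ((ca + (-sa : ℝ) * Complex.I) * (u + v * Complex.I))) := by
      push_cast
      push_cast at sumX
      linear_combination sumX + (2 * m - 1) * sumXc
    rw [this, norm_mul, norm_mul, norm_mul, Complex.norm_add_mul_I, Complex.norm_add_mul_I, Complex.norm_add_mul_I, hu, huv, neg_sq, ha]
    simp [abs_of_pos h30]
  have htri := norm_add₃_le (a := N1 * (H + (2 * m - 1 : ℝ) * (starRingEnd ℂ) H)) (b := N2 * (L + (2 * m - 1 : ℝ) * (starRingEnd ℂ) L))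
    (c := (E + (2 * m - 1 : ℝ) * (starRingEnd ℂ) E))
  rw [hnorm, norm_mul, norm_mul, ← p1, ← p2, ← p3] at htri
  have q1 := mul_le_mul_of_nonneg_right N1le (mul_nonneg zero_le_two (pen_nonneg m H.re H.im))
  have q2 := mul_le_mul_of_nonneg_right N2le (mul_nonneg zero_le_two (pen_nonneg m L.re L.im))
  linarith

lemma case3_geom (m y a b : ℝ) (ha0 : 0 ≤ a) (hb0 : 0 ≤ b) (ha : a ≤ Real.pi / 6)
    (hb : b ≤ Real.pi / 6) (hab : Real.pi / 6 ≤ a + b) :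
    Real.sqrt 3 / 2 ≤ pen m (Real.cos y - Real.cos (y + 2 * b)) (Real.sin y - Real.sin (y + 2 * b))
      + pen m (Real.cos y - Real.cos (y - 2 * a)) (Real.sin y - Real.sin (y - 2 * a))
      + pen m (Real.cos (y - 2 * a) + Real.cos (y + 2 * b) - Real.cos y)
          (Real.sin (y - 2 * a) + Real.sin (y + 2 * b) - Real.sin y) := by
  have hpi := Real.pi_pos
  rcases eq_or_lt_of_le hb with hb6 | hb6
  · -- b = π/6
    have e1 : Real.sin (2 * b) = Real.sqrt 3 / 2 := by
      rw [hb6, ← Real.sin_pi_div_three]; congr 1; ring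
    have e2 : Real.cos (2 * b) = 1 / 2 := by
      rw [hb6, ← Real.cos_pi_div_three]; congr 1; ring
    have hv := Real.cos_sq_add_sin_sq (y + 2 * b)
    have hy := Real.cos_sq_add_sin_sq y
    have hc : Real.cos y * Real.cos (y + 2 * b) + Real.sin y * Real.sin (y + 2 * b) = 1 / 2 := by
      rw [← e2, show 2 * b = (y + 2 * b) - y by ring, Real.cos_sub]; ring_nf
    have hd : Real.cos y * Real.sin (y + 2 * b) - Real.sin y * Real.cos (y + 2 * b) = Real.sqrt 3 / 2 := by
      rw [← e1, show 2 * b = (y + 2 * b) - y by ring, Real.sin_sub]; ring_nf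
    generalize Real.cos (y + 2 * b) = p at *
    generalize Real.sin (y + 2 * b) = q at *
    generalize Real.cos (y - 2 * a) = r at *
    generalize Real.sin (y - 2 * a) = s at *
    generalize Real.cos y = c at *
    generalize Real.sin y = d at *
    have b1 := pen_ge m (c - p) (d - q) q (-p) (by linarith [neg_sq p])
    have b2 := pen_ge m (c - r) (d - s) (-(d - q)) (c - p) (by linarith [neg_sq (d - q)])
    have b3 := pen_ge m (r + p - c) (s + q - d) (-(d - q)) (c - p) (by linarith [neg_sq (d - q)])
    linarith
  rcases eq_or_lt_of_le ha with ha6 | ha6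
  · have e1 : Real.sin (2 * a) = Real.sqrt 3 / 2 := by
      rw [ha6, ← Real.sin_pi_div_three]; congr 1; ring
    have e2 : Real.cos (2 * a) = 1 / 2 := by
      rw [ha6, ← Real.cos_pi_div_three]; congr 1; ring
    have hv := Real.cos_sq_add_sin_sq (y - 2 * a)
    have hy := Real.cos_sq_add_sin_sq y
    have hc : Real.cos y * Real.cos (y - 2 * a) + Real.sin y * Real.sin (y - 2 * a) = 1 / 2 := by
      rw [← e2, ← Real.cos_sub]; congr 1; ring
    have hd : Real.sin y * Real.cos (y - 2 * a) - Real.cos y * Real.sin (y - 2 * a) = Real.sqrt 3 / 2 := by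
      rw [← e1, ← Real.sin_sub]; congr 1; ring
    generalize Real.cos (y + 2 * b) = p at *
    generalize Real.sin (y + 2 * b) = q at *
    generalize Real.cos (y - 2 * a) = r at *
    generalize Real.sin (y - 2 * a) = s at *
    generalize Real.cos y = c at *
    generalize Real.sin y = d at *
    have b1 := pen_ge m (c - r) (d - s) (-s) r (by linarith [neg_sq s])
    have b2 := pen_ge m (c - p) (d - q) (d - s) (-(c - r)) (by linarith [neg_sq (c - r)])
    have b3 := pen_ge m (r + p - c) (s + q - d) (d - s) (-(c - r)) (by linarith [neg_sq (c - r)])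
    linarith
  have ha' : 0 < a := by linarith
  have hb' : 0 < b := by linarith
  have hsa : 0 < Real.sin a := Real.sin_pos_of_pos_of_lt_pi ha' (by linarith)
  have hsb : 0 < Real.sin b := Real.sin_pos_of_pos_of_lt_pi hb' (by linarith)
  have hca : 0 < Real.cos a := Real.cos_pos_of_mem_Ioo ⟨by linarith, by linarith⟩
  have hcb : 0 < Real.cos b := Real.cos_pos_of_mem_Ioo ⟨by linarith, by linarith⟩
  have e1 : Real.cos a ^ 2 + Real.sin a ^ 2 = 1 := Real.cos_sq_add_sin_sq a
  have e2 : Real.cos b ^ 2 + Real.sin b ^ 2 = 1 := Real.cos_sq_add_sin_sq b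
  have hsa2 : Real.sin a ≤ 1 / 2 := by
    rw [← Real.sin_pi_div_six]; exact Real.sin_le_sin_of_le_of_le_pi_div_two (by linarith) (by linarith) ha
  have hsb2 : Real.sin b ≤ 1 / 2 := by
    rw [← Real.sin_pi_div_six]; exact Real.sin_le_sin_of_le_of_le_pi_div_two (by linarith) (by linarith) hb
  have eC : Real.cos a * (Real.cos b ^ 2 - Real.sin b ^ 2) - Real.sin a * (2 * Real.cos b * Real.sin b) = Real.cos (a + 2 * b) := by
    rw [Real.cos_add, Real.cos_two_mul', Real.sin_two_mul]; ring
  have eC' : Real.cos b * (Real.cos a ^ 2 - Real.sin a ^ 2) - Real.sin b * (2 * Real.cos a * Real.sin a) = Real.cos (b + 2 * a) := by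
    rw [Real.cos_add, Real.cos_two_mul', Real.sin_two_mul]; ring
  have eσ : (Real.cos a * Real.cos b - Real.sin a * Real.sin b) ^ 2 - (Real.sin a * Real.cos b + Real.cos a * Real.sin b) ^ 2
      = Real.cos (2 * (a + b)) := by
    rw [Real.cos_two_mul', Real.cos_add, Real.sin_add]
  have hcσ : Real.cos (2 * (a + b)) ≤ 1 / 2 := by
    rw [← Real.cos_pi_div_three]
    exact Real.cos_le_cos_of_nonneg_of_le_pi (by linarith) (by linarith) (by linarith)
  have := case3_alg m (Real.cos a) (Real.sin a) (Real.cos b) (Real.sin b) (Real.cos y) (Real.sin y)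
    e1 e2 (Real.cos_sq_add_sin_sq y) hsa hsb hca hcb (by nlinarith) (by nlinarith)
    (by rw [eC]; exact Real.cos_pos_of_mem_Ioo ⟨by linarith, by linarith⟩)
    (by rw [eC']; exact Real.cos_pos_of_mem_Ioo ⟨by linarith, by linarith⟩)
    (by rw [eσ]; linarith) _ _ _ rfl rfl rfl
  have hp : ∀ x y x' y', x = x' → y = y' → pen m x y = pen m x' y' := by
    rintro _ _ _ _ rfl rfl; rfl
  refine this.trans_eq (congrArg₂ _ (congrArg₂ _ (hp _ _ _ _ ?_ ?_) (hp _ _ _ _ ?_ ?_)) (hp _ _ _ _ ?_ ?_))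
  all_goals
    simp only [Real.cos_add, Real.sin_add, Real.cos_sub, Real.sin_sub, Real.cos_two_mul', Real.sin_two_mul]
  all_goals
    simp only [pow_two, Complex.add_re, Complex.add_im, Complex.mul_re, Complex.mul_im, Complex.sub_re,
      Complex.sub_im, Complex.ofReal_re, Complex.ofReal_im, Complex.I_re, Complex.I_im, Complex.one_re, Complex.one_im]
    ring

end S3

section S4

lemma compact_pos {E : Type*} [TopologicalSpace E] (K : Set E) (hK : IsCompact K) (g : E → ℝ)
    (hg : Continuous g) (h : ∀ x ∈ K, 0 < g x) : ∃ η > 0, ∀ x ∈ K, η < g x := by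
  rcases K.eq_empty_or_nonempty with rfl | hne
  · exact ⟨1, one_pos, by simp⟩
  · obtain ⟨x, hx, hm⟩ := hK.exists_isMinOn hne hg.continuousOn
    refine ⟨g x / 2, by have := h x hx; positivity, fun y hy => ?_⟩
    have := hm hy
    have h2 := h x hx
    simp only [Set.mem_setOf_eq] at this
    linarith

@[fun_prop]
lemma Continuous.pen {E : Type*} [TopologicalSpace E] {f g h : E → ℝ} (hf : Continuous f) (hg : Continuous g)
    (hh : Continuous h) : Continuous fun x => pen (f x) (g x) (h x) := by
  unfold _root_.pen
  fun_prop

lemma tuple3 (p0 : ℝ) (hp0 : p0 < Real.sqrt 3 / 2) : ∃ η > 0, ∀ m y a b : ℝ, 0 ≤ m → m ≤ 1 →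
    |y| ≤ Real.pi → 0 ≤ a → a ≤ Real.pi / 2 → 0 ≤ b → b ≤ Real.pi / 2 → Real.pi / 6 ≤ a + b →
    2 - 2 * Real.cos (2 * a) ≤ 1 + η → 2 - 2 * Real.cos (2 * b) ≤ 1 + η →
    pen m (Real.cos y - Real.cos (y + 2 * b)) (Real.sin y - Real.sin (y + 2 * b))
      + pen m (Real.cos y - Real.cos (y - 2 * a)) (Real.sin y - Real.sin (y - 2 * a))
      + pen m (Real.cos (y - 2 * a) + Real.cos (y + 2 * b) - Real.cos y)
          (Real.sin (y - 2 * a) + Real.sin (y + 2 * b) - Real.sin y) ≤ p0 → False := by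
  let F : ℝ × ℝ × ℝ × ℝ → ℝ := fun x =>
    pen x.1 (Real.cos x.2.1 - Real.cos (x.2.1 + 2 * x.2.2.2)) (Real.sin x.2.1 - Real.sin (x.2.1 + 2 * x.2.2.2))
      + pen x.1 (Real.cos x.2.1 - Real.cos (x.2.1 - 2 * x.2.2.1)) (Real.sin x.2.1 - Real.sin (x.2.1 - 2 * x.2.2.1))
      + pen x.1 (Real.cos (x.2.1 - 2 * x.2.2.1) + Real.cos (x.2.1 + 2 * x.2.2.2) - Real.cos x.2.1)
          (Real.sin (x.2.1 - 2 * x.2.2.1) + Real.sin (x.2.1 + 2 * x.2.2.2) - Real.sin x.2.1)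
  have hF : Continuous F := by fun_prop
  let K : Set (ℝ × ℝ × ℝ × ℝ) := (Set.Icc 0 1 ×ˢ Set.Icc (-Real.pi) Real.pi ×ˢ Set.Icc 0 (Real.pi / 2) ×ˢ Set.Icc 0 (Real.pi / 2))
    ∩ ({x | Real.pi / 6 ≤ x.2.2.1 + x.2.2.2} ∩ {x | F x ≤ p0})
  have hK : IsCompact K := by
    apply IsCompact.inter_right
    · exact isCompact_Icc.prod (isCompact_Icc.prod (isCompact_Icc.prod isCompact_Icc))
    · exact (isClosed_le (by fun_prop) (by fun_prop)).inter (isClosed_le hF (by fun_prop))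
  obtain ⟨η, h0, hη⟩ := compact_pos K hK
    (fun x => max (2 - 2 * Real.cos (2 * x.2.2.1)) (2 - 2 * Real.cos (2 * x.2.2.2)) - 1) (by fun_prop) (by
      rintro ⟨m, y, a, b⟩ ⟨⟨hm, hy, ha, hb⟩, hab, hp⟩
      by_contra hcon
      simp only [not_lt, sub_nonpos, max_le_iff] at hcon
      have key : ∀ a : ℝ, a ∈ Set.Icc 0 (Real.pi / 2) → 2 - 2 * Real.cos (2 * a) ≤ 1 → a ≤ Real.pi / 6 := by
        intro a ha h
        by_contra hlt
        have : Real.cos (2 * a) < 1 / 2 := by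
          rw [← Real.cos_pi_div_three]
          exact Real.cos_lt_cos_of_nonneg_of_le_pi (by have := Real.pi_pos; positivity) (by linarith [ha.2]) (by linarith)
        linarith
      have := case3_geom m y a b ha.1 hb.1 (key a ha hcon.1) (key b hb hcon.2) hab
      have hp' : F (m, y, a, b) ≤ p0 := hp
      simp only [F] at hp'
      linarith)
  refine ⟨η, h0, ?_⟩
  intro m y a b h1 h2 hy h3 h4 h5 h6 h7 h8 h9 h10
  have := hη (m, y, a, b) ⟨⟨⟨h1, h2⟩, abs_le.1 hy, ⟨h3, h4⟩, ⟨h5, h6⟩⟩, h7, h10⟩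
  simp only at this
  have := max_le h8 h9
  linarith

set_option maxHeartbeats 1000000 in
lemma tuple2 (p0 : ℝ) (hp0 : p0 < Real.sqrt 3 / 2) : ∃ η > 0, ∀ ca sa cb sb cx sx cy sy m : ℝ,
    0 ≤ ca → 0 ≤ sa → 0 ≤ cb → 0 ≤ sb → 0 ≤ cx → 0 ≤ sx → 0 ≤ cy → 0 ≤ sy →
    ca ^ 2 + sa ^ 2 = 1 → cb ^ 2 + sb ^ 2 = 1 → cx ^ 2 + sx ^ 2 = 1 →
    cy ^ 2 + sy ^ 2 = 1 → 0 ≤ m → m ≤ p0 → m ≤ cx ^ 2 → m ≤ cy ^ 2 →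
    cx ≤ ca + cb → cy ≤ ca + cb → (ca + cb) ^ 2 + (sb - sa) ^ 2 ≤ 1 + η →
    pen m (cx - cb) (sx - sb) + pen m (ca + cb - cx) (sb - sa - sx)
      + pen m (cy - ca) (sa - sy) + pen m (ca + cb - cy) (sb - sa + sy) ≤ p0 → False := by
  have hp1 : p0 < 1 := by
    have : Real.sqrt 3 ≤ 2 := by rw [Real.sqrt_le_iff]; norm_num
    linarith
  let K : Set (Fin 9 → ℝ) := Set.Icc 0 1 ∩ {x | x 0 ^ 2 + x 1 ^ 2 = 1 ∧ x 2 ^ 2 + x 3 ^ 2 = 1 ∧ x 4 ^ 2 + x 5 ^ 2 = 1 ∧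
    x 6 ^ 2 + x 7 ^ 2 = 1 ∧ x 8 ≤ p0 ∧ x 8 ≤ x 4 ^ 2 ∧ x 8 ≤ x 6 ^ 2 ∧ x 4 ≤ x 0 + x 2 ∧ x 6 ≤ x 0 + x 2 ∧
    pen (x 8) (x 4 - x 2) (x 5 - x 3) + pen (x 8) (x 0 + x 2 - x 4) (x 3 - x 1 - x 5)
      + pen (x 8) (x 6 - x 0) (x 1 - x 7) + pen (x 8) (x 0 + x 2 - x 6) (x 3 - x 1 + x 7) ≤ p0}
  have hK : IsCompact K := by
    apply isCompact_Icc.inter_right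
    simp only [Set.setOf_and]
    refine (isClosed_eq ?_ ?_).inter ((isClosed_eq ?_ ?_).inter ((isClosed_eq ?_ ?_).inter ((isClosed_eq ?_ ?_).inter
      ((isClosed_le ?_ ?_).inter ((isClosed_le ?_ ?_).inter ((isClosed_le ?_ ?_).inter ((isClosed_le ?_ ?_).inter
      ((isClosed_le ?_ ?_).inter (isClosed_le ?_ ?_))))))))) <;> fun_prop
  obtain ⟨η, h0, hη⟩ := compact_pos K hK (fun x => (x 0 + x 2) ^ 2 + (x 3 - x 1) ^ 2 - 1) (by fun_prop) (by
    rintro x ⟨⟨hx0, hx1⟩, h1, h2, h3, h4, h5, h6, h7, h8, h9, h10⟩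
    by_contra hcon
    have := case2_geom (x 0) (x 1) (x 2) (x 3) (x 4) (x 5) (x 6) (x 7) (x 8) p0 (hx0 0) (hx0 1) (hx0 2)
      (hx0 3) (hx0 4) (hx0 5) (hx0 6) (hx0 7) h1 h2 h3 h4 (hx0 8) (by linarith) h6 h7 h8 h9 (by linarith) h10
    linarith)
  refine ⟨η, h0, ?_⟩
  intro ca sa cb sb cx sx cy sy m a1 a2 a3 a4 a5 a6 a7 a8 b1 b2 b3 b4 m0 m1 m2 m3 h1 h2 h3 h4
  have hle : ∀ c s : ℝ, c ^ 2 + s ^ 2 = 1 → c ≤ 1 ∧ s ≤ 1 := by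
    intro c s h; constructor <;> nlinarith [sq_nonneg c, sq_nonneg s]
  let x : Fin 9 → ℝ := ![ca, sa, cb, sb, cx, sx, cy, sy, m]
  have x0 : x 0 = ca := rfl
  have x1 : x 1 = sa := rfl
  have x2 : x 2 = cb := rfl
  have x3 : x 3 = sb := rfl
  have x4 : x 4 = cx := rfl
  have x5 : x 5 = sx := rfl
  have x6 : x 6 = cy := rfl
  have x7 : x 7 = sy := rfl
  have x8 : x 8 = m := rfl
  clear_value x
  have hx0 : (0 : Fin 9 → ℝ) ≤ x := by
    intro i; fin_cases i <;> simp [x0, x1, x2, x3, x4, x5, x6, x7, x8, *]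
  have hx1 : x ≤ (1 : Fin 9 → ℝ) := by
    have := hle _ _ b1
    have := hle _ _ b2
    have := hle _ _ b3
    have := hle _ _ b4
    have : m ≤ 1 := by linarith
    intro i; fin_cases i <;> simp [x0, x1, x2, x3, x4, x5, x6, x7, x8, *]
  have := hη x ⟨⟨hx0, hx1⟩, by
      simp only [Set.mem_setOf_eq, x0, x1, x2, x3, x4, x5, x6, x7, x8]
      exact ⟨b1, b2, b3, b4, m1, m2, m3, h1, h2, h4⟩⟩
  simp only [x0, x1, x2, x3, x4, x5, x6, x7, x8] at this
  linarith

end S4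

section S5

open Classical in
/-- Neighbourhood of atom `i`. -/
noncomputable def nbr {ι : Type*} [Fintype ι] (c σ : ι → ℝ) (m : ℝ) (i : ι) : Finset ι :=
  Finset.univ.filter (fun j => m * σ i * σ j < (1 - m) * c i * c j)

lemma mem_nbr {ι : Type*} [Fintype ι] (c σ : ι → ℝ) (m : ℝ) (i j : ι) :
    j ∈ nbr c σ m i ↔ m * σ i * σ j < (1 - m) * c i * c j := by simp [nbr]

/-- The data extracted from an (approximately) optimal configuration. -/
structure Config {ι : Type*} [Fintype ι] (k c σ : ι → ℝ) (m p η : ℝ) : Prop where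
  hk : ∀ i, 0 < k i
  hc : ∀ i, 0 ≤ c i
  hcs : ∀ i, c i ^ 2 + σ i ^ 2 = 1
  hm0 : 0 < m
  hm1 : m < 1
  hp0 : 0 < p
  hp1 : p < 1
  hmp : m ≤ p
  eqC : ∀ i, ∑ j ∈ nbr c σ m i, k j * c j = m * c i
  eqS : ∀ i, ∑ j ∈ nbr c σ m i, k j * σ j = - (1 - m) * σ i
  hp : ∑ i, k i = p
  nC : ∑ i, k i * c i ^ 2 = p * m
  nS : ∑ i, k i * σ i ^ 2 = p * (1 - m)
  orth : ∑ i, k i * (c i * σ i) = 0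
  hA : ∀ A : Finset ι, (∑ i ∈ A, k i * c i) ^ 2 / m ^ 2 + (∑ i ∈ A, k i * σ i) ^ 2 / (1 - m) ^ 2 ≤ 1 + η

namespace Config

variable {ι : Type*} [Fintype ι] {k c σ : ι → ℝ} {m p η : ℝ}

lemma nbr_neg (c σ : ι → ℝ) (m : ℝ) (i : ι) : nbr c (fun i => - σ i) m i = nbr c σ m i := by
  ext j; simp [mem_nbr]

lemma flip (h : Config k c σ m p η) : Config k c (fun i => - σ i) m p η where
  hk := h.hk
  hc := h.hc
  hcs := by simpa using h.hcs
  hm0 := h.hm0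
  hm1 := h.hm1
  hp0 := h.hp0
  hp1 := h.hp1
  hmp := h.hmp
  eqC := by intro i; rw [nbr_neg]; exact h.eqC i
  eqS := by intro i; rw [nbr_neg]; have := h.eqS i; simp only [mul_neg, Finset.sum_neg_distrib]; linarith
  hp := h.hp
  nC := h.nC
  nS := by simpa using h.nS
  orth := by have := h.orth; simp only [mul_neg, Finset.sum_neg_distrib]; linarith
  hA := by intro A; have := h.hA A; simpa only [mul_neg, Finset.sum_neg_distrib, neg_sq] using this

lemma perim (h : Config k c σ m p η) (A : Finset ι) (x y : ℝ) (hx : ∑ i ∈ A, k i * c i = m * x)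
    (hy : ∑ i ∈ A, k i * σ i = - (1 - m) * y) : pen m x y ≤ ∑ i ∈ A, k i := by
  set r := pen m x y with hr
  have hr0 : 0 ≤ r := pen_nonneg _ _ _
  have hr2 : r ^ 2 = (m * x) ^ 2 + ((1 - m) * y) ^ 2 := Real.sq_sqrt (by positivity)
  rcases eq_or_lt_of_le hr0 with h0 | h0
  · rw [← h0]; exact Finset.sum_nonneg fun i _ => (h.hk i).le
  have h1 : r * r ≤ r * ∑ i ∈ A, k i := by
    have : r * r = ∑ i ∈ A, k i * (c i * (m * x) - σ i * ((1 - m) * y)) := by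
      have : ∑ i ∈ A, k i * (c i * (m * x) - σ i * ((1 - m) * y))
        = (∑ i ∈ A, k i * c i) * (m * x) - (∑ i ∈ A, k i * σ i) * ((1 - m) * y) := by
        rw [Finset.sum_mul, Finset.sum_mul, ← Finset.sum_sub_distrib]
        exact Finset.sum_congr rfl fun i _ => by ring
      rw [this, hx, hy]; linarith
    rw [this, Finset.mul_sum]
    refine Finset.sum_le_sum fun i _ => ?_
    rw [mul_comm r]
    refine mul_le_mul_of_nonneg_left ?_ (h.hk i).le
    apply abs_le_of_sq_le_sq' _ hr0 |>.2
    rw [hr2]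
    have := h.hcs i
    nlinarith [sq_nonneg (c i * ((1 - m) * y) + σ i * (m * x))]
  exact le_of_mul_le_mul_left h1 h0

lemma bound (h : Config k c σ m p η) (A : Finset ι) (x y : ℝ) (hx : ∑ i ∈ A, k i * c i = m * x)
    (hy : ∑ i ∈ A, k i * σ i = - (1 - m) * y) : x ^ 2 + y ^ 2 ≤ 1 + η := by
  have := h.hA A
  have h1 : 0 < 1 - m := by linarith [h.hm1]
  have h2 := h.hm0
  rw [hx, hy] at this
  have e : (m * x) ^ 2 / m ^ 2 + (-(1 - m) * y) ^ 2 / (1 - m) ^ 2 = x ^ 2 + y ^ 2 := by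
    field_simp
  linarith

lemma exists_pos (h : Config k c σ m p η) (b : ι) (hb : ∀ i, σ i ≤ σ b) : 0 < σ b := by
  by_contra hcon
  have hle : ∀ i, σ i ≤ 0 := fun i => (hb i).trans (not_lt.1 hcon)
  have h1 : 0 < 1 - m := by linarith [h.hm1]
  have hz : ∀ i, σ i = 0 := by
    intro i
    by_contra hne
    have hlt : σ i < 0 := lt_of_le_of_ne (hle i) hne
    have h2 := h.eqS i
    have h3 : ∑ j ∈ nbr c σ m i, k j * σ j ≤ 0 :=
      Finset.sum_nonpos fun j _ => mul_nonpos_of_nonneg_of_nonpos (h.hk j).le (hle j)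
    nlinarith
  have := h.nS
  simp [hz] at this
  rcases this with h4 | h4
  · linarith [h.hp0]
  · linarith

lemma c_mono (h : Config k c σ m p η) (i b : ι) (h1 : 0 ≤ σ i) (h2 : σ i ≤ σ b) : c b ≤ c i := by
  apply abs_le_of_sq_le_sq' _ (h.hc i) |>.2
  have := h.hcs i
  have := h.hcs b
  nlinarith

lemma mid_aux (h : Config k c σ m p η) (a b j : ι) (ha : ∀ i, σ a ≤ σ i) (hb : ∀ i, σ i ≤ σ b)
    (hja : j ∈ nbr c σ m a) (hjb : j ∈ nbr c σ m b) (hj : 0 ≤ σ j) (i : ι) : i ∈ nbr c σ m j := by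
  rw [mem_nbr] at *
  have h1 : 0 < 1 - m := by linarith [h.hm1]
  have hm := h.hm0
  have hcj := h.hc j
  have hci := h.hc i
  rcases le_or_gt 0 (σ i) with hi | hi
  · have e := h.c_mono i b hi (hb i)
    calc m * σ j * σ i ≤ m * σ j * σ b := by gcongr; exact hb i
      _ < (1 - m) * c j * c b := by linarith
      _ ≤ (1 - m) * c j * c i := by gcongr
  · rcases eq_or_lt_of_le hj with hj0 | hj0
    · have e : c a ≤ c i := h.flip.c_mono i a (by simpa using hi.le) (by simpa using ha i)
      rw [← hj0] at hja ⊢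
      calc m * 0 * σ i = m * σ a * 0 := by ring
        _ < (1 - m) * c a * c j := hja
        _ = (1 - m) * c j * c a := by ring
        _ ≤ (1 - m) * c j * c i := by gcongr
    · have : m * σ j * σ i < 0 := mul_neg_of_pos_of_neg (by positivity) hi
      have : 0 ≤ (1 - m) * c j * c i := by positivity
      linarith

lemma mid_all (h : Config k c σ m p η) (a b j : ι) (ha : ∀ i, σ a ≤ σ i) (hb : ∀ i, σ i ≤ σ b)
    (hja : j ∈ nbr c σ m a) (hjb : j ∈ nbr c σ m b) (i : ι) : i ∈ nbr c σ m j := by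
  rcases le_total 0 (σ j) with hj | hj
  · exact h.mid_aux a b j ha hb hja hjb hj i
  · have := h.flip.mid_aux b a j (by simpa using hb) (by simpa using ha) (by rwa [nbr_neg]) (by rwa [nbr_neg]) (by simpa using hj) i
    rwa [nbr_neg] at this

lemma cos_arcsin (h : Config k c σ m p η) (i : ι) : Real.cos (Real.arcsin (σ i)) = c i := by
  rw [Real.cos_arcsin, show 1 - σ i ^ 2 = c i ^ 2 by linarith [h.hcs i], Real.sqrt_sq (h.hc i)]

lemma sin_arcsin (h : Config k c σ m p η) (i : ι) : Real.sin (Real.arcsin (σ i)) = σ i := by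
  have := h.hcs i
  exact Real.sin_arcsin (by nlinarith [sq_nonneg (c i)]) (by nlinarith [sq_nonneg (c i)])

lemma angle_b (h : Config k c σ m p η) (a b j : ι) (hb : ∀ i, σ i ≤ σ b) (hab : σ a < σ b)
    (hT1 : ∑ i, k i * c i = m * c j) (hT2 : ∑ i, k i * σ i = - (1 - m) * σ j) :
    - Real.arcsin (σ j) + Real.arccos p ≤ Real.arcsin (σ b) := by
  by_contra hcon
  push Not at hcon
  set ω := Real.arccos p with hω
  set θ := - Real.arcsin (σ j) with hθ
  have hp0 := h.hp0
  have hcω : Real.cos ω = p := Real.cos_arccos (by linarith) h.hp1.le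
  have hω0 : 0 < ω := Real.arccos_pos.2 h.hp1
  have hω1 : ω < Real.pi / 2 := Real.arccos_lt_pi_div_two.2 hp0
  have hpi := Real.pi_pos
  have hθ1 := Real.arcsin_le_pi_div_two (σ j)
  have hθ2 := Real.neg_pi_div_two_le_arcsin (σ j)
  have term : ∀ i, (p - (c i * c j - σ i * σ j)) * (σ i * Real.cos (θ - ω) - c i * Real.sin (θ - ω)) ≤ 0 ∧
      ((p - (c i * c j - σ i * σ j)) * (σ i * Real.cos (θ - ω) - c i * Real.sin (θ - ω)) = 0 → Real.arcsin (σ i) = θ - ω) := by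
    intro i
    set d := Real.arcsin (σ i) - θ with hd
    have e1 : c i * c j - σ i * σ j = Real.cos d := by
      rw [hd, hθ, sub_neg_eq_add, Real.cos_add, h.cos_arcsin, h.cos_arcsin, h.sin_arcsin, h.sin_arcsin]
    have e2 : σ i * Real.cos (θ - ω) - c i * Real.sin (θ - ω) = Real.sin (d + ω) := by
      rw [show d + ω = Real.arcsin (σ i) - (θ - ω) by rw [hd]; ring, Real.sin_sub (Real.arcsin (σ i)) (θ - ω), h.cos_arcsin, h.sin_arcsin]
    rw [e1, e2, ← hcω]
    have hi1 := Real.arcsin_le_pi_div_two (σ i)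
    have hi2 := Real.neg_pi_div_two_le_arcsin (σ i)
    have hib : Real.arcsin (σ i) ≤ Real.arcsin (σ b) := Real.monotone_arcsin (hb i)
    have hd1 : d < ω := by linarith
    have hd2 : -Real.pi ≤ d := by linarith
    rcases lt_trichotomy d (-ω) with hlt | heq | hgt
    · have s1 : Real.sin (d + ω) < 0 := Real.sin_neg_of_neg_of_neg_pi_lt (by linarith) (by linarith)
      have s2 : Real.cos d < Real.cos ω := by
        rw [← Real.cos_neg d]
        exact Real.cos_lt_cos_of_nonneg_of_le_pi hω0.le (by linarith) (by linarith)
      have s3 := mul_neg_of_pos_of_neg (sub_pos.2 s2) s1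
      exact ⟨s3.le, fun h0 => absurd h0 s3.ne⟩
    · refine ⟨by rw [heq]; simp, fun _ => by linarith⟩
    · have s1 : 0 < Real.sin (d + ω) := Real.sin_pos_of_pos_of_lt_pi (by linarith) (by linarith)
      have s2 : Real.cos ω < Real.cos d := by
        rw [← Real.cos_abs d]
        exact Real.cos_lt_cos_of_nonneg_of_le_pi (abs_nonneg d) (by linarith) (abs_lt.2 ⟨hgt, hd1⟩)
      have s3 := mul_neg_of_neg_of_pos (sub_neg.2 s2) s1
      exact ⟨s3.le, fun h0 => absurd h0 s3.ne⟩
  have hsum : ∑ i, k i * ((p - (c i * c j - σ i * σ j)) * (σ i * Real.cos (θ - ω) - c i * Real.sin (θ - ω))) = 0 := by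
    have e : ∑ i, k i * ((p - (c i * c j - σ i * σ j)) * (σ i * Real.cos (θ - ω) - c i * Real.sin (θ - ω)))
      = p * Real.cos (θ - ω) * (∑ i, k i * σ i) - p * Real.sin (θ - ω) * (∑ i, k i * c i)
        - c j * Real.cos (θ - ω) * (∑ i, k i * (c i * σ i)) + c j * Real.sin (θ - ω) * (∑ i, k i * c i ^ 2)
        + σ j * Real.cos (θ - ω) * (∑ i, k i * σ i ^ 2) - σ j * Real.sin (θ - ω) * (∑ i, k i * (c i * σ i)) := by
      simp only [Finset.mul_sum, ← Finset.sum_sub_distrib, ← Finset.sum_add_distrib]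
      exact Finset.sum_congr rfl fun i _ => by ring
    rw [e, hT1, hT2, h.orth, h.nC, h.nS]; ring
  have hall : ∀ i, Real.arcsin (σ i) = θ - ω := by
    intro i
    apply (term i).2
    have := (Finset.sum_eq_zero_iff_of_nonpos (fun i _ => mul_nonpos_of_nonneg_of_nonpos (h.hk i).le (term i).1)).1 hsum i (Finset.mem_univ i)
    exact (mul_eq_zero.1 this).resolve_left (h.hk i).ne'
  have : σ a = σ b := by
    rw [← h.sin_arcsin a, ← h.sin_arcsin b, hall a, hall b]
  linarith

end Config

end S5

section S6

namespace Config

variable {ι : Type*} [Fintype ι] {k c σ : ι → ℝ} {m p η : ℝ}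

lemma mono (h : Config k c σ m p η) {η' : ℝ} (hη : η ≤ η') : Config k c σ m p η' :=
  { h with hA := fun A => (h.hA A).trans (by linarith) }

set_option maxHeartbeats 2000000 in
lemma case3 (p0 : ℝ) (hp0 : p0 < √3 / 2) : ∃ η > 0, ∀ {ι : Type} [Fintype ι] (k c σ : ι → ℝ) (m p : ℝ),
    Config k c σ m p η → p ≤ p0 → ∀ a b j : ι, (∀ i, σ a ≤ σ i) → (∀ i, σ i ≤ σ b) →
    j ∈ nbr c σ m a → j ∈ nbr c σ m b → False := by
  classical
  obtain ⟨η, hη, H⟩ := tuple3 p0 hp0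
  refine ⟨η, hη, ?_⟩
  intro ι _ k c σ m p h hpp a b j ha hb hja hjb
  have hmid := h.mid_all a b j ha hb hja hjb
  have huniv : nbr c σ m j = Finset.univ := Finset.eq_univ_iff_forall.2 hmid
  have hT1 := h.eqC j
  have hT2 := h.eqS j
  rw [huniv] at hT1 hT2
  have hσb := h.exists_pos b hb
  have hσa : σ a < 0 := by
    have := h.flip.exists_pos a (by simpa using ha)
    simpa using this
  have hab : σ a < σ b := by linarith
  have A1 := h.angle_b a b j hb hab hT1 hT2
  have A2 := h.flip.angle_b b a j (by simpa using ha) (by simpa using hab) hT1 (by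
    simp only [mul_neg, Finset.sum_neg_distrib]; linarith)
  simp only [Real.arcsin_neg] at A2
  have h1m : 0 < 1 - m := by linarith [h.hm1]
  have hm := h.hm0
  have hUn : nbr c σ m a ∪ nbr c σ m b = Finset.univ := by
    apply Finset.eq_univ_iff_forall.2
    intro i
    by_contra hi
    rw [Finset.mem_union, not_or, mem_nbr, mem_nbr, not_lt, not_lt] at hi
    obtain ⟨i1, i2⟩ := hi
    have e1 : 0 ≤ (1 - m) * c a * c i := mul_nonneg (mul_nonneg h1m.le (h.hc a)) (h.hc i)
    have e2 : 0 ≤ (1 - m) * c b * c i := mul_nonneg (mul_nonneg h1m.le (h.hc b)) (h.hc i)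
    have s1 : σ i ≤ 0 := by
      by_contra hh; push Not at hh
      nlinarith [mul_pos hm (mul_pos (neg_pos.2 hσa) hh)]
    have s2 : 0 ≤ σ i := by
      by_contra hh; push Not at hh
      nlinarith [mul_pos hm (mul_pos hσb (neg_pos.2 hh))]
    have s0 : σ i = 0 := le_antisymm s1 s2
    have ci : c i = 1 := by
      have := h.hcs i
      have h0 := h.hc i
      rw [s0] at this
      nlinarith
    rw [s0, ci] at i1 i2
    have ca : c a = 0 := by
      have := h.hc a
      have : c a ≤ 0 := by
        by_contra hh; push Not at hh
        nlinarith [mul_pos h1m hh]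
      linarith
    have cb : c b = 0 := by
      have := h.hc b
      have : c b ≤ 0 := by
        by_contra hh; push Not at hh
        nlinarith [mul_pos h1m hh]
      linarith
    rw [mem_nbr, ca] at hja
    rw [mem_nbr, cb] at hjb
    have t1 : 0 < σ j := by
      by_contra hh; push Not at hh
      nlinarith [mul_nonneg hm.le (mul_nonneg (neg_pos.2 hσa).le (neg_nonneg.2 hh))]
    nlinarith [mul_pos hm (mul_pos hσb t1)]
  have ie : ∀ f : ι → ℝ, ∑ i ∈ nbr c σ m a ∩ nbr c σ m b, f i = ∑ i ∈ nbr c σ m a, f i + ∑ i ∈ nbr c σ m b, f i - ∑ i, f i := by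
    intro f
    have := Finset.sum_union_inter (s₁ := nbr c σ m a) (s₂ := nbr c σ m b) (f := f)
    rw [hUn] at this
    linarith
  have cp : ∀ (f : ι → ℝ) (A : Finset ι), ∑ i ∈ Aᶜ, f i = ∑ i, f i - ∑ i ∈ A, f i := by
    intro f A
    have := Finset.sum_add_sum_compl A f
    linarith
  have Bb1 : ∑ i ∈ (nbr c σ m b)ᶜ, k i * c i = m * (c j - c b) := by rw [cp, hT1, h.eqC b]; ring
  have Bb2 : ∑ i ∈ (nbr c σ m b)ᶜ, k i * σ i = -(1 - m) * (σ j - σ b) := by rw [cp, hT2, h.eqS b]; ring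
  have Ba1 : ∑ i ∈ (nbr c σ m a)ᶜ, k i * c i = m * (c j - c a) := by rw [cp, hT1, h.eqC a]; ring
  have Ba2 : ∑ i ∈ (nbr c σ m a)ᶜ, k i * σ i = -(1 - m) * (σ j - σ a) := by rw [cp, hT2, h.eqS a]; ring
  have I1 : ∑ i ∈ nbr c σ m a ∩ nbr c σ m b, k i * c i = m * (c a + c b - c j) := by rw [ie, hT1, h.eqC a, h.eqC b]; ring
  have I2 : ∑ i ∈ nbr c σ m a ∩ nbr c σ m b, k i * σ i = -(1 - m) * (σ a + σ b - σ j) := by rw [ie, hT2, h.eqS a, h.eqS b]; ring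
  have P1 := h.perim _ _ _ Bb1 Bb2
  have P2 := h.perim _ _ _ Ba1 Ba2
  have P3 := h.perim _ _ _ I1 I2
  have D1 := h.bound _ _ _ Bb1 Bb2
  have D2 := h.bound _ _ _ Ba1 Ba2
  rw [cp, h.hp] at P1 P2
  rw [ie, h.hp] at P3
  have yja : Real.arcsin (σ a) ≤ Real.arcsin (σ j) := Real.monotone_arcsin (ha j)
  have yjb : Real.arcsin (σ j) ≤ Real.arcsin (σ b) := Real.monotone_arcsin (hb j)
  have b1 := Real.arcsin_le_pi_div_two (σ b)
  have b2 := Real.neg_pi_div_two_le_arcsin (σ a)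
  have hω : Real.pi / 6 ≤ Real.arccos p := by
    rw [← Real.arccos_cos (x := Real.pi / 6) (by positivity) (by linarith [Real.pi_pos]), Real.cos_pi_div_six]
    exact Real.arccos_le_arccos (by linarith)
  have k1 : Real.arcsin (σ j) + 2 * ((Real.arcsin (σ b) - Real.arcsin (σ j)) / 2) = Real.arcsin (σ b) := by ring
  have k2 : Real.arcsin (σ j) - 2 * ((Real.arcsin (σ j) - Real.arcsin (σ a)) / 2) = Real.arcsin (σ a) := by ring
  have k3 : 2 * ((Real.arcsin (σ j) - Real.arcsin (σ a)) / 2) = Real.arcsin (σ j) - Real.arcsin (σ a) := by ring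
  have k4 : 2 * ((Real.arcsin (σ b) - Real.arcsin (σ j)) / 2) = Real.arcsin (σ b) - Real.arcsin (σ j) := by ring
  refine H m (Real.arcsin (σ j)) ((Real.arcsin (σ j) - Real.arcsin (σ a)) / 2) ((Real.arcsin (σ b) - Real.arcsin (σ j)) / 2)
    hm.le h.hm1.le ?_ (by linarith) (by linarith) (by linarith) (by linarith) (by linarith) ?_ ?_ ?_
  · rw [abs_le]; constructor <;> linarith [Real.pi_pos]
  · rw [k3, Real.cos_sub]
    simp only [h.cos_arcsin, h.sin_arcsin]
    nlinarith [h.hcs a, h.hcs j]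
  · rw [k4, Real.cos_sub]
    simp only [h.cos_arcsin, h.sin_arcsin]
    nlinarith [h.hcs b, h.hcs j]
  · rw [k1, k2]
    simp only [h.cos_arcsin, h.sin_arcsin]
    linarith

end Config

end S6

section S7

namespace Config

variable {ι : Type*} [Fintype ι] {k c σ : ι → ℝ} {m p η : ℝ}

lemma mem_of_neg (h : Config k c σ m p η) {i j : ι} (hi : 0 < σ i) (hj : σ j < 0) : j ∈ nbr c σ m i := by
  rw [mem_nbr]
  have h1m : 0 < 1 - m := by linarith [h.hm1]
  have : m * σ i * σ j < 0 := mul_neg_of_pos_of_neg (mul_pos h.hm0 hi) hj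
  have : 0 ≤ (1 - m) * c i * c j := mul_nonneg (mul_nonneg h1m.le (h.hc i)) (h.hc j)
  linarith

lemma mem_comm {i j : ι} (hh : j ∈ nbr c σ m i) : i ∈ nbr c σ m j := by
  rw [mem_nbr] at *
  linarith

lemma cb_pos (h : Config k c σ m p η) (a b : ι) (hσa : σ a < 0) (hσb : 0 < σ b) : 0 < c b := by
  by_contra hcon
  have cb : c b = 0 := le_antisymm (not_lt.1 hcon) (h.hc b)
  have h1m : 0 < 1 - m := by linarith [h.hm1]
  have hm := h.hm0
  have memb : ∀ j, j ∈ nbr c σ m b ↔ σ j < 0 := by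
    intro j
    rw [mem_nbr, cb]
    constructor
    · intro hj
      by_contra hh; push Not at hh
      nlinarith [mul_nonneg hm.le (mul_nonneg hσb.le hh)]
    · intro hj
      nlinarith [mul_pos hm (mul_pos hσb (neg_pos.2 hj))]
  have eb := h.eqC b
  rw [cb, mul_zero, Finset.sum_eq_zero_iff_of_nonneg (fun i _ => mul_nonneg (h.hk i).le (h.hc i))] at eb
  have cQ : ∀ j, σ j < 0 → c j = 0 := fun j hj =>
    (mul_eq_zero.1 (eb j ((memb j).2 hj))).resolve_left (h.hk j).ne'
  have ca := cQ a hσa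
  have mema : ∀ j, j ∈ nbr c σ m a ↔ 0 < σ j := by
    intro j
    rw [mem_nbr, ca]
    constructor
    · intro hj
      by_contra hh; push Not at hh
      nlinarith [mul_nonneg hm.le (mul_nonneg (neg_pos.2 hσa).le (neg_nonneg.2 hh))]
    · intro hj
      nlinarith [mul_pos hm (mul_pos (neg_pos.2 hσa) hj)]
  have ea := h.eqC a
  rw [ca, mul_zero, Finset.sum_eq_zero_iff_of_nonneg (fun i _ => mul_nonneg (h.hk i).le (h.hc i))] at ea
  have cP : ∀ j, 0 < σ j → c j = 0 := fun j hj =>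
    (mul_eq_zero.1 (ea j ((mema j).2 hj))).resolve_left (h.hk j).ne'
  have one : ∀ j, 0 < σ j → σ j = 1 := by
    intro j hj
    have := h.hcs j
    rw [cP j hj] at this
    nlinarith
  have mone : ∀ j, σ j < 0 → σ j = -1 := by
    intro j hj
    have := h.hcs j
    rw [cQ j hj] at this
    nlinarith
  have e1 : ∑ i, k i * σ i ^ 2 = ∑ i ∈ nbr c σ m a, k i * σ i - ∑ i ∈ nbr c σ m b, k i * σ i := by
    have f1 : nbr c σ m a = Finset.univ.filter (fun j => 0 < σ j) := by ext j; simp [mema]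
    have f2 : nbr c σ m b = Finset.univ.filter (fun j => σ j < 0) := by ext j; simp [memb]
    rw [f1, f2, Finset.sum_filter, Finset.sum_filter, ← Finset.sum_sub_distrib]
    refine Finset.sum_congr rfl fun i _ => ?_
    rcases lt_trichotomy (σ i) 0 with hi | hi | hi
    · rw [if_neg (by linarith), if_pos hi, mone i hi]; ring
    · simp [hi]
    · rw [if_neg (by linarith : ¬ σ i < 0), if_pos hi, one i hi]; ring
  rw [h.nS, h.eqS, h.eqS, one b hσb, mone a hσa] at e1
  have := h.hp1
  nlinarith

/-- Facts of the second case. -/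
structure Case2 (k c σ : ι → ℝ) (m p η : ℝ) (a b : ι) : Prop extends Config k c σ m p η where
  ha : ∀ i, σ a ≤ σ i
  hb : ∀ i, σ i ≤ σ b
  sa : σ a < 0
  sb : 0 < σ b
  ne : ∀ i, σ i ≠ 0
  mema : ∀ j, j ∈ nbr c σ m a ↔ 0 < σ j
  memb : ∀ j, j ∈ nbr c σ m b ↔ σ j < 0

lemma Case2.flip' {a b : ι} (h : Case2 k c σ m p η a b) : Case2 k c (fun i => - σ i) m p η b a where
  toConfig := h.toConfig.flip
  ha := by simpa using h.hb
  hb := by simpa using h.ha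
  sa := by simpa using h.sb
  sb := by simpa using h.sa
  ne := by simpa using h.ne
  mema := by intro j; rw [nbr_neg, h.memb]; simp
  memb := by intro j; rw [nbr_neg, h.mema]; simp

lemma mkCase2 (h : Config k c σ m p η) (a b : ι) (ha : ∀ i, σ a ≤ σ i) (hb : ∀ i, σ i ≤ σ b)
    (hno : ∀ j, j ∈ nbr c σ m a → j ∈ nbr c σ m b → False) : Case2 k c σ m p η a b := by
  have hσb := h.exists_pos b hb
  have hσa : σ a < 0 := by
    have := h.flip.exists_pos a (by simpa using ha)
    simpa using this
  have hcb := h.cb_pos a b hσa hσb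
  have hca := h.flip.cb_pos b a (by simpa using hσb) (by simpa using hσa)
  have h1m : 0 < 1 - m := by linarith [h.hm1]
  have hne : ∀ i, σ i ≠ 0 := by
    intro i hi
    have ci : c i = 1 := by
      have := h.hcs i
      have h0 := h.hc i
      rw [hi] at this
      nlinarith
    apply hno i <;> rw [mem_nbr, hi, ci] <;> simp <;> positivity
  have Pa : ∀ j, 0 < σ j → j ∈ nbr c σ m a := fun j hj => mem_comm (h.mem_of_neg hj hσa)
  have Qb : ∀ j, σ j < 0 → j ∈ nbr c σ m b := fun j hj => h.mem_of_neg hσb hj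
  refine ⟨h, ha, hb, hσa, hσb, hne, ?_, ?_⟩
  · intro j
    refine ⟨fun hj => ?_, Pa j⟩
    rcases lt_or_gt_of_ne (hne j) with h1 | h1
    · exact (hno j hj (Qb j h1)).elim
    · exact h1
  · intro j
    refine ⟨fun hj => ?_, Qb j⟩
    rcases lt_or_gt_of_ne (hne j) with h1 | h1
    · exact h1
    · exact (hno j (Pa j h1) hj).elim

lemma Case2.compl {a b : ι} (h : Case2 k c σ m p η a b) (f : ι → ℝ) :
    ∑ i ∈ nbr c σ m a, f i + ∑ i ∈ nbr c σ m b, f i = ∑ i, f i := by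
  classical
  have : nbr c σ m b = (nbr c σ m a)ᶜ := by
    ext j
    rw [Finset.mem_compl, h.mema, h.memb]
    have := h.ne j
    constructor
    · intro hj; linarith
    · intro hj; exact lt_of_le_of_ne (not_lt.1 hj) this
  rw [this, Finset.sum_add_sum_compl]

lemma Case2.sub_self {a b : ι} (h : Case2 k c σ m p η a b) (hno : ∀ i, 0 < σ i → i ∉ nbr c σ m i) :
    √3 / 2 ≤ p := by
  have h1m : 0 < 1 - m := by linarith [h.hm1]
  have hm := h.hm0
  have nb : ∀ i, 0 < σ i → nbr c σ m i = nbr c σ m b := by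
    intro i hi
    ext j
    rw [h.memb]
    constructor
    · intro hj
      by_contra hcon
      have hj0 : 0 < σ j := lt_of_le_of_ne (not_lt.1 hcon) (h.ne j).symm
      have t1 := hno i hi
      have t2 := hno j hj0
      rw [mem_nbr] at t1 t2 hj
      push Not at t1 t2
      have c1 := h.hc i
      have c2 := h.hc j
      have : ((1 - m) * c i * c j) ^ 2 ≤ (m * σ i * σ j) ^ 2 := by
        calc ((1 - m) * c i * c j) ^ 2 = ((1 - m) * c i * c i) * ((1 - m) * c j * c j) := by ring
          _ ≤ (m * σ i * σ i) * (m * σ j * σ j) := by gcongr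
          _ = (m * σ i * σ j) ^ 2 := by ring
      have := abs_le_of_sq_le_sq' this (by positivity)
      linarith [this.2]
    · intro hj; exact h.mem_of_neg hi hj
  have ec : ∀ i ∈ nbr c σ m a, c i = c b := by
    intro i hi
    have t := h.eqC i
    rw [nb i ((h.mema i).1 hi), h.eqC b] at t
    exact (mul_left_cancel₀ hm.ne' t).symm
  have es : ∀ i ∈ nbr c σ m a, σ i = σ b := by
    intro i hi
    have t := h.eqS i
    rw [nb i ((h.mema i).1 hi), h.eqS b] at t
    exact (mul_left_cancel₀ (neg_ne_zero.2 h1m.ne') t).symm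
  -- bounds on Q
  have hQ : ∀ i ∈ nbr c σ m b, c a ≤ c i ∧ c i ≤ c a + c b ∧ σ a ≤ σ i ∧ σ i ≤ σ a + σ b := by
    intro i hi
    rw [h.memb] at hi
    have sub : nbr c σ m a ⊆ nbr c σ m i := fun j hj => mem_comm (h.mem_of_neg ((h.mema j).1 hj) hi)
    have q1 : ∑ j ∈ nbr c σ m a, k j * c j ≤ ∑ j ∈ nbr c σ m i, k j * c j :=
      Finset.sum_le_sum_of_subset_of_nonneg sub fun j _ _ => mul_nonneg (h.hk j).le (h.hc j)
    have q2 : ∑ j ∈ nbr c σ m i, k j * c j ≤ ∑ j, k j * c j :=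
      Finset.sum_le_sum_of_subset_of_nonneg (Finset.subset_univ _) fun j _ _ => mul_nonneg (h.hk j).le (h.hc j)
    have q3 : - ∑ j ∈ nbr c σ m i, k j * σ j ≤ - ∑ j, k j * σ j := by
      classical
      have := Finset.sum_add_sum_compl (nbr c σ m i) (fun j => k j * σ j)
      have : ∑ j ∈ (nbr c σ m i)ᶜ, k j * σ j ≤ 0 := by
        refine Finset.sum_nonpos fun j hj => mul_nonpos_of_nonneg_of_nonpos (h.hk j).le ?_
        by_contra hh; push Not at hh
        exact Finset.mem_compl.1 hj (mem_comm (h.mem_of_neg hh hi))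
      linarith
    rw [← h.compl] at q2 q3
    rw [h.eqC, h.eqC] at q1
    rw [h.eqC, h.eqC, h.eqC] at q2
    rw [h.eqS, h.eqS, h.eqS] at q3
    refine ⟨le_of_mul_le_mul_left q1 hm, ?_, h.ha i, ?_⟩
    · exact le_of_mul_le_mul_left (by linarith) hm
    · exact le_of_mul_le_mul_left (by linarith) h1m
  have key : ∑ i, (k i * c i ^ 2 / m - k i * σ i ^ 2 / (1 - m)) = 0 := by
    rw [Finset.sum_sub_distrib, ← Finset.sum_div, ← Finset.sum_div, h.nC, h.nS]
    field_simp; ring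
  rw [← h.compl] at key
  have kP : ∑ i ∈ nbr c σ m a, (k i * c i ^ 2 / m - k i * σ i ^ 2 / (1 - m)) = c a * c b + σ a * σ b := by
    have : ∀ i ∈ nbr c σ m a, (k i * c i ^ 2 / m - k i * σ i ^ 2 / (1 - m)) = (k i * c i) * (c b / m) - (k i * σ i) * (σ b / (1 - m)) := by
      intro i hi
      rw [ec i hi, es i hi]; ring
    rw [Finset.sum_congr rfl this, Finset.sum_sub_distrib, ← Finset.sum_mul, ← Finset.sum_mul, h.eqC, h.eqS]
    field_simp; ring
  have kQ1 : c a * c b + σ a * σ b ≤ ∑ i ∈ nbr c σ m b, (k i * c i ^ 2 / m - k i * σ i ^ 2 / (1 - m)) := by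
    have : ∑ i ∈ nbr c σ m b, ((k i * c i) * (c a / m) - (k i * σ i) * (σ a / (1 - m))) = c a * c b + σ a * σ b := by
      rw [Finset.sum_sub_distrib, ← Finset.sum_mul, ← Finset.sum_mul, h.eqC, h.eqS]
      field_simp; ring
    rw [← this]
    refine Finset.sum_le_sum fun i hi => ?_
    obtain ⟨r1, r2, r3, r4⟩ := hQ i hi
    have hi0 := (h.memb i).1 hi
    have w1 : 0 ≤ k i * c i / m := div_nonneg (mul_nonneg (h.hk i).le (h.hc i)) hm.le
    have w2 : 0 ≤ k i * (- σ i) / (1 - m) := div_nonneg (mul_nonneg (h.hk i).le (by linarith)) h1m.le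
    have z1 := mul_le_mul_of_nonneg_left r1 w1
    have z2 := mul_le_mul_of_nonneg_left r3 w2
    calc _ = k i * c i / m * c a + k i * (- σ i) / (1 - m) * σ a := by ring
      _ ≤ k i * c i / m * c i + k i * (- σ i) / (1 - m) * σ i := by linarith
      _ = _ := by ring
  have kQ2 : ∑ i ∈ nbr c σ m b, (k i * c i ^ 2 / m - k i * σ i ^ 2 / (1 - m)) ≤ (c a + c b) * c b + (σ a + σ b) * σ b := by
    have : ∑ i ∈ nbr c σ m b, ((k i * c i) * ((c a + c b) / m) - (k i * σ i) * ((σ a + σ b) / (1 - m))) = (c a + c b) * c b + (σ a + σ b) * σ b := by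
      rw [Finset.sum_sub_distrib, ← Finset.sum_mul, ← Finset.sum_mul, h.eqC, h.eqS]
      field_simp; ring
    rw [← this]
    refine Finset.sum_le_sum fun i hi => ?_
    obtain ⟨r1, r2, r3, r4⟩ := hQ i hi
    have hi0 := (h.memb i).1 hi
    have w1 : 0 ≤ k i * c i / m := div_nonneg (mul_nonneg (h.hk i).le (h.hc i)) hm.le
    have w2 : 0 ≤ k i * (- σ i) / (1 - m) := div_nonneg (mul_nonneg (h.hk i).le (by linarith)) h1m.le
    have z1 := mul_le_mul_of_nonneg_left r2 w1
    have z2 := mul_le_mul_of_nonneg_left r4 w2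
    calc _ = k i * c i / m * c i + k i * (- σ i) / (1 - m) * σ i := by ring
      _ ≤ k i * c i / m * (c a + c b) + k i * (- σ i) / (1 - m) * (σ a + σ b) := by linarith
      _ = _ := by ring
  have ua := h.hcs a
  have ub := h.hcs b
  have hsa := h.sa
  have hsb := h.sb
  have d1 : c a * c b + σ a * σ b ≤ 0 := by linarith
  have d2 : -(1 / 2) ≤ c a * c b + σ a * σ b := by nlinarith
  have d3 : (c a * σ b - σ a * c b) ^ 2 ≥ 3 / 4 := by
    have : (c a * σ b - σ a * c b) ^ 2 = (c a ^ 2 + σ a ^ 2) * (c b ^ 2 + σ b ^ 2) - (c a * c b + σ a * σ b) ^ 2 := by ring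
    rw [this, ua, ub]; nlinarith
  have d4 : √3 / 2 ≤ c a * σ b - σ a * c b := by
    apply abs_le_of_sq_le_sq' _ _ |>.2
    · rw [div_pow, Real.sq_sqrt (by norm_num)]; linarith
    · have := mul_nonneg (h.hc a) hsb.le
      have := mul_nonneg (neg_pos.2 hsa).le (h.hc b)
      linarith
  have P1 := h.perim _ _ _ (h.eqC a) (h.eqS a)
  have P2 := h.perim _ _ _ (h.eqC b) (h.eqS b)
  have P3 := h.compl k
  rw [h.hp] at P3
  have g1 := pen_ge (n := σ b) (s := - c b) (m := m) (x := c a) (y := σ a) (by nlinarith)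
  have g2 := pen_ge (n := - σ a) (s := c a) (m := m) (x := c b) (y := σ b) (by nlinarith)
  nlinarith

lemma case2 (p0 : ℝ) (hp0 : p0 < √3 / 2) : ∃ η > 0, ∀ {ι : Type} [Fintype ι] (k c σ : ι → ℝ) (m p : ℝ) (a b : ι),
    Case2 k c σ m p η a b → p ≤ p0 → False := by
  classical
  obtain ⟨η, hη, H⟩ := tuple2 p0 hp0
  refine ⟨η, hη, ?_⟩
  intro ι _ k c σ m p a b h hpp
  have h1m : 0 < 1 - m := by linarith [h.hm1]
  have hm := h.hm0
  have X : ∃ x, 0 < σ x ∧ x ∈ nbr c σ m x := by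
    by_contra hcon
    push Not at hcon
    linarith [h.sub_self hcon]
  have Y : ∃ y, σ y < 0 ∧ y ∈ nbr c σ m y := by
    by_contra hcon
    push Not at hcon
    have := h.flip'.sub_self (by simpa [nbr_neg] using hcon)
    linarith
  obtain ⟨x, hx0, hx⟩ := X
  obtain ⟨y, hy0, hy⟩ := Y
  have subx : nbr c σ m b ⊆ nbr c σ m x := fun j hj => h.mem_of_neg hx0 ((h.memb j).1 hj)
  have suby : nbr c σ m a ⊆ nbr c σ m y := fun j hj => mem_comm (h.mem_of_neg ((h.mema j).1 hj) hy0)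
  have cp : ∀ (f : ι → ℝ) (A : Finset ι), ∑ i ∈ Aᶜ, f i = ∑ i ∈ nbr c σ m a, f i + ∑ i ∈ nbr c σ m b, f i - ∑ i ∈ A, f i := by
    intro f A
    have := Finset.sum_add_sum_compl A f
    have := h.compl f
    linarith
  have sd : ∀ (f : ι → ℝ) (A B : Finset ι), B ⊆ A → ∑ i ∈ A \ B, f i = ∑ i ∈ A, f i - ∑ i ∈ B, f i := by
    intro f A B hh
    have := Finset.sum_sdiff (f := f) hh
    linarith
  have X1 : ∑ i ∈ nbr c σ m x \ nbr c σ m b, k i * c i = m * (c x - c b) := by rw [sd _ _ _ subx, h.eqC, h.eqC]; ring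
  have X2 : ∑ i ∈ nbr c σ m x \ nbr c σ m b, k i * σ i = -(1 - m) * (σ x - σ b) := by rw [sd _ _ _ subx, h.eqS, h.eqS]; ring
  have Y1 : ∑ i ∈ nbr c σ m y \ nbr c σ m a, k i * c i = m * (c y - c a) := by rw [sd _ _ _ suby, h.eqC, h.eqC]; ring
  have Y2 : ∑ i ∈ nbr c σ m y \ nbr c σ m a, k i * σ i = -(1 - m) * (- σ a - - σ y) := by rw [sd _ _ _ suby, h.eqS, h.eqS]; ring
  have X3 : ∑ i ∈ (nbr c σ m x)ᶜ, k i * c i = m * (c a + c b - c x) := by rw [cp, h.eqC, h.eqC, h.eqC]; ring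
  have X4 : ∑ i ∈ (nbr c σ m x)ᶜ, k i * σ i = -(1 - m) * (σ b - - σ a - σ x) := by rw [cp, h.eqS, h.eqS, h.eqS]; ring
  have Y3 : ∑ i ∈ (nbr c σ m y)ᶜ, k i * c i = m * (c a + c b - c y) := by rw [cp, h.eqC, h.eqC, h.eqC]; ring
  have Y4 : ∑ i ∈ (nbr c σ m y)ᶜ, k i * σ i = -(1 - m) * (σ b - - σ a + - σ y) := by rw [cp, h.eqS, h.eqS, h.eqS]; ring
  have T1 : ∑ i, k i * c i = m * (c a + c b) := by rw [← h.compl, h.eqC, h.eqC]; ring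
  have T2 : ∑ i, k i * σ i = -(1 - m) * (σ b - - σ a) := by rw [← h.compl, h.eqS, h.eqS]; ring
  have P1 := h.perim _ _ _ X1 X2
  have P2 := h.perim _ _ _ X3 X4
  have P3 := h.perim _ _ _ Y1 Y2
  have P4 := h.perim _ _ _ Y3 Y4
  have B := h.bound _ _ _ T1 T2
  have P5 := h.compl k
  rw [h.hp] at P5
  rw [sd _ _ _ subx] at P1
  rw [sd _ _ _ suby] at P3
  rw [cp] at P2 P4
  have nn : ∀ A : Finset ι, 0 ≤ ∑ i ∈ A, k i * c i := fun A => Finset.sum_nonneg fun j _ => mul_nonneg (h.hk j).le (h.hc j)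
  have nx := nn (nbr c σ m x)ᶜ
  have ny := nn (nbr c σ m y)ᶜ
  rw [X3] at nx
  rw [Y3] at ny
  have nx' := nonneg_of_mul_nonneg_right nx hm
  have ny' := nonneg_of_mul_nonneg_right ny hm
  rw [mem_nbr] at hx hy
  have ux := h.hcs x
  have uy := h.hcs y
  exact H (c a) (- σ a) (c b) (σ b) (c x) (σ x) (c y) (- σ y) m (h.hc a) (by linarith [h.sa]) (h.hc b) h.sb.le
    (h.hc x) hx0.le (h.hc y) (by linarith) (by linarith [h.hcs a]) (h.hcs b) ux (by linarith)
    hm.le (h.hmp.trans hpp) (by nlinarith) (by nlinarith) (by linarith) (by linarith) B (by linarith)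

end Config

theorem no_cfg (p0 : ℝ) (hp0 : p0 < √3 / 2) : ∃ η > 0, ∀ {ι : Type} [Fintype ι] (k c σ : ι → ℝ) (m p : ℝ),
    Config k c σ m p η → p ≤ p0 → False := by
  obtain ⟨η2, h2, H2⟩ := Config.case2 p0 hp0
  obtain ⟨η3, h3, H3⟩ := Config.case3 p0 hp0
  refine ⟨min η2 η3, lt_min h2 h3, ?_⟩
  intro ι _ k c σ m p h hpp
  have : Nonempty ι := by
    by_contra hcon
    rw [not_nonempty_iff] at hcon
    have := h.hp
    simp at this
    linarith [h.hp0]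
  obtain ⟨a, ha⟩ := Finite.exists_min σ
  obtain ⟨b, hb⟩ := Finite.exists_max σ
  by_cases hj : ∃ j, j ∈ nbr c σ m a ∧ j ∈ nbr c σ m b
  · obtain ⟨j, j1, j2⟩ := hj
    exact H3 k c σ m p (h.mono (min_le_right _ _)) hpp a b j ha hb j1 j2
  · exact H2 k c σ m p a b ((h.mono (min_le_left _ _)).mkCase2 a b ha hb fun j j1 j2 => hj ⟨j, j1, j2⟩) hpp

end S7

section S8

/-- The finite objective. -/
noncomputable def fval {n : ℕ} (h F G : Fin n → ℝ) : ℝ :=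
  ∑ i, ∑ j, h i * h j * max (F i * F j - G i * G j) 0

/-- The quadratic form with weights. -/
noncomputable def qf {n : ℕ} (W : Fin n → Fin n → ℝ) (h F : Fin n → ℝ) : ℝ :=
  ∑ i, ∑ j, W i j * (h i * F i) * (h j * F j)

/-- Feasible triples. -/
def Feas {n : ℕ} (h F G : Fin n → ℝ) : Prop :=
  (∀ i, 0 ≤ h i) ∧ ∑ i, h i ^ 2 = 1 ∧ ∑ i, F i ^ 2 = 1 ∧ ∑ i, G i ^ 2 = 1

/-- Upper bound on all feasible values. -/
def UB (n : ℕ) (T : ℝ) : Prop := ∀ h F G : Fin n → ℝ, Feas h F G → fval h F G ≤ T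

lemma qf_smul {n : ℕ} (W : Fin n → Fin n → ℝ) (h F : Fin n → ℝ) (a b : ℝ) :
    qf W (fun i => a * h i) (fun i => b * F i) = a ^ 2 * b ^ 2 * qf W h F := by
  simp only [qf, Finset.mul_sum]
  refine Finset.sum_congr rfl fun i _ => Finset.sum_congr rfl fun j _ => by ring

lemma qf_le_fval {n : ℕ} (W : Fin n → Fin n → ℝ) (hW : ∀ i j, 0 ≤ W i j ∧ W i j ≤ 1) (h F G : Fin n → ℝ)
    (hh : ∀ i, 0 ≤ h i) : qf W h F - qf W h G ≤ fval h F G := by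
  simp only [qf, fval, ← Finset.sum_sub_distrib]
  refine Finset.sum_le_sum fun i _ => Finset.sum_le_sum fun j _ => ?_
  have h1 : W i j * (F i * F j - G i * G j) ≤ max (F i * F j - G i * G j) 0 := by
    rcases le_total 0 (F i * F j - G i * G j) with h0 | h0
    · rw [max_eq_left h0]; nlinarith [hW i j]
    · rw [max_eq_right h0]; nlinarith [hW i j]
  have := mul_le_mul_of_nonneg_left h1 (mul_nonneg (hh i) (hh j))
  nlinarith

lemma norm_unit {n : ℕ} (F : Fin n → ℝ) (hF : 0 < ∑ i, F i ^ 2) :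
    ∑ i, ((√(∑ i, F i ^ 2))⁻¹ * F i) ^ 2 = 1 := by
  simp only [mul_pow, ← Finset.mul_sum, inv_pow, Real.sq_sqrt hF.le]
  exact inv_mul_cancel₀ hF.ne'

lemma UB.hom {n : ℕ} {T : ℝ} (hT : UB n T) (W : Fin n → Fin n → ℝ) (hW : ∀ i j, 0 ≤ W i j ∧ W i j ≤ 1)
    (h F G : Fin n → ℝ) (hh : ∀ i, 0 ≤ h i) (h1 : 0 < ∑ i, h i ^ 2) (h2 : 0 < ∑ i, F i ^ 2) (h3 : 0 < ∑ i, G i ^ 2) :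
    (∑ i, h i ^ 2)⁻¹ * ((∑ i, F i ^ 2)⁻¹ * qf W h F - (∑ i, G i ^ 2)⁻¹ * qf W h G) ≤ T := by
  have H := hT (fun i => (√(∑ i, h i ^ 2))⁻¹ * h i) (fun i => (√(∑ i, F i ^ 2))⁻¹ * F i) (fun i => (√(∑ i, G i ^ 2))⁻¹ * G i)
    ⟨fun i => mul_nonneg (by positivity) (hh i), norm_unit h h1, norm_unit F h2, norm_unit G h3⟩
  have H2 := qf_le_fval W hW _ (fun i => (√(∑ i, F i ^ 2))⁻¹ * F i) (fun i => (√(∑ i, G i ^ 2))⁻¹ * G i)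
    (fun i => mul_nonneg (inv_nonneg.2 (Real.sqrt_nonneg (∑ i, h i ^ 2))) (hh i))
  rw [qf_smul, qf_smul] at H2
  simp only [inv_pow, Real.sq_sqrt h1.le, Real.sq_sqrt h2.le, Real.sq_sqrt h3.le] at H2
  linarith

lemma cs_unit {n : ℕ} (h F : Fin n → ℝ) (h1 : ∑ i, h i ^ 2 = 1) (h2 : ∑ i, F i ^ 2 = 1) :
    (∑ i, h i * F i) ^ 2 ≤ 1 := by
  have := Finset.sum_mul_sq_le_sq_mul_sq Finset.univ h F
  rw [h1, h2] at this; linarith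

lemma qf_abs_le {n : ℕ} (W : Fin n → Fin n → ℝ) (hW : ∀ i j, |W i j| ≤ 1)
    (h F : Fin n → ℝ) (hh : ∀ i, 0 ≤ h i) (h1 : ∑ i, h i ^ 2 = 1) (h2 : ∑ i, F i ^ 2 = 1) : |qf W h F| ≤ 1 := by
  have h3 : ∑ i, |F i| ^ 2 = 1 := by simpa using h2
  refine le_trans ?_ (cs_unit h (fun i => |F i|) h1 h3)
  rw [sq, Finset.sum_mul_sum]
  refine (Finset.abs_sum_le_sum_abs _ _).trans (Finset.sum_le_sum fun i _ => ?_)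
  refine (Finset.abs_sum_le_sum_abs _ _).trans (Finset.sum_le_sum fun j _ => ?_)
  rw [abs_mul, abs_mul, abs_mul, abs_mul, abs_of_nonneg (hh i), abs_of_nonneg (hh j)]
  have : 0 ≤ (h i * |F i|) * (h j * |F j|) := by
    have := hh i; have := hh j; positivity
  nlinarith [hW i j]

lemma fval_eq {n : ℕ} (h F G : Fin n → ℝ) :
    fval h F G = qf (fun i j => if G i * G j < F i * F j then 1 else 0) h F
      - qf (fun i j => if G i * G j < F i * F j then 1 else 0) h G := by
  simp only [qf, fval, ← Finset.sum_sub_distrib]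
  refine Finset.sum_congr rfl fun i _ => Finset.sum_congr rfl fun j _ => ?_
  split_ifs with h0
  · rw [max_eq_left (by linarith)]; ring
  · rw [max_eq_right (by linarith)]; ring

lemma ub_two (n : ℕ) : UB n 2 := by
  intro h F G ⟨hh, h1, h2, h3⟩
  rw [fval_eq]
  have hW : ∀ i j, |(fun i j => if G i * G j < F i * F j then (1:ℝ) else 0) i j| ≤ 1 := by
    intro i j; dsimp only; split_ifs <;> simp
  have e1 := abs_le.1 (qf_abs_le _ hW h F hh h1 h2)
  have e2 := abs_le.1 (qf_abs_le _ hW h G hh h1 h3)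
  linarith

lemma quad_stat {n : ℕ} (B : Fin n → Fin n → ℝ) (hB : ∀ i j, B i j = B j i) (μ : ℝ) (F : Fin n → ℝ)
    (hQ : ∀ z : Fin n → ℝ, ∑ i, ∑ j, B i j * z i * z j ≤ μ * ∑ i, z i ^ 2)
    (hF : ∑ i, ∑ j, B i j * F i * F j = μ * ∑ i, F i ^ 2) (i : Fin n) : ∑ j, B i j * F j = μ * F i := by
  set r : Fin n → ℝ := fun i => ∑ j, B i j * F j - μ * F i with hr
  set R := ∑ i, r i ^ 2 with hR
  set q := ∑ i, ∑ j, B i j * r i * r j with hq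
  have key : ∀ t : ℝ, 2 * t * R + t ^ 2 * q ≤ μ * t ^ 2 * R := by
    intro t
    have h1 := hQ (fun i => F i + t * r i)
    have e1 : ∑ i, ∑ j, B i j * (F i + t * r i) * (F j + t * r j) = ∑ i, ∑ j, B i j * F i * F j
        + 2 * t * ∑ i, r i * ∑ j, B i j * F j + t ^ 2 * q := by
      have sw : ∑ i, ∑ j, B i j * F i * r j = ∑ i, r i * ∑ j, B i j * F j := by
        rw [Finset.sum_comm]
        refine Finset.sum_congr rfl fun i _ => ?_
        rw [Finset.mul_sum]
        exact Finset.sum_congr rfl fun j _ => by rw [hB]; ring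
      have : ∑ i, ∑ j, B i j * (F i + t * r i) * (F j + t * r j) = ∑ i, ∑ j, B i j * F i * F j
        + t * (∑ i, ∑ j, B i j * F i * r j) + t * ∑ i, r i * ∑ j, B i j * F j + t ^ 2 * q := by
        rw [hq]
        simp only [Finset.mul_sum, ← Finset.sum_add_distrib]
        exact Finset.sum_congr rfl fun i _ => Finset.sum_congr rfl fun j _ => by ring
      rw [this, sw]; ring
    have e2 : ∑ i, (F i + t * r i) ^ 2 = ∑ i, F i ^ 2 + 2 * t * ∑ i, r i * F i + t ^ 2 * R := by
      rw [hR]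
      simp only [Finset.mul_sum, ← Finset.sum_add_distrib]
      exact Finset.sum_congr rfl fun i _ => by ring
    have e3 : R = ∑ i, r i * ∑ j, B i j * F j - μ * ∑ i, r i * F i := by
      rw [hR, Finset.mul_sum, ← Finset.sum_sub_distrib]
      exact Finset.sum_congr rfl fun i _ => by simp only [hr]; ring
    rw [e1, e2, hF] at h1
    linear_combination h1 + 2 * t * e3
  have hR0 : 0 ≤ R := Finset.sum_nonneg fun i _ => sq_nonneg _
  have hRz : R = 0 := by
    by_contra hne
    have hpos : 0 < R := lt_of_le_of_ne hR0 (Ne.symm hne)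
    set C := |μ * R - q| + 1 with hC
    have hC0 : 0 < C := by positivity
    have h2 := key (R / C)
    have h3 : R / C * C = R := div_mul_cancel₀ _ hC0.ne'
    have h4 : μ * R - q ≤ C := (le_abs_self _).trans (by linarith)
    have h5 : 0 < R / C := by positivity
    have h6 : (R / C) ^ 2 * (μ * R - q) ≤ (R / C) ^ 2 * C := by gcongr
    have h7 : (R / C) ^ 2 * C = (R / C) * R := by rw [sq, mul_assoc, h3]
    nlinarith [mul_pos h5 hpos]
  have := (Finset.sum_eq_zero_iff_of_nonneg (fun i _ => sq_nonneg (r i))).1 hRz i (Finset.mem_univ i)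
  have := pow_eq_zero_iff (two_ne_zero) |>.1 this
  simp only [hr] at this
  linarith

lemma exists_max (n : ℕ) (hne : ∃ h F G : Fin n → ℝ, Feas h F G) :
    ∃ h F G : Fin n → ℝ, Feas h F G ∧ (∀ i, 0 ≤ F i) ∧ UB n (fval h F G) := by
  set K : Set ((Fin n → ℝ) × (Fin n → ℝ) × (Fin n → ℝ)) := {z | Feas z.1 z.2.1 z.2.2} with hK
  have hc : IsCompact K := by
    have hI : IsCompact (Set.Icc (fun _ => (-1:ℝ)) (fun _ => 1) : Set (Fin n → ℝ)) := isCompact_Icc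
    refine (hI.prod (hI.prod hI)).of_isClosed_subset ?_ ?_
    · have : K = {z | ∀ i, 0 ≤ z.1 i} ∩ ({z | ∑ i, z.1 i ^ 2 = 1} ∩ ({z | ∑ i, z.2.1 i ^ 2 = 1} ∩ {z | ∑ i, z.2.2 i ^ 2 = 1})) := by
        ext z; simp [hK, Feas]
      rw [this]
      refine IsClosed.inter ?_ (IsClosed.inter ?_ (IsClosed.inter ?_ ?_))
      · simp only [Set.setOf_forall]
        exact isClosed_iInter fun i => isClosed_le (by fun_prop) (by fun_prop)
      all_goals exact isClosed_eq (by fun_prop) (by fun_prop)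
    · rintro ⟨h, F, G⟩ ⟨_, h1, h2, h3⟩
      have aux : ∀ f : Fin n → ℝ, ∑ i, f i ^ 2 = 1 → f ∈ Set.Icc (fun _ => (-1:ℝ)) (fun _ => 1) := by
        intro f hf
        have : ∀ i, f i ^ 2 ≤ 1 := fun i => by
          rw [← hf]; exact Finset.single_le_sum (f := fun i => f i ^ 2) (fun i _ => sq_nonneg _) (Finset.mem_univ i)
        exact ⟨fun i => (abs_le.1 ((sq_le_one_iff_abs_le_one _).1 (this i))).1, fun i => (abs_le.1 ((sq_le_one_iff_abs_le_one _).1 (this i))).2⟩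
      exact ⟨aux _ h1, aux _ h2, aux _ h3⟩
  obtain ⟨h0, F0, G0, hf0⟩ := hne
  obtain ⟨⟨h, F, G⟩, hm, hmax⟩ := hc.exists_isMaxOn ⟨(h0, F0, G0), hf0⟩
    (f := fun z => fval z.1 z.2.1 z.2.2) (by unfold fval; fun_prop)
  obtain ⟨hh, h1, h2, h3⟩ := hm
  refine ⟨h, fun i => |F i|, G, ⟨hh, h1, by simpa using h2, h3⟩, fun i => abs_nonneg _, ?_⟩
  intro h' F' G' hf'
  refine (hmax (show (h', F', G') ∈ K from hf')).trans ?_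
  refine Finset.sum_le_sum fun i _ => Finset.sum_le_sum fun j _ => ?_
  refine mul_le_mul_of_nonneg_left ?_ (mul_nonneg (hh i) (hh j))
  refine max_le_max ?_ le_rfl
  have : F i * F j ≤ |F i| * |F j| := by rw [← abs_mul]; exact le_abs_self _
  dsimp only
  linarith

end S8

section S9

/-- Indicator of a positive kernel value. -/
noncomputable def Wm {n : ℕ} (F G : Fin n → ℝ) (i j : Fin n) : ℝ := if G i * G j < F i * F j then 1 else 0

lemma Wm_comm {n : ℕ} (F G : Fin n → ℝ) (i j : Fin n) : Wm F G i j = Wm F G j i := by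
  simp only [Wm, mul_comm]

lemma Wm_mem {n : ℕ} (F G : Fin n → ℝ) (i j : Fin n) : 0 ≤ Wm F G i j ∧ Wm F G i j ≤ 1 := by
  unfold Wm; split_ifs <;> simp

/-- Stationarity data. -/
structure Stat {n : ℕ} (h F G : Fin n → ℝ) (s μ L : ℝ) : Prop where
  hh : ∀ i, 0 ≤ h i
  h1 : ∑ i, h i ^ 2 = 1
  h2 : ∑ i, F i ^ 2 = 1
  h3 : ∑ i, G i ^ 2 = 1
  hF : ∀ i, 0 ≤ F i
  qF : qf (Wm F G) h F = μ
  qG : qf (Wm F G) h G = - L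
  sum : μ + L = s
  mu1 : μ ≤ 1
  L1 : L ≤ 1
  eF : ∀ i, h i * ∑ j, Wm F G i j * (h j * F j) = μ * F i
  eG : ∀ i, h i * ∑ j, Wm F G i j * (h j * G j) = - L * G i
  eh : ∀ i, μ * F i ^ 2 + L * G i ^ 2 = s * h i ^ 2

lemma mk_stat {n : ℕ} (h F G : Fin n → ℝ) (hf : Feas h F G) (hF : ∀ i, 0 ≤ F i) (hU : UB n (fval h F G)) :
    Stat h F G (fval h F G) (qf (Wm F G) h F) (- qf (Wm F G) h G) := by
  obtain ⟨hh, h1, h2, h3⟩ := hf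
  set s := fval h F G with hs
  set μ := qf (Wm F G) h F with hμ
  set L := - qf (Wm F G) h G with hL
  have hsum : μ + L = s := by rw [hs, fval_eq, hμ, hL]; unfold Wm; ring
  have hWa : ∀ i j, |Wm F G i j| ≤ 1 := fun i j => by
    rw [abs_of_nonneg (Wm_mem F G i j).1]; exact (Wm_mem F G i j).2
  have eF : ∀ i, h i * ∑ j, Wm F G i j * (h j * F j) = μ * F i := by
    intro i
    have := quad_stat (fun i j => Wm F G i j * h i * h j) (fun i j => by rw [Wm_comm]; ring) μ F ?_ ?_ i
    · rw [← this, Finset.mul_sum]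
      exact Finset.sum_congr rfl fun j _ => by ring
    · intro z
      have e : ∑ i, ∑ j, Wm F G i j * h i * h j * z i * z j = qf (Wm F G) h z := by
        unfold qf
        exact Finset.sum_congr rfl fun i _ => Finset.sum_congr rfl fun j _ => by ring
      rw [e]
      have hz0 : 0 ≤ ∑ i, z i ^ 2 := Finset.sum_nonneg fun i _ => sq_nonneg _
      rcases eq_or_lt_of_le hz0 with h0 | h0
      · rw [← h0]
        have hz := (Finset.sum_eq_zero_iff_of_nonneg (fun i _ => sq_nonneg (z i))).1 h0.symm
        have hz' : ∀ i, z i = 0 := fun i => pow_eq_zero_iff two_ne_zero |>.1 (hz i (Finset.mem_univ i))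
        simp [qf, hz']
      · have := hU.hom (Wm F G) (Wm_mem F G) h z G hh (by rw [h1]; norm_num) h0 (by rw [h3]; norm_num)
        rw [h1, h3] at this
        have e2 : (∑ i, z i ^ 2)⁻¹ * qf (Wm F G) h z ≤ μ := by linarith
        rw [inv_mul_le_iff₀ h0] at e2
        linarith
    · rw [h2, mul_one, hμ]; unfold qf
      exact Finset.sum_congr rfl fun i _ => Finset.sum_congr rfl fun j _ => by ring
  have eG : ∀ i, h i * ∑ j, Wm F G i j * (h j * G j) = - L * G i := by
    intro i
    have := quad_stat (fun i j => - (Wm F G i j * h i * h j)) (fun i j => by rw [Wm_comm]; ring) L G ?_ ?_ i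
    · rw [neg_mul, ← this, Finset.mul_sum, ← Finset.sum_neg_distrib]
      exact Finset.sum_congr rfl fun j _ => by ring
    · intro z
      have e : ∑ i, ∑ j, -(Wm F G i j * h i * h j) * z i * z j = - qf (Wm F G) h z := by
        unfold qf
        simp only [← Finset.sum_neg_distrib]
        exact Finset.sum_congr rfl fun i _ => Finset.sum_congr rfl fun j _ => by ring
      rw [e]
      have hz0 : 0 ≤ ∑ i, z i ^ 2 := Finset.sum_nonneg fun i _ => sq_nonneg _
      rcases eq_or_lt_of_le hz0 with h0 | h0
      · rw [← h0]
        have hz := (Finset.sum_eq_zero_iff_of_nonneg (fun i _ => sq_nonneg (z i))).1 h0.symm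
        have hz' : ∀ i, z i = 0 := fun i => pow_eq_zero_iff two_ne_zero |>.1 (hz i (Finset.mem_univ i))
        simp [qf, hz']
      · have := hU.hom (Wm F G) (Wm_mem F G) h F z hh (by rw [h1]; norm_num) (by rw [h2]; norm_num) h0
        rw [h1, h2] at this
        have e2 : (∑ i, z i ^ 2)⁻¹ * (- qf (Wm F G) h z) ≤ L := by linarith
        rw [inv_mul_le_iff₀ h0] at e2
        linarith
    · rw [h3, mul_one, hL]; unfold qf
      simp only [← Finset.sum_neg_distrib]
      exact Finset.sum_congr rfl fun i _ => Finset.sum_congr rfl fun j _ => by ring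
  have eh0 : ∀ i, ∑ j, max (F i * F j - G i * G j) 0 * h j = s * h i := by
    intro i
    refine quad_stat (fun i j => max (F i * F j - G i * G j) 0) (fun i j => by rw [mul_comm, mul_comm (G i)]) s h ?_ ?_ i
    · intro z
      have hz0 : 0 ≤ ∑ i, z i ^ 2 := Finset.sum_nonneg fun i _ => sq_nonneg _
      rcases eq_or_lt_of_le hz0 with h0 | h0
      · rw [← h0]
        have hz := (Finset.sum_eq_zero_iff_of_nonneg (fun i _ => sq_nonneg (z i))).1 h0.symm
        have hz' : ∀ i, z i = 0 := fun i => pow_eq_zero_iff two_ne_zero |>.1 (hz i (Finset.mem_univ i))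
        simp [hz']
      · have h0' : 0 < ∑ i, |z i| ^ 2 := by simpa using h0
        have := hU.hom (Wm F G) (Wm_mem F G) (fun i => |z i|) F G (fun i => abs_nonneg _) h0' (by rw [h2]; norm_num) (by rw [h3]; norm_num)
        rw [h2, h3, inv_one, one_mul, one_mul] at this
        have e3 := fval_eq (fun i => |z i|) F G
        unfold Wm at this
        rw [← e3, inv_mul_le_iff₀ h0'] at this
        simp only [sq_abs] at this
        rw [mul_comm s]
        refine le_trans ?_ this
        refine Finset.sum_le_sum fun i _ => Finset.sum_le_sum fun j _ => ?_
        have : z i * z j ≤ |z i| * |z j| := by rw [← abs_mul]; exact le_abs_self _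
        have := mul_le_mul_of_nonneg_left this (le_max_right (F i * F j - G i * G j) 0)
        linarith
    · rw [h1, mul_one, hs]; unfold fval
      exact Finset.sum_congr rfl fun i _ => Finset.sum_congr rfl fun j _ => by ring
  refine ⟨hh, h1, h2, h3, hF, rfl, by simp [hL], hsum, ?_, ?_, eF, eG, ?_⟩
  · exact (abs_le.1 (qf_abs_le _ hWa h F hh h1 h2)).2
  · linarith [(abs_le.1 (qf_abs_le _ hWa h G hh h1 h3)).1]
  · intro i
    have a1 := eF i
    have a2 := eG i
    have a3 := eh0 i
    have a4 : ∑ j, max (F i * F j - G i * G j) 0 * h j = F i * ∑ j, Wm F G i j * (h j * F j) - G i * ∑ j, Wm F G i j * (h j * G j) := by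
      simp only [Finset.mul_sum, ← Finset.sum_sub_distrib]
      refine Finset.sum_congr rfl fun j _ => ?_
      unfold Wm
      split_ifs with h0
      · rw [max_eq_left (by linarith)]; ring
      · rw [max_eq_right (by linarith)]; ring
    rw [a3] at a4
    linear_combination (-F i) * a1 + G i * a2 - h i * a4

/-- Adding an atom. -/
lemma Stat.new_atom {n : ℕ} {h F G : Fin n → ℝ} {s μ L S τ : ℝ} (st : Stat h F G s μ L) (hS : UB (n + 1) S)
    (hμ : 0 < μ) (hL : 0 < L) (hτ : 0 < τ) (A : Finset (Fin n)) (x y : ℝ)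
    (hx : ∑ i ∈ A, h i * F i = μ * x) (hy : ∑ i ∈ A, h i * G i = - L * y) :
    s + τ * (μ * x ^ 2 / (1 + τ * x ^ 2)) + τ * (L * y ^ 2 / (1 + τ * y ^ 2)) ≤ (1 + τ) * S := by
  classical
  set W' : Fin (n + 1) → Fin (n + 1) → ℝ :=
    Fin.cons (Fin.cons 0 (fun j => if j ∈ A then 1 else 0)) (fun i => Fin.cons (if i ∈ A then 1 else 0) (fun j => Wm F G i j)) with hW'
  have hW : ∀ i j, 0 ≤ W' i j ∧ W' i j ≤ 1 := by
    intro i j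
    refine Fin.cases ?_ (fun i => ?_) i <;> refine Fin.cases ?_ (fun j => ?_) j
    · simp [hW']
    · simp only [hW', Fin.cons_zero, Fin.cons_succ]; split_ifs <;> simp
    · simp only [hW', Fin.cons_zero, Fin.cons_succ]; split_ifs <;> simp
    · simp only [hW', Fin.cons_succ]; exact Wm_mem F G i j
  set t := √τ with ht
  have ht2 : t ^ 2 = τ := Real.sq_sqrt hτ.le
  have qn : ∀ (H : Fin n → ℝ) (z : ℝ), qf W' (Fin.cons t h) (Fin.cons (t * z) H) = qf (Wm F G) h H + 2 * τ * z * ∑ i ∈ A, h i * H i := by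
    intro H z
    unfold qf
    simp only [Fin.sum_univ_succ, hW', Fin.cons_zero, Fin.cons_succ, Finset.sum_add_distrib]
    have e1 : ∑ j, (if j ∈ A then (1:ℝ) else 0) * (t * (t * z)) * (h j * H j) = τ * z * ∑ i ∈ A, h i * H i := by
      rw [← ht2, Finset.mul_sum, ← Finset.sum_filter_add_sum_filter_not Finset.univ (fun j => j ∈ A)]
      rw [Finset.sum_eq_zero (s := Finset.filter (fun j => ¬ j ∈ A) Finset.univ), add_zero]
      · have : Finset.filter (fun j => j ∈ A) Finset.univ = A := by ext; simp
        rw [this]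
        exact Finset.sum_congr rfl fun j hj => by rw [if_pos hj]; ring
      · intro j hj
        rw [if_neg (Finset.mem_filter.1 hj).2]; ring
    have e2 : ∑ j, (if j ∈ A then (1:ℝ) else 0) * (h j * H j) * (t * (t * z)) = τ * z * ∑ i ∈ A, h i * H i := by
      rw [← e1]
      exact Finset.sum_congr rfl fun j _ => by ring
    rw [e1, e2]; ring
  have nn : ∀ (H : Fin n → ℝ) (z : ℝ), ∑ i, (Fin.cons (t * z) H : Fin (n+1) → ℝ) i ^ 2 = ∑ i, H i ^ 2 + τ * z ^ 2 := by
    intro H z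
    simp only [Fin.sum_univ_succ, Fin.cons_zero, Fin.cons_succ]
    rw [← ht2]; ring
  have nh : ∑ i, (Fin.cons t h : Fin (n+1) → ℝ) i ^ 2 = 1 + τ := by
    have := nn h 1
    rw [mul_one, st.h1] at this
    rw [this]; ring
  have px : 0 < 1 + τ * x ^ 2 := by positivity
  have py : 0 < 1 + τ * y ^ 2 := by positivity
  have key := hS.hom W' hW (Fin.cons t h) (Fin.cons (t * x) F) (Fin.cons (t * y) G) ?_ (by rw [nh]; positivity)
    (by rw [nn, st.h2]; positivity) (by rw [nn, st.h3]; positivity)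
  · rw [nh, nn, nn, qn, qn, st.h2, st.h3, st.qF, st.qG, hx, hy, inv_mul_le_iff₀ (by positivity)] at key
    refine le_trans (le_of_eq ?_) key
    rw [← st.sum]
    field_simp
    ring
  · intro i
    refine Fin.cases ?_ (fun i => ?_) i
    · simp [ht]
    · simpa using st.hh i

lemma Stat.hA {n : ℕ} {h F G : Fin n → ℝ} {s μ L S τ η : ℝ} (st : Stat h F G s μ L) (hS : UB (n + 1) S)
    (hs : 1.15 < s) (hs2 : s ≤ 2) (hτ : 0 < τ) (hτ1 : τ ≤ 1) (hτη : 202 * τ ≤ η) (hSs : S ≤ s + τ ^ 2) (A : Finset (Fin n)) :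
    (∑ i ∈ A, h i * F i) ^ 2 / μ + (∑ i ∈ A, h i * G i) ^ 2 / L ≤ s * (1 + η) := by
  have hsum := st.sum
  have hμ1 := st.mu1
  have hL1 := st.L1
  have hμ : 0.15 < μ := by linarith
  have hL : 0.15 < L := by linarith
  have cs : ∀ H : Fin n → ℝ, ∑ i, H i ^ 2 = 1 → (∑ i ∈ A, h i * H i) ^ 2 ≤ 1 := by
    intro H hH
    have := Finset.sum_mul_sq_le_sq_mul_sq A h H
    have a1 : ∑ i ∈ A, h i ^ 2 ≤ 1 := by
      rw [← st.h1]; exact Finset.sum_le_sum_of_subset_of_nonneg (Finset.subset_univ _) fun _ _ _ => sq_nonneg _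
    have a2 : ∑ i ∈ A, H i ^ 2 ≤ 1 := by
      rw [← hH]; exact Finset.sum_le_sum_of_subset_of_nonneg (Finset.subset_univ _) fun _ _ _ => sq_nonneg _
    have a3 : 0 ≤ ∑ i ∈ A, h i ^ 2 := Finset.sum_nonneg fun _ _ => sq_nonneg _
    have a4 : 0 ≤ ∑ i ∈ A, H i ^ 2 := Finset.sum_nonneg fun _ _ => sq_nonneg _
    nlinarith
  set x := (∑ i ∈ A, h i * F i) / μ with hx
  set y := - (∑ i ∈ A, h i * G i) / L with hy
  have ex : ∑ i ∈ A, h i * F i = μ * x := by rw [hx]; field_simp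
  have ey : ∑ i ∈ A, h i * G i = - L * y := by rw [hy]; field_simp
  have key := st.new_atom hS (by linarith) (by linarith) hτ A x y ex ey
  have c1 := cs F st.h2
  have c2 := cs G st.h3
  rw [ex] at c1 ⊢
  rw [ey] at c2 ⊢
  have g1 : (μ * x) ^ 2 / μ = μ * x ^ 2 := by field_simp
  have g2 : (- L * y) ^ 2 / L = L * y ^ 2 := by field_simp
  rw [g1, g2]
  have x50 : x ^ 2 ≤ 50 := by
    by_contra hh; push Not at hh
    nlinarith [mul_pos (sub_pos.2 hμ) (sub_pos.2 hμ)]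
  have y50 : y ^ 2 ≤ 50 := by
    by_contra hh; push Not at hh
    nlinarith [mul_pos (sub_pos.2 hL) (sub_pos.2 hL)]
  have f1 : μ * x ^ 2 / (1 + τ * 50) ≤ μ * x ^ 2 / (1 + τ * x ^ 2) := by
    have : 0 ≤ μ * x ^ 2 := mul_nonneg (by linarith) (sq_nonneg _)
    gcongr
  have f2 : L * y ^ 2 / (1 + τ * 50) ≤ L * y ^ 2 / (1 + τ * y ^ 2) := by
    have : 0 ≤ L * y ^ 2 := mul_nonneg (by linarith) (sq_nonneg _)
    gcongr
  have f3 : τ * ((μ * x ^ 2 + L * y ^ 2) / (1 + τ * 50)) ≤ τ * (s + τ + τ ^ 2) := by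
    rw [add_div]
    have := mul_le_mul_of_nonneg_left f1 hτ.le
    have := mul_le_mul_of_nonneg_left f2 hτ.le
    have := mul_le_mul_of_nonneg_left hSs (by linarith : 0 ≤ 1 + τ)
    nlinarith
  have f4 := le_of_mul_le_mul_left f3 hτ
  rw [div_le_iff₀ (by positivity)] at f4
  have f5 : τ ^ 2 ≤ τ := by nlinarith
  have f6 : τ ^ 3 ≤ τ := by nlinarith
  nlinarith

end S9

section S10

lemma sum_pos_subtype {n : ℕ} (h f : Fin n → ℝ) (hh : ∀ i, 0 ≤ h i) (hf : ∀ i, h i = 0 → f i = 0) :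
    ∑ x : {i : Fin n // 0 < h i}, f x = ∑ i, f i := by
  rw [← Finset.sum_subtype (Finset.univ.filter fun i => 0 < h i) (by simp) f]
  refine Finset.sum_filter_of_ne fun i _ hi => ?_
  exact lt_of_le_of_ne (hh i) fun h0 => hi (hf i h0.symm)

set_option maxHeartbeats 1000000 in
lemma Stat.toCfg {n : ℕ} {h F G : Fin n → ℝ} {s μ L η : ℝ} (st : Stat h F G s μ L)
    (hs : 1.15 < s)
    (hA : ∀ A : Finset (Fin n), (∑ i ∈ A, h i * F i) ^ 2 / μ + (∑ i ∈ A, h i * G i) ^ 2 / L ≤ s * (1 + η)) :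
    Config (ι := {i : Fin n // 0 < h i}) (fun i => h i ^ 2 / s) (fun i => √μ * F i / (√s * h i))
      (fun i => √L * G i / (√s * h i)) (μ / s) (1 / s) η := by
  have hsum := st.sum
  have hμ1 := st.mu1
  have hL1 := st.L1
  have hμ : 0 < μ := by linarith
  have hL : 0 < L := by linarith
  have hs0 : 0 < s := by linarith
  have hα : 0 < √μ := Real.sqrt_pos.2 hμ
  have hβ : 0 < √L := Real.sqrt_pos.2 hL
  have hq : 0 < √s := Real.sqrt_pos.2 hs0
  have hα2 : √μ ^ 2 = μ := Real.sq_sqrt hμ.le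
  have hβ2 : √L ^ 2 = L := Real.sq_sqrt hL.le
  have hq2 : √s ^ 2 = s := Real.sq_sqrt hs0.le
  have h1m : 1 - μ / s = L / s := by field_simp; linarith
  have hz : ∀ i, h i = 0 → F i = 0 ∧ G i = 0 := by
    intro i hi
    have := st.eh i
    rw [hi] at this
    have a1 : 0 ≤ μ * F i ^ 2 := by positivity
    have a2 : 0 ≤ L * G i ^ 2 := by positivity
    have b1 : μ * F i ^ 2 = 0 := by linarith
    have b2 : L * G i ^ 2 = 0 := by linarith
    exact ⟨pow_eq_zero_iff two_ne_zero |>.1 ((mul_eq_zero.1 b1).resolve_left hμ.ne'),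
      pow_eq_zero_iff two_ne_zero |>.1 ((mul_eq_zero.1 b2).resolve_left hL.ne')⟩
  have kc : ∀ (a : ℝ) (H : Fin n → ℝ) (i : {i : Fin n // 0 < h i}), h i ^ 2 / s * (a * H i / (√s * h i)) = a / (s * √s) * (h i * H i) := by
    intro a H i
    have := i.2
    field_simp
  have nb : ∀ i j : {i : Fin n // 0 < h i},
      (μ / s * (√L * G i / (√s * h i)) * (√L * G j / (√s * h j)) < (1 - μ / s) * (√μ * F i / (√s * h i)) * (√μ * F j / (√s * h j))
        ↔ G i * G j < F i * F j) := by
    intro i j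
    have hi := i.2
    have hj := j.2
    have e1 : μ / s * (√L * G i / (√s * h i)) * (√L * G j / (√s * h j)) = μ * L / (s ^ 2 * h i * h j) * (G i * G j) := by
      field_simp; rw [hβ2, hq2]; ring
    have e2 : (1 - μ / s) * (√μ * F i / (√s * h i)) * (√μ * F j / (√s * h j)) = μ * L / (s ^ 2 * h i * h j) * (F i * F j) := by
      rw [h1m]; field_simp; rw [hα2, hq2]; ring
    rw [e1, e2]
    exact mul_lt_mul_iff_right₀ (by positivity)
  have eq : ∀ (a lam : ℝ) (H : Fin n → ℝ), (∀ i, h i * ∑ j, Wm F G i j * (h j * H j) = lam * H i) → ∀ i : {i : Fin n // 0 < h i},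
      ∑ j ∈ nbr (fun i : {i : Fin n // 0 < h i} => √μ * F i / (√s * h i)) (fun i => √L * G i / (√s * h i)) (μ / s) i,
        h j ^ 2 / s * (a * H j / (√s * h j)) = (lam / s) * (a * H i / (√s * h i)) := by
    intro a lam H hH i
    have hi := i.2
    unfold nbr
    rw [Finset.sum_filter]
    have : ∀ j : {i : Fin n // 0 < h i}, (if μ / s * (√L * G i / (√s * h i)) * (√L * G j / (√s * h j)) < (1 - μ / s) * (√μ * F i / (√s * h i)) * (√μ * F j / (√s * h j))
        then h j ^ 2 / s * (a * H j / (√s * h j)) else 0) = (fun j : Fin n => a / (s * √s) * (Wm F G i j * (h j * H j))) j := by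
      intro j
      dsimp only
      rw [kc]
      unfold Wm
      by_cases hc : G i * G j < F i * F j
      · rw [if_pos ((nb i j).2 hc), if_pos hc, one_mul]
      · rw [if_neg (fun hx => hc ((nb i j).1 hx)), if_neg hc]; ring
    rw [Finset.sum_congr rfl fun j _ => this j, sum_pos_subtype h (fun j : Fin n => a / (s * √s) * (Wm F G i j * (h j * H j))) st.hh (fun i hi => by rw [hi]; ring), ← Finset.mul_sum]
    have e := hH i
    have : ∑ j, Wm F G i j * (h j * H j) = lam * H i / h i := by rw [← e]; field_simp
    rw [this]
    field_simp
  have sq : ∀ (a : ℝ) (H K : Fin n → ℝ) (i : {i : Fin n // 0 < h i}), h i ^ 2 / s * (a * (H i * K i) / (s * h i ^ 2)) = a / s ^ 2 * (H i * K i) := by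
    intro a H K i
    have := i.2
    field_simp
  have hsq : ∀ (a : ℝ) (H : Fin n → ℝ) (i : {i : Fin n // 0 < h i}), (a * H i / (√s * h i)) ^ 2 = a ^ 2 * (H i * H i) / (s * h i ^ 2) := by
    intro a H i
    rw [div_pow, mul_pow, mul_pow, hq2]; ring
  refine ⟨?_, ?_, ?_, by positivity, ?_, by positivity, ?_, ?_, ?_, ?_, ?_, ?_, ?_, ?_, ?_⟩
  · intro i; have := i.2; positivity
  · intro i; have := i.2; have := st.hF i; positivity
  · intro i
    have hi := i.2
    rw [hsq, hsq, hα2, hβ2, ← add_div, div_eq_one_iff_eq (by positivity)]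
    linarith [st.eh i]
  · rw [div_lt_one hs0]; linarith
  · rw [div_lt_one hs0]; linarith
  · gcongr
  · intro i; exact eq √μ μ F st.eF i
  · intro i
    have := eq √L (-L) G st.eG i
    rw [h1m, this]; ring
  · rw [sum_pos_subtype h (fun i => h i ^ 2 / s) st.hh (fun i hi => by simp [hi]), ← Finset.sum_div, st.h1]
  · simp only [hsq, hα2, sq]
    rw [sum_pos_subtype h (fun i => μ / s ^ 2 * (F i * F i)) st.hh (fun i hi => by simp [(hz i hi).1]), ← Finset.mul_sum]
    have := st.h2
    simp only [pow_two] at this ⊢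
    rw [this]; field_simp
  · simp only [hsq, hβ2, sq, h1m]
    rw [sum_pos_subtype h (fun i => L / s ^ 2 * (G i * G i)) st.hh (fun i hi => by simp [(hz i hi).2]), ← Finset.mul_sum]
    have := st.h3
    simp only [pow_two] at this ⊢
    rw [this]; field_simp
  · have e : ∀ i : {i : Fin n // 0 < h i}, h i ^ 2 / s * (√μ * F i / (√s * h i) * (√L * G i / (√s * h i))) = (√μ * √L) / s ^ 2 * (F i * G i) := by
      intro i
      rw [← sq]; congr 1
      have := i.2
      field_simp; rw [hq2]; ring
    rw [Finset.sum_congr rfl fun i _ => e i, sum_pos_subtype h (fun i => (√μ * √L) / s ^ 2 * (F i * G i)) st.hh (fun i hi => by simp [(hz i hi).1]), ← Finset.mul_sum]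
    have o1 : μ * ∑ i, F i * G i = ∑ i, ∑ j, Wm F G i j * (h i * G i) * (h j * F j) := by
      rw [Finset.mul_sum]
      refine Finset.sum_congr rfl fun i _ => ?_
      have := st.eF i
      rw [← mul_assoc, ← this, mul_assoc, Finset.sum_mul, Finset.mul_sum]
      exact Finset.sum_congr rfl fun j _ => by ring
    have o2 : - L * ∑ i, F i * G i = ∑ i, ∑ j, Wm F G i j * (h i * G i) * (h j * F j) := by
      rw [Finset.mul_sum, Finset.sum_comm]
      refine Finset.sum_congr rfl fun i _ => ?_
      have := st.eG i
      rw [mul_comm (F i), ← mul_assoc, ← this, mul_assoc, Finset.sum_mul, Finset.mul_sum]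
      exact Finset.sum_congr rfl fun j _ => by rw [Wm_comm]; ring
    have o3 : s * ∑ i, F i * G i = 0 := by rw [← hsum]; linarith
    rw [(mul_eq_zero.1 o3).resolve_left hs0.ne', mul_zero]
  · intro A
    simp only [kc]
    rw [← Finset.mul_sum, ← Finset.mul_sum, h1m]
    have := hA (A.map (Function.Embedding.subtype _))
    rw [Finset.sum_map, Finset.sum_map] at this
    simp only [Function.Embedding.subtype_apply] at this
    set X := ∑ i ∈ A, h i * F i
    set Y := ∑ i ∈ A, h i * G i
    have e : (√μ / (s * √s) * X) ^ 2 / (μ / s) ^ 2 + (√L / (s * √s) * Y) ^ 2 / (L / s) ^ 2 = (X ^ 2 / μ + Y ^ 2 / L) / s := by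
      simp only [mul_pow, div_pow, hα2, hβ2, hq2]
      field_simp
    rw [e, div_le_iff₀ hs0]
    linarith

theorem finite_bound (n : ℕ) : UB n (2 / √3) := by
  by_contra hcon
  set V : Set ℝ := {v | ∃ (n : ℕ) (h F G : Fin n → ℝ), Feas h F G ∧ v = fval h F G} with hV
  have hbd : BddAbove V := ⟨2, by rintro v ⟨n, h, F, G, hf, rfl⟩; exact ub_two n h F G hf⟩
  set S := sSup V with hS
  have hUB : ∀ n, UB n S := fun n h F G hf => le_csSup hbd ⟨n, h, F, G, hf, rfl⟩
  unfold UB at hcon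
  push Not at hcon
  obtain ⟨h0, F0, G0, hf0, hlt⟩ := hcon
  have hVne : V.Nonempty := ⟨_, n, h0, F0, G0, hf0, rfl⟩
  have hS0 : 2 / √3 < S := hlt.trans_le (hUB n h0 F0 G0 hf0)
  have h3 : 0 < √3 := by positivity
  have h3' : √3 ^ 2 = 3 := Real.sq_sqrt (by norm_num)
  have h115 : 1.15 < 2 / √3 := by
    rw [lt_div_iff₀ h3]
    nlinarith
  set s0 := (S + 2 / √3) / 2 with hs0
  have hs0S : s0 < S := by linarith
  have hs0l : 2 / √3 < s0 := by linarith
  have hp0 : 1 / s0 < √3 / 2 := by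
    rw [div_lt_iff₀ (by linarith)]
    have : √3 / 2 * (2 / √3) = 1 := by field_simp
    rw [← this]
    gcongr
  obtain ⟨η, hη, H⟩ := no_cfg (1 / s0) hp0
  set τ := min (min 1 (η / 202)) (S - s0) with hτ
  have hτ0 : 0 < τ := lt_min (lt_min one_pos (by positivity)) (by linarith)
  have t1 : τ ≤ 1 := (min_le_left _ _).trans (min_le_left _ _)
  have t2 : τ ≤ η / 202 := (min_le_left _ _).trans (min_le_right _ _)
  have t3 : τ ≤ S - s0 := min_le_right _ _
  have t4 : τ ^ 2 ≤ τ := by nlinarith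
  obtain ⟨v, ⟨N, h1, F1, G1, hf1, rfl⟩, hv⟩ := exists_lt_of_lt_csSup hVne (show S - τ ^ 2 < sSup V by
    have : 0 < τ ^ 2 := by positivity
    linarith)
  obtain ⟨h, F, G, hf, hF, hU⟩ := exists_max N ⟨h1, F1, G1, hf1⟩
  have hsv := hU h1 F1 G1 hf1
  have hs2 := ub_two N h F G hf
  have st := mk_stat h F G hf hF hU
  have hss : s0 ≤ fval h F G := by linarith
  have hs115 : 1.15 < fval h F G := by linarith
  have cfg := st.toCfg (η := η) hs115 (fun A => st.hA (hUB (N + 1)) hs115 hs2 hτ0 t1 (by linarith) (by linarith) A)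
  refine H _ _ _ _ _ cfg ?_
  have : 0 < s0 := by linarith
  gcongr

end S10

section S11
open MeasureTheory Filter Topology



/-- Indicator of the `i`-th cell. -/
noncomputable def cell {n : ℕ} (π : ℝ → Fin n) (i : Fin n) (x : ℝ) : ℝ := if π x = i then 1 else 0

lemma cell_meas {n : ℕ} {π : ℝ → Fin n} (hπ : Measurable π) (i : Fin n) : Measurable (cell π i) :=
  Measurable.ite (hπ (measurableSet_singleton i)) measurable_const measurable_const

lemma cell_mem {n : ℕ} (π : ℝ → Fin n) (i : Fin n) (x : ℝ) : 0 ≤ cell π i x ∧ cell π i x ≤ 1 := by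
  unfold cell; split_ifs <;> simp

lemma cell_sum {n : ℕ} (π : ℝ → Fin n) (φ : Fin n → ℝ) (x : ℝ) : φ (π x) = ∑ i, φ i * cell π i x := by
  simp [cell]

lemma cell_integrable {n : ℕ} {π : ℝ → Fin n} (hπ : Measurable π) (ν : Measure ℝ) [IsProbabilityMeasure ν] (i : Fin n) :
    Integrable (cell π i) ν :=
  Integrable.mono' (integrable_const (1:ℝ)) (cell_meas hπ i).aestronglyMeasurable
    (Eventually.of_forall fun x => by rw [Real.norm_of_nonneg (cell_mem π i x).1]; exact (cell_mem π i x).2)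

lemma step_bound {n : ℕ} (π : ℝ → Fin n) (hπ : Measurable π) (φ γ : Fin n → ℝ) (ν : Measure ℝ) [IsProbabilityMeasure ν]
    (W : ℝ × ℝ → ℝ) (hWm : Measurable W) (hW : ∀ z, 0 ≤ W z ∧ W z ≤ 1)
    (hf : 0 < ∫ x, φ (π x) ^ 2 ∂ν) (hg : 0 < ∫ x, γ (π x) ^ 2 ∂ν) :
    (∫ x, φ (π x) ^ 2 ∂ν)⁻¹ * (∫ z, W z * (φ (π z.1) * φ (π z.2)) ∂(ν.prod ν))
      - (∫ x, γ (π x) ^ 2 ∂ν)⁻¹ * (∫ z, W z * (γ (π z.1) * γ (π z.2)) ∂(ν.prod ν)) ≤ 2 / √3 := by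
  set w : Fin n → ℝ := fun i => ∫ x, cell π i x ∂ν with hw
  have w0 : ∀ i, 0 ≤ w i := fun i => integral_nonneg fun x => (cell_mem π i x).1
  set I : Fin n → Fin n → ℝ := fun i j => ∫ z, W z * (cell π i z.1 * cell π j z.2) ∂(ν.prod ν) with hI
  have hcc : ∀ i j, Integrable (fun z : ℝ × ℝ => cell π i z.1 * cell π j z.2) (ν.prod ν) := fun i j =>
    (cell_integrable hπ ν i).mul_prod (cell_integrable hπ ν j)
  have hWcc : ∀ i j, Integrable (fun z : ℝ × ℝ => W z * (cell π i z.1 * cell π j z.2)) (ν.prod ν) := fun i j =>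
    (hcc i j).bdd_mul (c := 1) hWm.aestronglyMeasurable
      (Eventually.of_forall fun z => by rw [Real.norm_of_nonneg (hW z).1]; exact (hW z).2)
  have I0 : ∀ i j, 0 ≤ I i j := fun i j => integral_nonneg fun z =>
    mul_nonneg (hW z).1 (mul_nonneg (cell_mem π i z.1).1 (cell_mem π j z.2).1)
  have I1 : ∀ i j, I i j ≤ w i * w j := by
    intro i j
    rw [hw, ← integral_prod_mul]
    refine integral_mono (hWcc i j) (hcc i j) fun z => ?_
    have := mul_nonneg (cell_mem π i z.1).1 (cell_mem π j z.2).1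
    dsimp only
    nlinarith [hW z]
  have wsum : ∑ i, w i = 1 := by
    rw [hw, ← integral_finset_sum _ (fun i _ => cell_integrable hπ ν i)]
    have : ∀ x, ∑ i, cell π i x = 1 := fun x => by simp [cell]
    simp [this]
  have sqn : ∀ φ : Fin n → ℝ, ∫ x, φ (π x) ^ 2 ∂ν = ∑ i, (√(w i) * φ i) ^ 2 := by
    intro φ
    have e : ∀ x, φ (π x) ^ 2 = ∑ i, φ i ^ 2 * cell π i x := fun x => cell_sum π (fun i => φ i ^ 2) x
    simp only [e]
    rw [integral_finset_sum _ (fun i _ => (cell_integrable hπ ν i).const_mul _)]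
    refine Finset.sum_congr rfl fun i _ => ?_
    rw [integral_const_mul, mul_pow, Real.sq_sqrt (w0 i)]; ring
  set U : Fin n → Fin n → ℝ := fun i j => I i j / (w i * w j) with hU
  have quad : ∀ φ : Fin n → ℝ, ∫ z, W z * (φ (π z.1) * φ (π z.2)) ∂(ν.prod ν) = qf U (fun i => √(w i)) (fun i => √(w i) * φ i) := by
    intro φ
    have e : ∀ z : ℝ × ℝ, W z * (φ (π z.1) * φ (π z.2)) = ∑ i, ∑ j, (φ i * φ j) * (W z * (cell π i z.1 * cell π j z.2)) := by
      intro z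
      rw [cell_sum π φ z.1, cell_sum π φ z.2, Finset.sum_mul_sum, Finset.mul_sum]
      refine Finset.sum_congr rfl fun i _ => ?_
      rw [Finset.mul_sum]
      exact Finset.sum_congr rfl fun j _ => by ring
    simp only [e]
    rw [integral_finset_sum _ (fun i _ => integrable_finset_sum _ fun j _ => (hWcc i j).const_mul _)]
    unfold qf
    refine Finset.sum_congr rfl fun i _ => ?_
    rw [integral_finset_sum _ fun j _ => (hWcc i j).const_mul _]
    refine Finset.sum_congr rfl fun j _ => ?_
    rw [integral_const_mul]
    change φ i * φ j * I i j = _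
    have si := Real.mul_self_sqrt (w0 i)
    have sj := Real.mul_self_sqrt (w0 j)
    have e2 : U i j * (√(w i) * (√(w i) * φ i)) * (√(w j) * (√(w j) * φ j)) = U i j * ((√(w i) * √(w i)) * (√(w j) * √(w j))) * (φ i * φ j) := by ring
    rw [e2, si, sj]
    have e3 : U i j * (w i * w j) = I i j := by
      simp only [hU]
      rcases eq_or_ne (w i * w j) 0 with h0 | h0
      · have := I0 i j
        have := I1 i j
        rw [h0] at this ⊢
        simp; linarith
      · exact div_mul_cancel₀ _ h0
    rw [e3]; ring
  have hUm : ∀ i j, 0 ≤ U i j ∧ U i j ≤ 1 := fun i j =>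
    ⟨div_nonneg (I0 i j) (mul_nonneg (w0 i) (w0 j)), div_le_one_of_le₀ (I1 i j) (mul_nonneg (w0 i) (w0 j))⟩
  have h1 : ∑ i, √(w i) ^ 2 = 1 := by
    rw [← wsum]
    exact Finset.sum_congr rfl fun i _ => Real.sq_sqrt (w0 i)
  have key := (finite_bound n).hom U hUm (fun i => √(w i)) (fun i => √(w i) * φ i) (fun i => √(w i) * γ i)
    (fun i => Real.sqrt_nonneg _) (by rw [h1]; norm_num) (by rw [← sqn]; exact hf) (by rw [← sqn]; exact hg)
  rw [h1, inv_one, one_mul, ← sqn, ← sqn, ← quad, ← quad] at key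
  exact key

lemma simple_bound (f g : SimpleFunc ℝ ℝ) (ν : Measure ℝ) [IsProbabilityMeasure ν]
    (W : ℝ × ℝ → ℝ) (hWm : Measurable W) (hW : ∀ z, 0 ≤ W z ∧ W z ≤ 1)
    (hf : 0 < ∫ x, f x ^ 2 ∂ν) (hg : 0 < ∫ x, g x ^ 2 ∂ν) :
    (∫ x, f x ^ 2 ∂ν)⁻¹ * (∫ z, W z * (f z.1 * f z.2) ∂(ν.prod ν))
      - (∫ x, g x ^ 2 ∂ν)⁻¹ * (∫ z, W z * (g z.1 * g z.2) ∂(ν.prod ν)) ≤ 2 / √3 := by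
  classical
  set P := f.pair g with hP
  set R := P.range with hR
  set e := R.equivFin with he
  set π : ℝ → Fin R.card := fun x => e ⟨P x, P.mem_range_self x⟩ with hπ
  have hm : Measurable π := by
    refine measurable_to_countable' fun i => ?_
    have : π ⁻¹' {i} = P ⁻¹' {(e.symm i).1} := by
      ext x
      simp only [hπ, Set.mem_preimage, Set.mem_singleton_iff, ← Equiv.eq_symm_apply]
      rw [Subtype.ext_iff]
    rw [this]
    exact P.measurableSet_fiber _
  have ef : ∀ x, f x = (fun i => (e.symm i).1.1) (π x) := by intro x; simp [hπ, hP]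
  have eg : ∀ x, g x = (fun i => (e.symm i).1.2) (π x) := by intro x; simp [hπ, hP]
  simp only [ef, eg] at hf hg ⊢
  exact step_bound π hm (fun i => (e.symm i).1.1) (fun i => (e.symm i).1.2) ν W hWm hW hf hg

lemma approx_seq (f : ℝ → ℝ) (hf : Measurable f) :
    ∃ F : ℕ → SimpleFunc ℝ ℝ, (∀ x, Tendsto (fun k => F k x) atTop (𝓝 (f x))) ∧ ∀ k x, |F k x| ≤ 2 * |f x| := by
  refine ⟨fun k => SimpleFunc.approxOn f hf Set.univ 0 (Set.mem_univ 0) k, fun x => ?_, fun k x => ?_⟩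
  · exact SimpleFunc.tendsto_approxOn hf (Set.mem_univ 0) (by simp)
  · have := SimpleFunc.norm_approxOn_zero_le hf (Set.mem_univ 0) x k
    simp only [Real.norm_eq_abs] at this
    linarith

lemma tend_parts (f : ℝ → ℝ) (hf : Measurable f) (ν : Measure ℝ) [IsProbabilityMeasure ν]
    (hi : Integrable f ν) (hi2 : Integrable (fun x => f x ^ 2) ν)
    (W : ℝ × ℝ → ℝ) (hWm : Measurable W) (hW : ∀ z, 0 ≤ W z ∧ W z ≤ 1) :
    ∃ F : ℕ → SimpleFunc ℝ ℝ, Tendsto (fun k => ∫ x, F k x ^ 2 ∂ν) atTop (𝓝 (∫ x, f x ^ 2 ∂ν)) ∧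
      Tendsto (fun k => ∫ z, W z * (F k z.1 * F k z.2) ∂(ν.prod ν)) atTop (𝓝 (∫ z, W z * (f z.1 * f z.2) ∂(ν.prod ν))) := by
  obtain ⟨F, h1, h2⟩ := approx_seq f hf
  refine ⟨F, ?_, ?_⟩
  · refine tendsto_integral_of_dominated_convergence (fun x => 4 * f x ^ 2) (fun k => ?_) (hi2.const_mul 4) (fun k => ?_) ?_
    · exact ((F k).measurable.pow_const 2).aestronglyMeasurable
    · refine Eventually.of_forall fun x => ?_
      rw [Real.norm_of_nonneg (sq_nonneg _), ← sq_abs, ← sq_abs (f x)]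
      have := h2 k x
      nlinarith [abs_nonneg (F k x)]
    · exact Eventually.of_forall fun x => (h1 x).pow 2
  · refine tendsto_integral_of_dominated_convergence (fun z => 4 * (|f z.1| * |f z.2|)) (fun k => ?_)
      ((hi.abs.mul_prod hi.abs).const_mul 4) (fun k => ?_) ?_
    · have m1 : Measurable (F k) := (F k).measurable
      exact (hWm.mul ((m1.comp measurable_fst).mul (m1.comp measurable_snd))).aestronglyMeasurable
    · refine Eventually.of_forall fun z => ?_
      rw [norm_mul, norm_mul, Real.norm_of_nonneg (hW z).1, Real.norm_eq_abs, Real.norm_eq_abs]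
      have a1 := h2 k z.1
      have a2 := h2 k z.2
      have a3 : |F k z.1| * |F k z.2| ≤ (2 * |f z.1|) * (2 * |f z.2|) := by gcongr
      have a4 : 0 ≤ |F k z.1| * |F k z.2| := by positivity
      nlinarith [hW z]
    · exact Eventually.of_forall fun z => ((h1 z.1).mul (h1 z.2)).const_mul _

lemma prod_bound (f g : ℝ → ℝ) (hfm : Measurable f) (hgm : Measurable g) (ν : Measure ℝ) [IsProbabilityMeasure ν]
    (W : ℝ × ℝ → ℝ) (hWm : Measurable W) (hW : ∀ z, 0 ≤ W z ∧ W z ≤ 1)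
    (hf : ∫ x, f x ^ 2 ∂ν = 1) (hg : ∫ x, g x ^ 2 ∂ν = 1) :
    ∫ x, ∫ y, W (x, y) * (f x * f y - g x * g y) ∂ν ∂ν ≤ 2 / √3 := by
  have int2 : ∀ f : ℝ → ℝ, ∫ x, f x ^ 2 ∂ν = 1 → Integrable (fun x => f x ^ 2) ν := by
    intro f hf
    by_contra hc
    rw [integral_undef hc] at hf
    norm_num at hf
  have int1 : ∀ f : ℝ → ℝ, Measurable f → ∫ x, f x ^ 2 ∂ν = 1 → Integrable f ν := by
    intro f hm hf
    refine Integrable.mono' ((integrable_const (1:ℝ)).add (int2 f hf)) hm.aestronglyMeasurable (Eventually.of_forall fun x => ?_)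
    rw [Real.norm_eq_abs]
    simp only [Pi.add_apply]
    rw [← sq_abs]
    nlinarith [sq_nonneg (|f x| - 1), abs_nonneg (f x)]
  have intW : ∀ f : ℝ → ℝ, Integrable f ν → Integrable (fun z : ℝ × ℝ => W z * (f z.1 * f z.2)) (ν.prod ν) := by
    intro f hi
    exact (hi.mul_prod hi).bdd_mul (c := 1) hWm.aestronglyMeasurable
      (Eventually.of_forall fun z => by rw [Real.norm_of_nonneg (hW z).1]; exact (hW z).2)
  obtain ⟨Fs, F1, F2⟩ := tend_parts f hfm ν (int1 f hfm hf) (int2 f hf) W hWm hW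
  obtain ⟨Gs, G1, G2⟩ := tend_parts g hgm ν (int1 g hgm hg) (int2 g hg) W hWm hW
  have e : ∫ x, ∫ y, W (x, y) * (f x * f y - g x * g y) ∂ν ∂ν
      = (∫ z, W z * (f z.1 * f z.2) ∂(ν.prod ν)) - ∫ z, W z * (g z.1 * g z.2) ∂(ν.prod ν) := by
    rw [← integral_sub (intW f (int1 f hfm hf)) (intW g (int1 g hgm hg)), integral_prod]
    · refine integral_congr_ae (Eventually.of_forall fun x => integral_congr_ae (Eventually.of_forall fun y => ?_))
      dsimp only; ring
    · exact (intW f (int1 f hfm hf)).sub (intW g (int1 g hgm hg))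
  rw [e]
  rw [hf] at F1
  rw [hg] at G1
  have lim := ((F1.inv₀ one_ne_zero).mul F2).sub ((G1.inv₀ one_ne_zero).mul G2)
  rw [inv_one, one_mul, one_mul] at lim
  refine le_of_tendsto lim ?_
  filter_upwards [F1.eventually (lt_mem_nhds one_pos), G1.eventually (lt_mem_nhds one_pos)] with k k1 k2
  exact simple_bound (Fs k) (Gs k) ν W hWm hW k1 k2

end S11

/-- For any graphon `W` and unit `f, g ∈ L²[0,1]`,
`⟨f, A_W f⟩ − ⟨g, A_W g⟩ ≤ 2/√3`. -/
theorem graphon_spread_le (W : ℝ → ℝ → ℝ) (hW : IsGraphon W)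
    (f g : ℝ → ℝ) (hf : IsUnitL2 f) (hg : IsUnitL2 g) :
    (∫ x in Set.Icc (0 : ℝ) 1, ∫ y in Set.Icc (0 : ℝ) 1,
      W x y * (f x * f y - g x * g y)) ≤ 2 / Real.sqrt 3 := by
  have : IsProbabilityMeasure (volume.restrict (Set.Icc (0 : ℝ) 1)) := ⟨by simp⟩
  exact prod_bound f g hf.1 hg.1 (volume.restrict (Set.Icc (0 : ℝ) 1)) (Function.uncurry W) hW.1
    (fun z => hW.2.1 z.1 z.2) hf.2 hg.2
end
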